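/- Fix integers n and k with 3 ≤ k ≤ n, and let t ≥ 0 be an integer. Then H_{t(k−2)}(M_{n,k}; ℤ) is a free abelian group whose rank equals the number of pairs (w, T) where w is a permutation of {1, …, n+1} and T ⊆ Des(w), such that: (1) the subgraph of the path graph on {1, …, n} induced by T has exactly t connected components, each with exactly k−2 vertices; (2) for every connected component C of the induced subgraph on T, there exists v ∈ Des(w) with v ∉ T such that v is adjacent (in the path graph) to some vertex of C, v < min C, and v is not adjacent to any vertex of any other connected component of the induced subgraph on T; and (3) every v ∈ Des(w) ∖ T is adjacent (in the path graph) to some vertex of T. -/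

import Mathlib

open CategoryTheory

/-- The singular chain complex of a topological space with `ℤ` coefficients. -/
noncomputable def singularChainComplex (X : TopCat) : ChainComplex (ModuleCat ℤ) ℕ :=
  (AlgebraicTopology.alternatingFaceMapComplex (ModuleCat ℤ)).obj
    (((SimplicialObject.whiskering _ _).obj (ModuleCat.free ℤ)).obj (TopCat.toSSet.obj X))

/-- The `i`-th singular homology of a topological space with `ℤ` coefficients. -/
noncomputable def singularHomology (X : TopCat) (i : ℕ) : ModuleCat ℤ :=
  (singularChainComplex X).homology i

/-- The complement of the `k`-equal arrangement in `ℝ^{n+1}`. -/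
def kEqualComplement (n k : ℕ) : Set (Fin (n + 1) → ℝ) :=
  {x | ∀ S : Finset (Fin (n + 1)), S.card = k → ¬ (∀ i ∈ S, ∀ j ∈ S, x i = x j)}

/-- `i` is a descent of the permutation `w` of `{1, …, n+1}` (with `i ∈ {1, …, n}`):
`w(i) > w(i+1)`. -/
def IsDescent {n : ℕ} (w : Equiv.Perm (Fin (n + 1))) (i : Fin n) : Prop :=
  w i.succ < w i.castSucc

/-- The conditions on a pair `(w, T)` counted by the Betti number `β_{t(k-2)}` of the
complement of the `k`-equal arrangement. -/
def IsCriticalPair (n k t : ℕ) (p : Equiv.Perm (Fin (n + 1)) × Finset (Fin n)) : Prop :=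
  -- `T ⊆ Des(w)`
  (∀ i ∈ p.2, IsDescent p.1 i) ∧
  -- (1) the subgraph of the path graph induced by `T` has exactly `t` components,
  -- each with exactly `k - 2` vertices
  (Nat.card ((SimpleGraph.pathGraph n).induce (p.2 : Set (Fin n))).ConnectedComponent = t) ∧
  (∀ c : ((SimpleGraph.pathGraph n).induce (p.2 : Set (Fin n))).ConnectedComponent,
      Nat.card c.supp = k - 2) ∧
  -- (2) each component `C` has a descent `v ∉ T`, adjacent to `C`, with `v < min C`,
  -- not adjacent to any other component
  (∀ c : ((SimpleGraph.pathGraph n).induce (p.2 : Set (Fin n))).ConnectedComponent,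
      ∃ v : Fin n, IsDescent p.1 v ∧ v ∉ p.2 ∧
        (∃ u ∈ c.supp, (SimpleGraph.pathGraph n).Adj v (u : Fin n)) ∧
        (∀ u ∈ c.supp, v < (u : Fin n)) ∧
        (∀ c' : ((SimpleGraph.pathGraph n).induce (p.2 : Set (Fin n))).ConnectedComponent,
          c' ≠ c → ∀ u ∈ c'.supp, ¬ (SimpleGraph.pathGraph n).Adj v (u : Fin n))) ∧
  -- (3) every descent not in `T` is adjacent to some vertex of `T`
  (∀ v : Fin n, IsDescent p.1 v → v ∉ p.2 → ∃ u ∈ p.2, (SimpleGraph.pathGraph n).Adj v u)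

/-- The singular chain complex functor. -/
noncomputable def SC : TopCat.{0} ⥤ ChainComplex (ModuleCat.{0} ℤ) ℕ :=
  TopCat.toSSet ⋙ (SimplicialObject.whiskering _ _).obj (ModuleCat.free ℤ) ⋙
    AlgebraicTopology.alternatingFaceMapComplex (ModuleCat ℤ)

lemma SC_obj (X : TopCat.{0}) : SC.obj X = singularChainComplex X := rfl

/-- Homotopic maps induce chain homotopic maps. -/
noncomputable def SC_homotopy {X Y : TopCat.{0}} {f g : X ⟶ Y} (H : TopCat.Homotopy f g) :
    Homotopy (SC.map f) (SC.map g) :=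
  SimplicialObject.Homotopy.toChainHomotopy
    ((H.toSSet.toSimplicialObjectHomotopy).whiskerRight (ModuleCat.free ℤ))

lemma SC_quasiIso {X Y : TopCat.{0}} (f : X ⟶ Y) (g : Y ⟶ X)
    (h₁ : (g.hom.comp f.hom).Homotopic (ContinuousMap.id X))
    (h₂ : (f.hom.comp g.hom).Homotopic (ContinuousMap.id Y)) : QuasiIso (SC.map f) := by
  obtain ⟨H₁⟩ := h₁
  obtain ⟨H₂⟩ := h₂
  let e : HomotopyEquiv (SC.obj X) (SC.obj Y) :=
    { hom := SC.map f
      inv := SC.map g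
      homotopyHomInvId := (Homotopy.ofEq (SC.map_comp f g).symm).trans
        ((SC_homotopy (f := f ≫ g) (g := 𝟙 X) H₁).trans (Homotopy.ofEq (SC.map_id X)))
      homotopyInvHomId := (Homotopy.ofEq (SC.map_comp g f).symm).trans
        ((SC_homotopy (f := g ≫ f) (g := 𝟙 Y) H₂).trans (Homotopy.ofEq (SC.map_id Y))) }
  exact e.quasiIso_hom


/-- The standard simplex. -/
abbrev Dl (n : ℕ) : Type := stdSimplex ℝ (Fin (n + 1))

/-- The basis element of a singular simplex. -/
noncomputable def sx {X : TopCat.{0}} {n : ℕ} (σ : C(Dl n, X)) : (SC.obj X).X n :=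
  (Finsupp.single ((TopCat.toSSetObjEquiv X (Opposite.op (SimplexCategory.mk n))).symm σ) 1 :
    (TopCat.toSSet.obj X).obj (Opposite.op (SimplexCategory.mk n)) →₀ ℤ)

/-- Linear extension from singular simplices. -/
noncomputable def sxLift {X : TopCat.{0}} {n : ℕ} {M : Type*} [AddCommGroup M] [hM : Module ℤ M]
    (φ : C(Dl n, X) → M) : (SC.obj X).X n →ₗ[ℤ] M :=
  (Finsupp.lift M ℤ ((TopCat.toSSet.obj X).obj (Opposite.op (SimplexCategory.mk n)))
    (fun s => φ (TopCat.toSSetObjEquiv X (Opposite.op (SimplexCategory.mk n)) s)) :)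

lemma sxLift_sx {X : TopCat.{0}} {n : ℕ} {M : Type*} [AddCommGroup M] [hM : Module ℤ M]
    (φ : C(Dl n, X) → M) (σ : C(Dl n, X)) : sxLift φ (sx σ) = φ σ := by
  unfold sxLift sx
  erw [Finsupp.lift_apply, Finsupp.sum_single_index]
  · refine (hM.one_smul _).trans ?_
    rw [Equiv.apply_symm_apply]
  · exact hM.zero_smul _

lemma sx_induction {X : TopCat.{0}} {n : ℕ} {p : (SC.obj X).X n → Prop}
    (h0 : p 0) (hadd : ∀ a b, p a → p b → p (a + b)) (hsmul : ∀ (m : ℤ) (a), p a → p (m • a))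
    (hs : ∀ σ, p (sx σ)) (x : (SC.obj X).X n) : p x := by
  have : ∀ y : (TopCat.toSSet.obj X).obj (Opposite.op (SimplexCategory.mk n)) →₀ ℤ,
      p y := by
    intro y
    induction y using Finsupp.induction_linear with
    | zero => exact h0
    | add f g hf hg => exact hadd _ _ hf hg
    | single a b =>
      have := hsmul b _ (hs ((TopCat.toSSetObjEquiv X _) a))
      convert this
      unfold sx
      simp only [Equiv.symm_apply_apply]
      erw [Finsupp.smul_single]
      simp
  exact this x

lemma SC_map_sx {X Y : TopCat.{0}} (f : X ⟶ Y) {n : ℕ} (σ : C(Dl n, X)) :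
    ((SC.map f).f n).hom (sx σ) = sx (f.hom.comp σ) := by
  change Finsupp.mapDomain _ (Finsupp.single _ _) = _
  rw [Finsupp.mapDomain_single]
  rfl

/-- The face inclusion of standard simplices. -/
noncomputable def faceMap {n : ℕ} (i : Fin (n + 2)) : C(Dl n, Dl (n + 1)) :=
  ⟨stdSimplex.map i.succAbove, stdSimplex.continuous_map _⟩

lemma modSum_hom_apply {n : ℕ} {A B : ModuleCat.{0} ℤ} (f : Fin n → (A ⟶ B)) (x : A) :
    (∑ i : Fin n, (-1 : ℤ) ^ (i : ℕ) • f i : A ⟶ B).hom x =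
      ∑ i : Fin n, (-1 : ℤ) ^ (i : ℕ) • (f i).hom x := by
  rw [ModuleCat.hom_sum, LinearMap.sum_apply]
  simp

lemma SC_d_sx {X : TopCat.{0}} {n : ℕ} (σ : C(Dl (n + 1), X)) :
    ((SC.obj X).d (n + 1) n).hom (sx σ) =
      ∑ i : Fin (n + 2), (-1 : ℤ) ^ (i : ℕ) • sx (σ.comp (faceMap i)) := by
  have h : (SC.obj X).d (n + 1) n = ∑ i : Fin (n + 2), (-1 : ℤ) ^ (i : ℕ) •
    (((SimplicialObject.whiskering _ _).obj (ModuleCat.free ℤ)).obj (TopCat.toSSet.obj X)).δ i := by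
    exact AlgebraicTopology.alternatingFaceMapComplex_obj_d _ _
  have h2 := congrArg (fun f => ModuleCat.Hom.hom f (sx σ)) h
  refine (h2.trans (modSum_hom_apply _ _)).trans ?_
  refine Finset.sum_congr rfl fun i _ => ?_
  congr 1
  change Finsupp.mapDomain _ (Finsupp.single _ _) = _
  rw [Finsupp.mapDomain_single]
  rfl

lemma SC_map_injective {X Y : TopCat.{0}} (f : X ⟶ Y) (hf : Function.Injective f.hom) (n : ℕ) :
    Function.Injective ((SC.map f).f n).hom := by
  change Function.Injective (Finsupp.mapDomain _)
  apply Finsupp.mapDomain_injective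
  intro a b hab
  apply (TopCat.toSSetObjEquiv X _).injective
  have h2 := congrArg (TopCat.toSSetObjEquiv Y _) hab
  ext x
  exact hf (DFunLike.congr_fun h2 x)

instance SC_mono {X Y : TopCat.{0}} (f : X ⟶ Y) [Mono f] : Mono (SC.map f) := by
  have : ∀ n, Mono ((SC.map f).f n) := fun n => by
    rw [ModuleCat.mono_iff_injective]
    exact SC_map_injective f ((TopCat.mono_iff_injective f).1 inferInstance) n
  exact HomologicalComplex.mono_of_mono_f _ this

/-! ### Affine simplices and linear chains -/

/-- The affine map between standard simplices with given images of vertices. -/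
noncomputable def aff {m n : ℕ} (v : Fin (n + 1) → Dl m) : C(Dl n, Dl m) where
  toFun t := ⟨∑ i, t.1 i • (v i).1,
    (convex_stdSimplex ℝ (Fin (m + 1))).sum_mem (fun i _ => t.2.1 i) t.2.2 (fun i _ => (v i).2)⟩
  continuous_toFun := by
    refine Continuous.subtype_mk ?_ _
    refine continuous_finsetSum _ fun i _ => ?_
    exact ((continuous_apply i).comp continuous_subtype_val).smul continuous_const

lemma aff_coe {m n : ℕ} (v : Fin (n + 1) → Dl m) (t : Dl n) :
    (aff v t).1 = ∑ i, t.1 i • (v i).1 := rfl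

/-- The vertices of the standard simplex. -/
noncomputable def vtx (n : ℕ) (i : Fin (n + 1)) : Dl n := stdSimplex.vertex i

lemma vtx_coe (n : ℕ) (i : Fin (n + 1)) : (vtx n i).1 = Pi.single i 1 := by
  rfl

lemma aff_vtx {m n : ℕ} (v : Fin (n + 1) → Dl m) (i : Fin (n + 1)) : aff v (vtx n i) = v i := by
  apply Subtype.ext
  rw [aff_coe, vtx_coe]
  simp [Pi.single_apply]

lemma aff_comp_aff {l m n : ℕ} (u : Fin (m + 1) → Dl l) (v : Fin (n + 1) → Dl m) :
    (aff u).comp (aff v) = aff (fun i => aff u (v i)) := by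
  ext t : 1
  apply Subtype.ext
  rw [ContinuousMap.comp_apply, aff_coe, aff_coe, aff_coe]
  simp only [aff_coe, Finset.smul_sum, Finset.sum_apply, Finset.sum_smul, Pi.smul_apply,
    smul_eq_mul, mul_smul]
  rw [Finset.sum_comm]

lemma aff_vtx_id (n : ℕ) : aff (vtx n) = ContinuousMap.id _ := by
  ext t : 1
  apply Subtype.ext
  rw [aff_coe]
  ext j
  simp [vtx_coe, Pi.single_apply]

lemma faceMap_eq_aff {n : ℕ} (i : Fin (n + 2)) :
    faceMap i = aff (fun j => vtx (n + 1) (i.succAbove j)) := by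
  ext t : 1
  apply Subtype.ext
  rw [aff_coe]
  ext j
  change FunOnFinite.linearMap ℝ ℝ _ _ _ = _
  rw [FunOnFinite.linearMap_apply_apply]
  simp only [vtx_coe, Finset.sum_apply, Pi.smul_apply, Pi.single_apply, smul_eq_mul, mul_ite, mul_one, mul_zero]
  rw [Finset.sum_filter]
  refine Finset.sum_congr rfl fun x _ => ?_
  simp only [eq_comm]
  rfl

lemma aff_comp_faceMap {m n : ℕ} (v : Fin (n + 2) → Dl m) (i : Fin (n + 2)) :
    (aff v).comp (faceMap i) = aff (fun j => v (i.succAbove j)) := by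
  rw [faceMap_eq_aff, aff_comp_aff]
  simp only [aff_vtx]

/-- The barycenter of an affine simplex. -/
noncomputable def bary {m n : ℕ} (v : Fin (n + 1) → Dl m) : Dl m := aff v stdSimplex.barycenter

lemma bary_aff {l m n : ℕ} (u : Fin (m + 1) → Dl l) (v : Fin (n + 1) → Dl m) :
    bary (fun i => aff u (v i)) = aff u (bary v) := by
  rw [bary, ← aff_comp_aff]; rfl

/-- Linear chains. -/
abbrev LC (m n : ℕ) : Type := (Fin (n + 1) → Dl m) →₀ ℤ

/-- Boundary of linear chains. -/
noncomputable def dL {m n : ℕ} : LC m (n + 1) →ₗ[ℤ] LC m n :=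
  Finsupp.lift _ ℤ _ fun v => ∑ i : Fin (n + 2),
    (-1 : ℤ) ^ (i : ℕ) • Finsupp.single (fun j => v (i.succAbove j)) (1 : ℤ)

lemma dL_single {m n : ℕ} (v : Fin (n + 2) → Dl m) :
    dL (Finsupp.single v 1) = ∑ i : Fin (n + 2),
      (-1 : ℤ) ^ (i : ℕ) • Finsupp.single (fun j => v (i.succAbove j)) (1 : ℤ) := by
  simp [dL]

/-- Cone. -/
noncomputable def coneL {m n : ℕ} (b : Dl m) : LC m n →ₗ[ℤ] LC m (n + 1) :=
  Finsupp.lmapDomain ℤ ℤ (fun v => (Fin.cons b v : Fin (n + 2) → Dl m))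

lemma coneL_single {m n : ℕ} (b : Dl m) (v : Fin (n + 1) → Dl m) :
    coneL b (Finsupp.single v 1) = Finsupp.single (Fin.cons b v : Fin (n + 2) → Dl m) 1 := by
  simp [coneL]

lemma LC_hom_ext {m n : ℕ} {M : Type*} [AddCommGroup M] [Module ℤ M] {f g : LC m n →ₗ[ℤ] M}
    (h : ∀ v, f (Finsupp.single v 1) = g (Finsupp.single v 1)) : f = g := by
  apply Finsupp.lhom_ext'
  intro v
  ext
  exact h v

lemma dL_coneL {m n : ℕ} (b : Dl m) (c : LC m (n + 1)) :
    dL (coneL b c) = c - coneL b (dL c) := by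
  suffices h : dL ∘ₗ coneL b = LinearMap.id - coneL b ∘ₗ (dL : LC m (n + 1) →ₗ[ℤ] LC m n) from
    LinearMap.congr_fun h c
  refine LC_hom_ext fun v => ?_
  simp only [LinearMap.comp_apply, LinearMap.sub_apply, LinearMap.id_apply, coneL_single, dL_single]
  rw [Fin.sum_univ_succ]
  simp only [Fin.val_zero, pow_zero, one_smul, Fin.zero_succAbove, Fin.cons_succ, map_sum, map_zsmul,
    coneL_single]
  rw [sub_eq_add_neg, ← Finset.sum_neg_distrib]
  congr 1
  refine Finset.sum_congr rfl fun i _ => ?_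
  rw [Fin.val_succ, pow_succ, mul_neg_one, neg_smul]
  congr 3
  ext j : 1
  refine Fin.cases ?_ (fun j => ?_) j <;> simp

lemma dL_coneL_zero {m : ℕ} (b : Dl m) (v : Fin 1 → Dl m) :
    dL (coneL b (Finsupp.single v 1)) = Finsupp.single v 1 - Finsupp.single (fun _ => b) (1 : ℤ) := by
  rw [coneL_single, dL_single, Fin.sum_univ_two]
  simp only [Fin.val_zero, pow_zero, one_smul, Fin.zero_succAbove, Fin.cons_succ, Fin.val_one, pow_one,
    neg_smul, sub_eq_add_neg]
  congr 4
  ext j : 1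
  have : j = 0 := Fin.eq_zero j
  subst this
  simp

/-- Push forward a linear chain along a singular simplex. -/
noncomputable def push {X : TopCat.{0}} {m n : ℕ} (σ : C(Dl m, X)) : LC m n →ₗ[ℤ] (SC.obj X).X n :=
  Finsupp.lift _ ℤ _ fun v => sx (σ.comp (aff v))

lemma push_single {X : TopCat.{0}} {m n : ℕ} (σ : C(Dl m, X)) (v : Fin (n + 1) → Dl m) :
    push σ (Finsupp.single v 1) = sx (σ.comp (aff v)) := by
  unfold push
  rw [Finsupp.lift_apply, Finsupp.sum_single_index]
  · exact one_smul ℤ _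
  · exact zero_smul ℤ _

lemma push_vtx {X : TopCat.{0}} {n : ℕ} (σ : C(Dl n, X)) :
    push σ (Finsupp.single (vtx n) 1) = sx σ := by
  rw [push_single, aff_vtx_id]; rfl

lemma d_push {X : TopCat.{0}} {m n : ℕ} (σ : C(Dl m, X)) (c : LC m (n + 1)) :
    ((SC.obj X).d (n + 1) n).hom (push σ c) = push σ (dL c) := by
  suffices h : ((SC.obj X).d (n + 1) n).hom ∘ₗ push σ = push σ ∘ₗ dL from LinearMap.congr_fun h c
  refine LC_hom_ext fun v => ?_
  simp only [LinearMap.comp_apply, push_single, SC_d_sx, dL_single, map_sum, map_zsmul,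
    ContinuousMap.comp_assoc, aff_comp_faceMap]

lemma push_id_injective (m n : ℕ) :
    Function.Injective (push (X := TopCat.of (Dl m)) (n := n) (ContinuousMap.id (Dl m))) := by
  have : (push (X := TopCat.of (Dl m)) (n := n) (ContinuousMap.id (Dl m))) =
    (Finsupp.lmapDomain ℤ ℤ (fun v : Fin (n + 1) → Dl m => (TopCat.toSSetObjEquiv (TopCat.of (Dl m))
      (Opposite.op (SimplexCategory.mk n))).symm (aff v)) :) := by
    refine LC_hom_ext fun v => ?_
    rw [push_single]
    erw [Finsupp.lmapDomain_apply, Finsupp.mapDomain_single]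
    rfl
  rw [this]
  apply Finsupp.mapDomain_injective
  refine (Equiv.injective _).comp ?_
  intro u v huv
  ext i : 1
  rw [← aff_vtx u, ← aff_vtx v]
  exact DFunLike.congr_fun huv _

lemma dL_dL {m n : ℕ} (c : LC m (n + 2)) : dL (dL c) = 0 := by
  apply push_id_injective
  rw [← d_push, ← d_push, map_zero]
  have := (SC.obj (TopCat.of (Dl m))).d_comp_d (n + 2) (n + 1) n
  exact LinearMap.congr_fun (congrArg ModuleCat.Hom.hom this) _

/-- Affine push-forward of linear chains. -/
noncomputable def affL {l m n : ℕ} (u : Fin (m + 1) → Dl l) : LC m n →ₗ[ℤ] LC l n :=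
  Finsupp.lmapDomain ℤ ℤ (fun v i => aff u (v i))

lemma affL_single {l m n : ℕ} (u : Fin (m + 1) → Dl l) (v : Fin (n + 1) → Dl m) :
    affL u (Finsupp.single v 1) = Finsupp.single (fun i => aff u (v i)) 1 := by
  simp [affL]

lemma affL_vtx {m n : ℕ} (v : Fin (n + 1) → Dl m) :
    affL v (Finsupp.single (vtx n) 1) = Finsupp.single v 1 := by
  simp only [affL_single, aff_vtx]

lemma affL_dL {l m n : ℕ} (u : Fin (m + 1) → Dl l) (c : LC m (n + 1)) :
    dL (affL u c) = affL u (dL c) := by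
  suffices h : dL ∘ₗ affL u = affL u ∘ₗ (dL : LC m (n + 1) →ₗ[ℤ] LC m n) from
    LinearMap.congr_fun h c
  refine LC_hom_ext fun v => ?_
  simp only [LinearMap.comp_apply, affL_single, dL_single, map_sum, map_zsmul]

lemma affL_coneL {l m n : ℕ} (u : Fin (m + 1) → Dl l) (b : Dl m) (c : LC m n) :
    coneL (aff u b) (affL u c) = affL u (coneL b c) := by
  suffices h : coneL (aff u b) ∘ₗ affL u = affL u ∘ₗ (coneL b : LC m n →ₗ[ℤ] LC m (n + 1)) from
    LinearMap.congr_fun h c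
  refine LC_hom_ext fun v => ?_
  simp only [LinearMap.comp_apply, affL_single, coneL_single]
  congr 1
  ext j : 1
  refine Fin.cases ?_ (fun j => ?_) j <;> simp

lemma push_affL {X : TopCat.{0}} {l m n : ℕ} (σ : C(Dl l, X)) (u : Fin (m + 1) → Dl l) (c : LC m n) :
    push σ (affL u c) = push (σ.comp (aff u)) c := by
  suffices h : push σ ∘ₗ affL u = (push (σ.comp (aff u)) : LC m n →ₗ[ℤ] _) from
    LinearMap.congr_fun h c
  refine LC_hom_ext fun v => ?_
  simp only [LinearMap.comp_apply, affL_single, push_single, ContinuousMap.comp_assoc, aff_comp_aff]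

/-- Barycentric subdivision of linear chains. -/
noncomputable def sdL {m : ℕ} : (n : ℕ) → LC m n →ₗ[ℤ] LC m n
  | 0 => LinearMap.id
  | n + 1 => Finsupp.lift _ ℤ _ fun v => coneL (bary v) (sdL n (dL (Finsupp.single v 1)))

/-- The homotopy from the identity to the subdivision. -/
noncomputable def TL {m : ℕ} : (n : ℕ) → LC m n →ₗ[ℤ] LC m (n + 1)
  | 0 => 0
  | n + 1 => Finsupp.lift _ ℤ _ fun v =>
      coneL (bary v) (Finsupp.single v 1 - TL n (dL (Finsupp.single v 1)))

lemma sdL_succ {m n : ℕ} (v : Fin (n + 2) → Dl m) :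
    sdL (n + 1) (Finsupp.single v 1) = coneL (bary v) (sdL n (dL (Finsupp.single v 1))) := by
  simp [sdL]

lemma TL_succ {m n : ℕ} (v : Fin (n + 2) → Dl m) :
    TL (n + 1) (Finsupp.single v 1) =
      coneL (bary v) (Finsupp.single v 1 - TL n (dL (Finsupp.single v 1))) := by
  simp [TL]

lemma dL_sdL {m : ℕ} (n : ℕ) (c : LC m (n + 1)) : dL (sdL (n + 1) c) = sdL n (dL c) := by
  induction n with
  | zero =>
    suffices h : dL ∘ₗ sdL 1 = sdL 0 ∘ₗ (dL : LC m 1 →ₗ[ℤ] LC m 0) from LinearMap.congr_fun h c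
    refine LC_hom_ext fun v => ?_
    simp only [LinearMap.comp_apply, sdL_succ]
    rw [dL_single, Fin.sum_univ_two]
    simp only [sdL, LinearMap.id_apply, map_add, map_smul, dL_coneL_zero, smul_sub]
    simp
  | succ n ih =>
    suffices h : dL ∘ₗ sdL (n + 2) = sdL (n + 1) ∘ₗ (dL : LC m (n + 2) →ₗ[ℤ] LC m (n + 1)) from
      LinearMap.congr_fun h c
    refine LC_hom_ext fun v => ?_
    simp only [LinearMap.comp_apply, sdL_succ]
    rw [dL_coneL, ih, dL_dL, map_zero, map_zero, sub_zero]

lemma dL_TL {m : ℕ} (n : ℕ) (c : LC m (n + 1)) :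
    dL (TL (n + 1) c) = c - sdL (n + 1) c - TL n (dL c) := by
  induction n with
  | zero =>
    suffices h : dL ∘ₗ TL 1 = LinearMap.id - sdL 1 - TL 0 ∘ₗ (dL : LC m 1 →ₗ[ℤ] LC m 0) from
      LinearMap.congr_fun h c
    refine LC_hom_ext fun v => ?_
    simp only [LinearMap.comp_apply, LinearMap.sub_apply, LinearMap.id_apply]
    rw [sdL_succ, TL_succ, dL_coneL]
    simp only [TL, sdL, LinearMap.zero_apply, sub_zero, LinearMap.id_apply]
  | succ n ih =>
    suffices h : dL ∘ₗ TL (n + 2) = LinearMap.id - sdL (n + 2) -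
        TL (n + 1) ∘ₗ (dL : LC m (n + 2) →ₗ[ℤ] LC m (n + 1)) from LinearMap.congr_fun h c
    refine LC_hom_ext fun v => ?_
    simp only [LinearMap.comp_apply, LinearMap.sub_apply, LinearMap.id_apply, sdL_succ, TL_succ (n := n + 1),
      dL_coneL, map_sub, ih, dL_dL, map_zero, sub_zero]
    abel

lemma affL_sdL {l m : ℕ} (u : Fin (m + 1) → Dl l) (n : ℕ) (c : LC m n) :
    sdL n (affL u c) = affL u (sdL n c) := by
  induction n with
  | zero => rfl
  | succ n ih =>
    suffices h : sdL (n + 1) ∘ₗ affL u = affL u ∘ₗ sdL (n + 1) from LinearMap.congr_fun h c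
    refine LC_hom_ext fun v => ?_
    simp only [LinearMap.comp_apply]
    rw [affL_single, sdL_succ, sdL_succ, bary_aff, ← affL_coneL, ← ih, ← affL_dL, affL_single]

lemma affL_TL {l m : ℕ} (u : Fin (m + 1) → Dl l) (n : ℕ) (c : LC m n) :
    TL n (affL u c) = affL u (TL n c) := by
  induction n with
  | zero => simp [TL]
  | succ n ih =>
    suffices h : TL (n + 1) ∘ₗ affL u = affL u ∘ₗ TL (n + 1) from LinearMap.congr_fun h c
    refine LC_hom_ext fun v => ?_
    simp only [LinearMap.comp_apply]
    rw [affL_single, TL_succ, TL_succ, bary_aff, ← affL_coneL, map_sub (affL u), ← ih, ← affL_dL, affL_single]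

/-! ### Subdivision of singular chains -/

/-- Subdivision of singular chains. -/
noncomputable def Sd {X : TopCat.{0}} (n : ℕ) : (SC.obj X).X n →ₗ[ℤ] (SC.obj X).X n :=
  sxLift fun σ => push σ (sdL n (Finsupp.single (vtx n) 1))

/-- Homotopy of singular chains. -/
noncomputable def Th {X : TopCat.{0}} (n : ℕ) : (SC.obj X).X n →ₗ[ℤ] (SC.obj X).X (n + 1) :=
  sxLift fun σ => push σ (TL n (Finsupp.single (vtx n) 1))

lemma Sd_push {X : TopCat.{0}} {m n : ℕ} (σ : C(Dl m, X)) (c : LC m n) :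
    Sd n (push σ c) = push σ (sdL n c) := by
  suffices h : Sd n ∘ₗ push σ = push σ ∘ₗ sdL n from LinearMap.congr_fun h c
  refine LC_hom_ext fun v => ?_
  simp only [LinearMap.comp_apply, push_single, Sd, sxLift_sx]
  rw [← push_affL, ← affL_sdL, affL_vtx]

lemma Th_push {X : TopCat.{0}} {m n : ℕ} (σ : C(Dl m, X)) (c : LC m n) :
    Th n (push σ c) = push σ (TL n c) := by
  suffices h : Th n ∘ₗ push σ = push σ ∘ₗ TL n from LinearMap.congr_fun h c
  refine LC_hom_ext fun v => ?_
  simp only [LinearMap.comp_apply, push_single, Th, sxLift_sx]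
  rw [← push_affL, ← affL_TL, affL_vtx]

lemma SC_hom_ext {X : TopCat.{0}} {n : ℕ} {M : Type*} [AddCommGroup M] [Module ℤ M]
    {f g : (SC.obj X).X n →ₗ[ℤ] M} (h : ∀ σ, f (sx σ) = g (sx σ)) (z : (SC.obj X).X n) :
    f z = g z := by
  refine sx_induction (p := fun z => f z = g z) (by simp) (fun a b ha hb => ?_) (fun m a ha => ?_) h z
  · simp only [map_add, ha, hb]
  · simp only [map_zsmul, ha]

lemma d_Sd {X : TopCat.{0}} (n : ℕ) (z : (SC.obj X).X (n + 1)) :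
    ((SC.obj X).d (n + 1) n).hom (Sd (n + 1) z) = Sd n (((SC.obj X).d (n + 1) n).hom z) := by
  refine SC_hom_ext (f := ((SC.obj X).d (n + 1) n).hom ∘ₗ Sd (n + 1))
    (g := Sd n ∘ₗ ((SC.obj X).d (n + 1) n).hom) (fun σ => ?_) z
  simp only [LinearMap.comp_apply]
  rw [← push_vtx σ, d_push, Sd_push, Sd_push, d_push, dL_sdL]

lemma d_Th {X : TopCat.{0}} (n : ℕ) (z : (SC.obj X).X (n + 1)) :
    ((SC.obj X).d (n + 2) (n + 1)).hom (Th (n + 1) z) =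
      z - Sd (n + 1) z - Th n (((SC.obj X).d (n + 1) n).hom z) := by
  refine SC_hom_ext (f := ((SC.obj X).d (n + 2) (n + 1)).hom ∘ₗ Th (n + 1))
    (g := LinearMap.id - Sd (n + 1) - Th n ∘ₗ ((SC.obj X).d (n + 1) n).hom) (fun σ => ?_) z
  simp only [LinearMap.comp_apply, LinearMap.sub_apply, LinearMap.id_apply]
  rw [← push_vtx σ, d_push, Sd_push, Th_push, Th_push, d_push, dL_TL, map_sub, map_sub]

/-! ### Small simplices -/

lemma dist_aff_le {m n : ℕ} (u : Fin (n + 1) → Dl m) (x : Dl m) (δ : ℝ)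
    (h : ∀ i, dist (u i) x ≤ δ) (t : Dl n) : dist (aff u t) x ≤ δ := by
  have : (aff u t).1 ∈ Metric.closedBall x.1 δ := by
    rw [aff_coe]
    exact (convex_closedBall x.1 δ).sum_mem (fun i _ => t.2.1 i) t.2.2 (fun i _ => h i)
  exact this

lemma dist_bary_le {m n : ℕ} (v : Fin (n + 1) → Dl m) (δ : ℝ)
    (h : ∀ i j, dist (v i) (v j) ≤ δ) (j : Fin (n + 1)) :
    dist (v j) (bary v) ≤ n / (n + 1) * δ := by
  have e : (v j).1 - (bary v).1 = ∑ i, ((n : ℝ) + 1)⁻¹ • ((v j).1 - (v i).1) := by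
    rw [← Finset.smul_sum, Finset.sum_sub_distrib, bary, aff_coe, smul_sub]
    congr 1
    · rw [Finset.sum_const, Finset.card_univ, Fintype.card_fin, ← Nat.cast_smul_eq_nsmul ℝ, smul_smul]
      rw [Nat.cast_succ, inv_mul_cancel₀ (by positivity), one_smul]
    · rw [Finset.smul_sum]
      refine Finset.sum_congr rfl fun i _ => ?_
      congr 1
      have : (stdSimplex.barycenter : Dl n).1 i = (Fintype.card (Fin (n + 1)) : ℝ)⁻¹ := by
        rfl
      rw [this]
      simp
  change dist (v j).1 (bary v).1 ≤ _
  rw [dist_eq_norm, e]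
  refine (norm_sum_le _ _).trans ?_
  have key : ∀ i ∈ Finset.univ, ‖((n : ℝ) + 1)⁻¹ • ((v j).1 - (v i).1)‖ ≤
      if i = j then 0 else ((n : ℝ) + 1)⁻¹ * δ := by
    intro i _
    split_ifs with hi
    · subst hi; simp
    · rw [norm_smul, Real.norm_of_nonneg (by positivity)]
      have := h j i
      rw [Subtype.dist_eq, dist_eq_norm] at this
      gcongr
  refine (Finset.sum_le_sum key).trans (le_of_eq ?_)
  rw [Finset.sum_ite, Finset.sum_const_zero, zero_add, Finset.sum_const, Finset.filter_ne',
    Finset.card_erase_of_mem (Finset.mem_univ _), Finset.card_univ, Fintype.card_fin,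
    Nat.add_sub_cancel, nsmul_eq_mul]
  ring

/-- Simplices with vertices in the image of `v` and of small diameter. -/
def meshSet {m n l : ℕ} (v : Fin (l + 1) → Dl m) (δ : ℝ) : Set (Fin (n + 1) → Dl m) :=
  {u | (∀ i, u i ∈ Set.range (aff v)) ∧ ∀ i j, dist (u i) (u j) ≤ δ}

lemma supported_map {α M : Type*} [AddCommGroup M] [Module ℤ M] (f : (α →₀ ℤ) →ₗ[ℤ] M)
    (S : Set α) (N : Submodule ℤ M) (h : ∀ a ∈ S, f (Finsupp.single a 1) ∈ N) (c : α →₀ ℤ)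
    (hc : c ∈ Finsupp.supported ℤ ℤ S) : f c ∈ N := by
  rw [Finsupp.supported_eq_span_single] at hc
  refine (Submodule.span_le (p := N.comap f)).2 ?_ hc
  rintro _ ⟨a, ha, rfl⟩
  exact h a ha

lemma range_aff_aff {l m n : ℕ} (v : Fin (l + 1) → Dl m) (u : Fin (n + 1) → Dl m)
    (h : ∀ i, u i ∈ Set.range (aff v)) (t : Dl n) : aff u t ∈ Set.range (aff v) := by
  choose w hw using h
  have : u = fun i => aff v (w i) := by ext i : 1; rw [hw]
  rw [this, ← aff_comp_aff]
  exact ⟨_, rfl⟩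

lemma sd_mesh {m : ℕ} (n : ℕ) : ∀ (v : Fin (n + 1) → Dl m) (δ : ℝ),
    (∀ i j, dist (v i) (v j) ≤ δ) →
    sdL n (Finsupp.single v 1) ∈ Finsupp.supported ℤ ℤ (meshSet (n := n) v (n / (n + 1) * δ)) := by
  induction n with
  | zero =>
    intro v δ h
    refine Finsupp.single_mem_supported ℤ _ ⟨fun i => ⟨vtx _ i, aff_vtx _ _⟩, fun i j => ?_⟩
    rw [Fin.eq_zero i, Fin.eq_zero j]
    simp
  | succ n ih =>
    intro v δ h
    have hδ : 0 ≤ δ := dist_nonneg.trans (h 0 0)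
    rw [sdL_succ, dL_single, map_sum, map_sum]
    refine Submodule.sum_mem _ fun i _ => ?_
    rw [map_smul, map_smul]
    refine Submodule.smul_mem _ _ ?_
    refine supported_map _ _ _ ?_ _ (ih (fun j => v (i.succAbove j)) δ (fun _ _ => h _ _))
    intro u hu
    rw [coneL_single]
    refine Finsupp.single_mem_supported ℤ _ ?_
    have h1 : ∀ j, u j ∈ Set.range (aff v) := by
      intro j
      obtain ⟨t, ht⟩ := hu.1 j
      rw [← aff_comp_faceMap] at ht
      exact ⟨_, ht⟩
    have h2 : ∀ j, dist (u j) (bary v) ≤ (n + 1 : ℕ) / ((n + 1 : ℕ) + 1) * δ := by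
      intro j
      obtain ⟨t, ht⟩ := h1 j
      rw [← ht]
      exact dist_aff_le _ _ _ (dist_bary_le v δ h) t
    refine ⟨fun j => ?_, fun j k => ?_⟩
    · refine Fin.cases ?_ (fun j => ?_) j
      · exact ⟨_, rfl⟩
      · exact h1 j
    · refine Fin.cases ?_ (fun j => ?_) j <;> refine Fin.cases ?_ (fun k => ?_) k
      · simp; positivity
      · rw [dist_comm]; exact h2 k
      · exact h2 j
      · refine (hu.2 j k).trans ?_
        gcongr ?_ * δ
        rw [div_le_div_iff₀ (by positivity) (by positivity)]
        push_cast
        nlinarith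

lemma sd_iter_mesh {m n : ℕ} (v : Fin (n + 1) → Dl m) (δ : ℝ)
    (h : ∀ i j, dist (v i) (v j) ≤ δ) (r : ℕ) :
    (sdL n)^[r] (Finsupp.single v 1) ∈
      Finsupp.supported ℤ ℤ (meshSet (n := n) v ((n / (n + 1) : ℝ) ^ r * δ)) := by
  induction r with
  | zero =>
    refine Finsupp.single_mem_supported ℤ _ ⟨fun i => ⟨vtx _ i, aff_vtx _ _⟩, fun i j => ?_⟩
    simpa using h i j
  | succ r ih =>
    rw [Function.iterate_succ_apply']
    refine supported_map _ _ _ ?_ _ ih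
    intro u hu
    refine Finsupp.supported_mono ?_ (sd_mesh n u _ hu.2)
    intro w hw
    refine ⟨fun i => ?_, fun i j => (hw.2 i j).trans (le_of_eq ?_)⟩
    · obtain ⟨t, ht⟩ := hw.1 i
      rw [← ht]
      exact range_aff_aff v u hu.1 t
    · rw [pow_succ]; ring

/-- Chains generated by simplices inside `U` or `V`. -/
noncomputable def small {X : TopCat.{0}} (U V : Set X) (n : ℕ) : Submodule ℤ ((SC.obj X).X n) :=
  Submodule.span ℤ (Set.image sx {σ | Set.range σ ⊆ U ∨ Set.range σ ⊆ V})

lemma sx_mem_small {X : TopCat.{0}} {U V : Set X} {n : ℕ} {σ : C(Dl n, X)}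
    (h : Set.range σ ⊆ U ∨ Set.range σ ⊆ V) : sx σ ∈ small U V n :=
  Submodule.subset_span ⟨σ, h, rfl⟩

lemma push_mem_small {X : TopCat.{0}} {U V : Set X} {m n : ℕ} {σ : C(Dl m, X)}
    (h : Set.range σ ⊆ U ∨ Set.range σ ⊆ V) (c : LC m n) : push σ c ∈ small U V n := by
  refine supported_map _ Set.univ _ (fun v _ => ?_) c (by simp)
  rw [push_single]
  refine sx_mem_small (h.imp ?_ ?_) <;>
  · intro h
    refine subset_trans ?_ h
    rintro _ ⟨t, rfl⟩
    exact ⟨_, rfl⟩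

lemma smallCh_map {X Y : TopCat.{0}} {U V : Set X} {n l : ℕ}
    (f : (SC.obj X).X n →ₗ[ℤ] (SC.obj Y).X l) (N : Submodule ℤ ((SC.obj Y).X l))
    (h : ∀ σ : C(Dl n, X), (Set.range σ ⊆ U ∨ Set.range σ ⊆ V) → f (sx σ) ∈ N)
    {z : (SC.obj X).X n} (hz : z ∈ small U V n) : f z ∈ N := by
  refine (Submodule.span_le (p := N.comap f)).2 ?_ hz
  rintro _ ⟨σ, hσ, rfl⟩
  exact h σ hσ

lemma Sd_small {X : TopCat.{0}} {U V : Set X} {n : ℕ} {z : (SC.obj X).X n} (hz : z ∈ small U V n) :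
    Sd n z ∈ small U V n := by
  refine smallCh_map (Sd n) _ (fun σ hσ => ?_) hz
  rw [Sd, sxLift_sx]
  exact push_mem_small hσ _

lemma Th_small {X : TopCat.{0}} {U V : Set X} {n : ℕ} {z : (SC.obj X).X n} (hz : z ∈ small U V n) :
    Th n z ∈ small U V (n + 1) := by
  refine smallCh_map (Th n) _ (fun σ hσ => ?_) hz
  rw [Th, sxLift_sx]
  exact push_mem_small hσ _

lemma Sd_iter_small {X : TopCat.{0}} {U V : Set X} {n : ℕ} {z : (SC.obj X).X n}
    (hz : z ∈ small U V n) (r : ℕ) : (Sd n)^[r] z ∈ small U V n := by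
  induction r with
  | zero => exact hz
  | succ r ih => rw [Function.iterate_succ_apply']; exact Sd_small ih

lemma Sd_iter_push {X : TopCat.{0}} {m n : ℕ} (σ : C(Dl m, X)) (c : LC m n) (r : ℕ) :
    (Sd n)^[r] (push σ c) = push σ ((sdL n)^[r] c) := by
  induction r with
  | zero => rfl
  | succ r ih => rw [Function.iterate_succ_apply', ih, Sd_push, Function.iterate_succ_apply']

lemma exists_Sd_iter_sx {X : TopCat.{0}} {U V : Set X} (hU : IsOpen U) (hV : IsOpen V)
    (hUV : U ∪ V = Set.univ) {n : ℕ} (σ : C(Dl n, X)) : ∃ r, (Sd n)^[r] (sx σ) ∈ small U V n := by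
  obtain ⟨ε, hε, H⟩ := lebesgue_number_lemma_of_metric (s := (Set.univ : Set (Dl n)))
    (c := fun b : Bool => σ ⁻¹' (if b then U else V)) isCompact_univ (fun b => by
      cases b
      · exact hV.preimage σ.continuous
      · exact hU.preimage σ.continuous) (fun x _ => by
      have : σ x ∈ U ∪ V := by rw [hUV]; trivial
      rcases this with h | h
      · exact Set.mem_iUnion.2 ⟨true, h⟩
      · exact Set.mem_iUnion.2 ⟨false, h⟩)
  obtain ⟨δ, hδ⟩ : ∃ δ : ℝ, ∀ i j, dist (vtx n i) (vtx n j) ≤ δ := by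
    refine ⟨Metric.diam (Set.univ : Set (Dl n)), fun i j => ?_⟩
    exact Metric.dist_le_diam_of_mem isCompact_univ.isBounded trivial trivial
  have hδ0 : 0 ≤ δ := dist_nonneg.trans (hδ 0 0)
  obtain ⟨r, hr⟩ : ∃ r : ℕ, (n / (n + 1) : ℝ) ^ r * δ < ε := by
    obtain ⟨r, hr⟩ := exists_pow_lt_of_lt_one (show 0 < ε / (δ + 1) by positivity)
      (show (n / (n + 1) : ℝ) < 1 by rw [div_lt_one (by positivity)]; linarith)
    refine ⟨r, ?_⟩
    rw [lt_div_iff₀ (by positivity)] at hr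
    have : 0 ≤ (n / (n + 1) : ℝ) ^ r := by positivity
    nlinarith
  refine ⟨r, ?_⟩
  rw [← push_vtx σ, Sd_iter_push]
  refine supported_map _ _ _ (fun u hu => ?_) _ (sd_iter_mesh (vtx n) δ hδ r)
  rw [push_single]
  obtain ⟨b, hb⟩ := H (u 0) trivial
  have : Set.range (σ.comp (aff u)) ⊆ if b then U else V := by
    rintro _ ⟨t, rfl⟩
    apply hb
    rw [Metric.mem_ball]
    refine lt_of_le_of_lt (dist_aff_le u (u 0) _ (fun i => hu.2 i 0) t) hr
  refine sx_mem_small ?_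
  cases b
  · exact Or.inr this
  · exact Or.inl this

lemma exists_Sd_iter {X : TopCat.{0}} {U V : Set X} (hU : IsOpen U) (hV : IsOpen V)
    (hUV : U ∪ V = Set.univ) {n : ℕ} (z : (SC.obj X).X n) : ∃ r, (Sd n)^[r] z ∈ small U V n := by
  have hadd : ∀ r (a b : (SC.obj X).X n), (Sd n)^[r] (a + b) = (Sd n)^[r] a + (Sd n)^[r] b := by
    intro r
    induction r with
    | zero => intro a b; rfl
    | succ r ih => intro a b; simp only [Function.iterate_succ_apply', ih, map_add]
  have hsm : ∀ r (m : ℤ) (a : (SC.obj X).X n), (Sd n)^[r] (m • a) = m • (Sd n)^[r] a := by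
    intro r
    induction r with
    | zero => intro a b; rfl
    | succ r ih => intro a b; simp only [Function.iterate_succ_apply', ih, map_zsmul]
  refine sx_induction (p := fun z => ∃ r, (Sd n)^[r] z ∈ small U V n) ⟨0, ?_⟩ ?_ ?_
    (exists_Sd_iter_sx hU hV hUV) z
  · exact Submodule.zero_mem _
  · rintro a b ⟨r, hr⟩ ⟨s, hs⟩
    refine ⟨r + s, ?_⟩
    rw [hadd]
    refine Submodule.add_mem _ ?_ ?_
    · rw [add_comm, Function.iterate_add_apply]; exact Sd_iter_small hr _
    · rw [Function.iterate_add_apply]; exact Sd_iter_small hs _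
  · rintro m a ⟨r, hr⟩
    refine ⟨r, ?_⟩
    rw [hsm]
    exact zsmul_mem hr m

lemma small_correct {X : TopCat.{0}} {U V : Set X} {n : ℕ} (r : ℕ) :
    ∀ (z : (SC.obj X).X (n + 1)), ((SC.obj X).d (n + 1) n).hom z ∈ small U V n →
    ∃ y : (SC.obj X).X (n + 2), z - (Sd (n + 1))^[r] z - ((SC.obj X).d (n + 2) (n + 1)).hom y ∈
      small U V (n + 1) := by
  induction r with
  | zero =>
    intro z _
    refine ⟨0, ?_⟩
    simp
  | succ r ih =>
    intro z hz
    obtain ⟨y, hy⟩ := ih (Sd (n + 1) z) (by rw [d_Sd]; exact Sd_small hz)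
    refine ⟨y + Th (n + 1) z, ?_⟩
    have e : z - (Sd (n + 1))^[r + 1] z - ((SC.obj X).d (n + 2) (n + 1)).hom (y + Th (n + 1) z) =
      (Sd (n + 1) z - (Sd (n + 1))^[r] (Sd (n + 1) z) - ((SC.obj X).d (n + 2) (n + 1)).hom y) +
        Th n (((SC.obj X).d (n + 1) n).hom z) := by
      rw [Function.iterate_succ_apply, map_add, d_Th]
      abel
    rw [e]
    exact Submodule.add_mem _ hy (Th_small hz)

/-- Small simplices theorem. -/
lemma small_theorem {X : TopCat.{0}} {U V : Set X} (hU : IsOpen U) (hV : IsOpen V)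
    (hUV : U ∪ V = Set.univ) (n : ℕ) (z : (SC.obj X).X n)
    (hz : ∀ m, ((SC.obj X).d n m).hom z ∈ small U V m) :
    ∃ y : (SC.obj X).X (n + 1), z - ((SC.obj X).d (n + 1) n).hom y ∈ small U V n := by
  obtain ⟨r, hr⟩ := exists_Sd_iter hU hV hUV z
  cases n with
  | zero =>
    refine ⟨0, ?_⟩
    have : ∀ r, (Sd 0)^[r] z = z := by
      intro r
      induction r with
      | zero => rfl
      | succ r ih =>
        rw [Function.iterate_succ_apply', ih]
        refine SC_hom_ext (f := Sd 0) (g := LinearMap.id) (fun σ => ?_) z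
        rw [Sd, sxLift_sx]
        exact push_vtx σ
    rw [this] at hr
    simpa using hr
  | succ n =>
    obtain ⟨y, hy⟩ := small_correct r z (hz n)
    refine ⟨y, ?_⟩
    have := Submodule.add_mem _ hy hr
    convert this using 1
    abel

/-! ### Homological algebra of chain complexes of abelian groups -/

/-- Chain complexes of abelian groups. -/
abbrev Ch := ChainComplex (ModuleCat.{0} ℤ) ℕ

lemma cokShort {K L : Ch} (φ : K ⟶ L) [Mono φ] :
    (ShortComplex.mk φ (Limits.cokernel.π φ) (Limits.cokernel.condition φ)).ShortExact where
  exact := ShortComplex.exact_cokernel φ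

lemma cok_surj {K L : Ch} (φ : K ⟶ L) (n : ℕ) :
    Function.Surjective ((Limits.cokernel.π φ).f n).hom := by
  rw [← ModuleCat.epi_iff_surjective]
  infer_instance

lemma cok_zero_iff {K L : Ch} (φ : K ⟶ L) {n : ℕ} (x : L.X n) :
    ((Limits.cokernel.π φ).f n).hom x = 0 ↔ ∃ a, (φ.f n).hom a = x := by
  have h := (ShortComplex.exact_cokernel φ).map (HomologicalComplex.eval _ _ n)
  rw [ShortComplex.moduleCat_exact_iff] at h
  constructor
  · exact h x
  · rintro ⟨a, rfl⟩
    have := congrArg (fun f : K ⟶ Limits.cokernel φ => (f.f n).hom a) (Limits.cokernel.condition φ)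
    exact this

lemma cok_map_π {K L K' L' : Ch} (φ : K ⟶ L) (φ' : K' ⟶ L') (a : K ⟶ K') (b : L ⟶ L')
    (w : φ ≫ b = a ≫ φ') {n : ℕ} (x : L.X n) :
    ((Limits.cokernel.map φ φ' a b w).f n).hom (((Limits.cokernel.π φ).f n).hom x) =
      ((Limits.cokernel.π φ').f n).hom ((b.f n).hom x) := by
  have : Limits.cokernel.π φ ≫ Limits.cokernel.map φ φ' a b w = b ≫ Limits.cokernel.π φ' := by simp
  exact congrArg (fun f : L ⟶ Limits.cokernel φ' => (f.f n).hom x) this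

lemma d_comm {K L : Ch} (φ : K ⟶ L) (i j : ℕ) (x : K.X i) :
    (L.d i j).hom ((φ.f i).hom x) = (φ.f j).hom ((K.d i j).hom x) :=
  congrArg (fun f => ModuleCat.Hom.hom f x) (φ.comm i j)

lemma quasiIso_of_approx {K L : Ch} (φ : K ⟶ L)
    (hinj : ∀ n, Function.Injective (φ.f n).hom)
    (h : ∀ n (z : L.X n), (∀ m, ∃ a, (φ.f m).hom a = (L.d n m).hom z) →
      ∃ y : L.X (n + 1), ∃ a, (φ.f n).hom a = z - (L.d (n + 1) n).hom y) : QuasiIso φ := by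
  have hm : Mono φ := HomologicalComplex.mono_of_mono_f _ fun n => by
    rw [ModuleCat.mono_iff_injective]; exact hinj n
  have hS := cokShort φ
  have hac : (Limits.cokernel φ).Acyclic := by
    intro n
    rw [HomologicalComplex.exactAt_iff' _ (n + 1) n _ (by simp) rfl, ShortComplex.moduleCat_exact_iff]
    intro q hq
    obtain ⟨z, rfl⟩ := cok_surj φ n q
    have hz : ∀ m, ∃ a, (φ.f m).hom a = (L.d n m).hom z := by
      intro m
      rw [← cok_zero_iff, ← d_comm]
      by_cases hnm : (ComplexShape.down ℕ).Rel n m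
      · have e := (ComplexShape.down ℕ).next_eq' hnm
        subst e
        exact hq
      · rw [HomologicalComplex.shape _ _ _ hnm]
        rfl
    obtain ⟨y, hy⟩ := h n z hz
    rw [← cok_zero_iff] at hy
    refine ⟨((Limits.cokernel.π φ).f (n + 1)).hom y, ?_⟩
    refine (d_comm (Limits.cokernel.π φ) (n + 1) n y).trans ?_
    rw [map_sub, sub_eq_zero] at hy
    exact hy.symm
  rw [quasiIso_iff]
  intro i
  rw [quasiIsoAt_iff_isIso_homologyMap]
  have z : ∀ i, Limits.IsZero ((Limits.cokernel φ).homology i) := fun i =>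
    ((Limits.cokernel φ).exactAt_iff_isZero_homology i).1 (hac i)
  have h1 : Epi (HomologicalComplex.homologyMap φ i) :=
    (hS.homology_exact₂ i).epi_f ((z i).eq_of_tgt _ _)
  have h2 : Mono (HomologicalComplex.homologyMap φ i) :=
    (hS.homology_exact₁ (i + 1) i (by simp)).mono_g ((z (i + 1)).eq_of_src _ _)
  exact isIso_of_mono_of_epi _

lemma quasiIso_cok_map {K L K' L' : Ch} (φ : K ⟶ L) (φ' : K' ⟶ L') [Mono φ] [Mono φ']
    (a : K ⟶ K') (b : L ⟶ L') (w : φ ≫ b = a ≫ φ') (ha : QuasiIso a) (hb : QuasiIso b) :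
    QuasiIso (Limits.cokernel.map φ φ' a b w) :=
  HomologicalComplex.HomologySequence.quasiIso_τ₃
    (S₁ := ShortComplex.mk φ (Limits.cokernel.π φ) (Limits.cokernel.condition φ))
    (S₂ := ShortComplex.mk φ' (Limits.cokernel.π φ') (Limits.cokernel.condition φ'))
    { τ₁ := a, τ₂ := b, τ₃ := Limits.cokernel.map φ φ' a b w }
    (cokShort φ) (cokShort φ') ha hb

lemma tripleShort {K L M : Ch} (φ : K ⟶ L) (ψ : L ⟶ M) (χ : K ⟶ M) [Mono φ] [Mono ψ] [Mono χ]
    (e : φ ≫ ψ = χ) :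
    (ShortComplex.mk (Limits.cokernel.map φ χ (𝟙 K) ψ (by simp [e]))
      (Limits.cokernel.map χ ψ φ (𝟙 M) (by simp [e])) (by
        rw [← cancel_epi (Limits.cokernel.π φ)]
        simp)).ShortExact := by
  subst e
  refine HomologicalComplex.shortExact_of_degreewise_shortExact _ fun n => ?_
  have hψ : Function.Injective (ψ.f n).hom := by
    rw [← ModuleCat.mono_iff_injective]; infer_instance
  refine ShortComplex.ShortExact.mk' ?_ ?_ ?_
  · rw [ShortComplex.moduleCat_exact_iff]
    intro x hx
    obtain ⟨z, rfl⟩ := cok_surj (φ ≫ ψ) n x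
    have := (cok_map_π (φ ≫ ψ) ψ φ (𝟙 M) (by simp) z).symm.trans hx
    obtain ⟨a, ha⟩ := (cok_zero_iff _ _).1 this
    refine ⟨((Limits.cokernel.π φ).f n).hom a, ?_⟩
    refine (cok_map_π φ (φ ≫ ψ) (𝟙 K) ψ (by simp) a).trans ?_
    erw [ha]
    rfl
  · rw [ModuleCat.mono_iff_injective]
    refine (injective_iff_map_eq_zero (ModuleCat.Hom.hom _)).2 ?_
    intro x hx
    obtain ⟨z, rfl⟩ := cok_surj φ n x
    have := (cok_map_π φ (φ ≫ ψ) (𝟙 K) ψ (by simp) z).symm.trans hx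
    obtain ⟨a, ha⟩ := (cok_zero_iff _ _).1 this
    exact (cok_zero_iff _ _).2 ⟨a, hψ ha⟩
  · have h : Limits.cokernel.π (φ ≫ ψ) ≫
        Limits.cokernel.map (φ ≫ ψ) ψ φ (𝟙 M) (by simp) = Limits.cokernel.π ψ := by simp
    have : Epi (Limits.cokernel.map (φ ≫ ψ) ψ φ (𝟙 M) (by simp)) := epi_of_epi_fac h
    exact inferInstanceAs (Epi ((Limits.cokernel.map (φ ≫ ψ) ψ φ (𝟙 M) (by simp)).f n))

/-! ### Subspaces and excision -/

section subspaces

variable {X : Type} [TopologicalSpace X]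

/-- A subset as a space. -/
abbrev sp (S : Set X) : TopCat.{0} := TopCat.of S

/-- The inclusion of subspaces. -/
def inc {S T : Set X} (h : S ⊆ T) : sp S ⟶ sp T :=
  TopCat.ofHom ⟨Set.inclusion h, continuous_inclusion h⟩

instance inc_mono {S T : Set X} (h : S ⊆ T) : Mono (inc h) := by
  rw [TopCat.mono_iff_injective]
  exact Set.inclusion_injective h

/-- The inclusion on chains. -/
noncomputable abbrev ic {S T : Set X} (h : S ⊆ T) : SC.obj (sp S) ⟶ SC.obj (sp T) := SC.map (inc h)

lemma ic_comp {R S T : Set X} (h : R ⊆ S) (h' : S ⊆ T) : ic h ≫ ic h' = ic (h.trans h') :=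
  (SC.map_comp _ _).symm

lemma ic_comm {R S S' T : Set X} (h : R ⊆ S) (h' : S ⊆ T) (g : R ⊆ S') (g' : S' ⊆ T) :
    ic h ≫ ic h' = ic g ≫ ic g' := by rw [ic_comp, ic_comp]

/-- Relative chains. -/
noncomputable abbrev RelC {S T : Set X} (h : S ⊆ T) : Ch := Limits.cokernel (ic h)

lemma ic_sx {S T : Set X} (h : S ⊆ T) {n : ℕ} (σ : C(Dl n, S)) :
    ((ic h).f n).hom (sx (X := sp S) σ) =
      sx (X := sp T) ((⟨Set.inclusion h, continuous_inclusion h⟩ : C(S, T)).comp σ) :=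
  SC_map_sx (inc h) σ

open Classical in
/-- Restriction of chains to a subspace. -/
noncomputable def resC (S T : Set X) (n : ℕ) :
    (SC.obj (sp T)).X n →ₗ[ℤ] (SC.obj (sp S)).X n :=
  sxLift fun τ : C(Dl n, T) => if h : ∀ t, (τ t).1 ∈ S then
    sx (X := sp S) (⟨fun t => ⟨(τ t).1, h t⟩,
      (continuous_subtype_val.comp τ.continuous).subtype_mk _⟩ : C(Dl n, S)) else 0

lemma resC_pos {S T : Set X} {n : ℕ} (τ : C(Dl n, T)) (h : ∀ t, (τ t).1 ∈ S) :
    resC S T n (sx (X := sp T) τ) = sx (X := sp S) (⟨fun t => ⟨(τ t).1, h t⟩,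
      (continuous_subtype_val.comp τ.continuous).subtype_mk _⟩ : C(Dl n, S)) := by
  rw [resC, sxLift_sx, dif_pos h]

lemma resC_neg {S T : Set X} {n : ℕ} (τ : C(Dl n, T)) (h : ¬ ∀ t, (τ t).1 ∈ S) :
    resC S T n (sx (X := sp T) τ) = 0 := by
  rw [resC, sxLift_sx, dif_neg h]

lemma resC_ic {S T : Set X} (h : S ⊆ T) {n : ℕ} (a : (SC.obj (sp S)).X n) :
    resC S T n (((ic h).f n).hom a) = a := by
  refine SC_hom_ext (f := resC S T n ∘ₗ ((ic h).f n).hom) (g := LinearMap.id) (fun σ => ?_) a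
  rw [LinearMap.comp_apply, ic_sx]
  refine (resC_pos ((⟨Set.inclusion h, continuous_inclusion h⟩ : C(S, T)).comp σ)
    (fun t => (σ t).2)).trans ?_
  rfl

lemma ic_inter {U V T I : Set X} (hI : U ∩ V = I) (hIV : I ⊆ V) (hUT : U ⊆ T) (hVT : V ⊆ T)
    {n : ℕ} (a : (SC.obj (sp V)).X n) (b : (SC.obj (sp U)).X n)
    (h : ((ic hVT).f n).hom a = ((ic hUT).f n).hom b) : ∃ c, ((ic hIV).f n).hom c = a := by
  refine ⟨resC I V n a, ?_⟩
  apply SC_map_injective (inc hVT) (Set.inclusion_injective hVT)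
  have e : ((ic hUT).f n).hom (resC U T n (((ic hVT).f n).hom a)) =
      ((ic hVT).f n).hom (((ic hIV).f n).hom (resC I V n a)) := by
    refine SC_hom_ext (f := ((ic hUT).f n).hom ∘ₗ resC U T n ∘ₗ ((ic hVT).f n).hom)
      (g := ((ic hVT).f n).hom ∘ₗ ((ic hIV).f n).hom ∘ₗ resC I V n) (fun σ => ?_) a
    simp only [LinearMap.comp_apply]
    rw [ic_sx]
    by_cases hσ : ∀ t, (σ t).1 ∈ U
    · rw [resC_pos _ (fun t => by exact hσ t), resC_pos σ (fun t => hI ▸ ⟨hσ t, (σ t).2⟩),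
        ic_sx, ic_sx, ic_sx]
      rfl
    · rw [resC_neg _ (by exact hσ), resC_neg σ (fun h' => hσ fun t => ?_)]
      · simp only [map_zero]
      · have := h' t
        rw [← hI] at this
        exact this.1
  refine e.symm.trans ?_
  rw [h, resC_ic, ← h]

lemma ic_mem_small_left {U T : Set X} (hUT : U ⊆ T) (V' : Set (sp T)) {n : ℕ}
    (a : (SC.obj (sp U)).X n) :
    ((ic hUT).f n).hom a ∈ small (X := sp T) (Subtype.val ⁻¹' U) V' n := by
  refine sx_induction (p := fun a => ((ic hUT).f n).hom a ∈
    small (X := sp T) (Subtype.val ⁻¹' U) V' n) ?_ (fun a b ha hb => ?_) (fun m a ha => ?_)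
    (fun σ => ?_) a
  · rw [map_zero]; exact Submodule.zero_mem _
  · rw [map_add]; exact Submodule.add_mem _ ha hb
  · rw [map_zsmul]; exact zsmul_mem ha m
  · rw [ic_sx]
    refine sx_mem_small (Or.inl ?_)
    rintro _ ⟨t, rfl⟩
    exact (σ t).2

lemma small_comm {X : TopCat.{0}} (U V : Set X) (n : ℕ) : small U V n = small V U n := by
  unfold small
  congr 2
  ext σ
  exact or_comm

lemma ic_mem_small_right {V T : Set X} (hVT : V ⊆ T) (U' : Set (sp T)) {n : ℕ}
    (a : (SC.obj (sp V)).X n) :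
    ((ic hVT).f n).hom a ∈ small (X := sp T) U' (Subtype.val ⁻¹' V) n := by
  rw [small_comm]
  exact ic_mem_small_left hVT U' a

lemma exists_of_mem_small {U V T : Set X} (hUT : U ⊆ T) (hVT : V ⊆ T) {n : ℕ}
    (z : (SC.obj (sp T)).X n)
    (hz : z ∈ small (X := sp T) (Subtype.val ⁻¹' U) (Subtype.val ⁻¹' V) n) :
    ∃ a b, z = ((ic hUT).f n).hom a + ((ic hVT).f n).hom b := by
  suffices h : small (X := sp T) (Subtype.val ⁻¹' U) (Subtype.val ⁻¹' V) n ≤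
      LinearMap.range ((ic hUT).f n).hom ⊔ LinearMap.range ((ic hVT).f n).hom by
    obtain ⟨_, ⟨a, rfl⟩, _, ⟨b, rfl⟩, e⟩ := Submodule.mem_sup.1 (h hz)
    exact ⟨a, b, e.symm⟩
  refine Submodule.span_le.2 ?_
  rintro _ ⟨σ, hσ | hσ, rfl⟩
  · refine Submodule.mem_sup_left ⟨resC U T n (sx (X := sp T) σ), ?_⟩
    rw [resC_pos (S := U) σ (fun t => hσ ⟨t, rfl⟩), ic_sx]
    rfl
  · refine Submodule.mem_sup_right ⟨resC V T n (sx (X := sp T) σ), ?_⟩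
    rw [resC_pos (S := V) σ (fun t => hσ ⟨t, rfl⟩), ic_sx]
    rfl

/-- Excision. -/
lemma excision {U V T I : Set X} (hU : IsOpen U) (hV : IsOpen V) (hT : U ∪ V = T)
    (hI : U ∩ V = I) (hIV : I ⊆ V) (hIU : I ⊆ U) (hUT : U ⊆ T) (hVT : V ⊆ T) :
    QuasiIso (Limits.cokernel.map (ic hIV) (ic hUT) (ic hIU) (ic hVT) (ic_comm _ _ _ _)) := by
  have key : ∀ (n : ℕ) (z : (SC.obj (sp T)).X n),
      z ∈ small (X := sp T) (Subtype.val ⁻¹' U) (Subtype.val ⁻¹' V) n ↔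
      ∃ c, ((Limits.cokernel.map (ic hIV) (ic hUT) (ic hIU) (ic hVT) (ic_comm _ _ _ _)).f n).hom c =
        ((Limits.cokernel.π (ic hUT)).f n).hom z := by
    intro n z
    constructor
    · intro hz
      obtain ⟨a, b, rfl⟩ := exists_of_mem_small hUT hVT z hz
      refine ⟨((Limits.cokernel.π (ic hIV)).f n).hom b, ?_⟩
      rw [cok_map_π, map_add, (cok_zero_iff (ic hUT) _).2 ⟨a, rfl⟩, zero_add]
    · rintro ⟨c, hc⟩
      obtain ⟨b, rfl⟩ := cok_surj _ _ c
      rw [cok_map_π, eq_comm, ← sub_eq_zero, ← map_sub, cok_zero_iff] at hc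
      obtain ⟨a, ha⟩ := hc
      rw [eq_sub_iff_add_eq] at ha
      rw [← ha]
      exact Submodule.add_mem _ (ic_mem_small_left hUT _ a) (ic_mem_small_right hVT _ b)
  refine quasiIso_of_approx _ (fun n => ?_) (fun n z hz => ?_)
  · refine (injective_iff_map_eq_zero (ModuleCat.Hom.hom _)).2 ?_
    intro x hx
    obtain ⟨a, rfl⟩ := cok_surj _ _ x
    rw [cok_map_π, cok_zero_iff] at hx
    obtain ⟨b, hb⟩ := hx
    rw [cok_zero_iff]
    exact ic_inter hI hIV hUT hVT a b hb.symm
  · obtain ⟨z, rfl⟩ := cok_surj _ _ z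
    obtain ⟨y, hy⟩ := small_theorem (X := sp T) (U := Subtype.val ⁻¹' U) (V := Subtype.val ⁻¹' V)
      (hU.preimage continuous_subtype_val) (hV.preimage continuous_subtype_val)
      (by ext x; simpa [← hT] using x.2) n z (fun m => by
        rw [key, ← d_comm]
        exact hz m)
    rw [key] at hy
    refine ⟨((Limits.cokernel.π (ic hUT)).f (n + 1)).hom y, ?_⟩
    obtain ⟨c, hc⟩ := hy
    refine ⟨c, ?_⟩
    rw [hc, map_sub, d_comm]

end subspaces

/-! ### Free homology with prescribed ranks -/

/-- The homology of `K` is free with ranks given by the coefficients of `p`. -/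
def HasPoly (K : Ch) (p : Polynomial ℕ) : Prop :=
  ∀ i, Nonempty (K.homology i ≃+ (Fin (p.coeff i) → ℤ))

/-- Isomorphic modules are isomorphic as groups. -/
def addEquivOfIso {A B : ModuleCat.{0} ℤ} (e : A ≅ B) : A ≃+ B := e.toLinearEquiv.toAddEquiv

lemma HasPoly.of_iso {K L : Ch} {p : Polynomial ℕ} (h : HasPoly K p)
    (e : ∀ i, Nonempty (K.homology i ≅ L.homology i)) : HasPoly L p := by
  intro i
  obtain ⟨f⟩ := h i
  obtain ⟨g⟩ := e i
  exact ⟨(addEquivOfIso g).symm.trans f⟩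

lemma homology_iso_of_quasiIso {K L : Ch} (f : K ⟶ L) (hf : QuasiIso f) (i : ℕ) :
    Nonempty (K.homology i ≅ L.homology i) :=
  ⟨isoOfQuasiIsoAt f i⟩

lemma HasPoly.of_quasiIso {K L : Ch} {p : Polynomial ℕ} (h : HasPoly K p) (f : K ⟶ L)
    (hf : QuasiIso f) : HasPoly L p :=
  h.of_iso (homology_iso_of_quasiIso f hf)

lemma HasPoly.of_quasiIso' {K L : Ch} {p : Polynomial ℕ} (h : HasPoly L p) (f : K ⟶ L)
    (hf : QuasiIso f) : HasPoly K p :=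
  h.of_iso fun i => (homology_iso_of_quasiIso f hf i).map Iso.symm

lemma free_split {A B C : Type} [AddCommGroup A] [AddCommGroup B] [AddCommGroup C]
    (f : A →+ B) (g : B →+ C) (hf : Function.Injective f) (hg : Function.Surjective g)
    (hfg : ∀ b, g b = 0 ↔ ∃ a, f a = b) {a c : ℕ} (eA : A ≃+ (Fin a → ℤ)) (eC : C ≃+ (Fin c → ℤ)) :
    Nonempty (B ≃+ (Fin (c + a) → ℤ)) := by
  have hfree : Module.Free ℤ C := Module.Free.of_equiv eC.toIntLinearEquiv.symm
  obtain ⟨s, hs⟩ := Module.projective_lifting_property g.toIntLinearMap LinearMap.id hg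
  have hs' : ∀ x, g (s x) = x := fun x => LinearMap.congr_fun hs x
  let F : C × A →+ B := AddMonoidHom.coprod s.toAddMonoidHom f
  have hF : Function.Bijective F := by
    constructor
    · rw [injective_iff_map_eq_zero]
      rintro ⟨x, y⟩ hxy
      have h1 : s x + f y = 0 := hxy
      have h2 : g (f y) = 0 := (hfg _).2 ⟨y, rfl⟩
      have h3 : x = 0 := by
        have := congrArg g h1
        rwa [map_add, hs', h2, add_zero, map_zero] at this
      subst h3
      rw [map_zero, zero_add] at h1
      rw [(injective_iff_map_eq_zero f).1 hf y h1]
      rfl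
    · intro b
      obtain ⟨y, hy⟩ := (hfg (b - s (g b))).1 (by rw [map_sub, hs', sub_self])
      refine ⟨(g b, y), ?_⟩
      change s (g b) + f y = b
      rw [hy]; abel
  let e1 : B ≃+ C × A := (AddEquiv.ofBijective F hF).symm
  let e2 : C × A ≃+ (Fin c → ℤ) × (Fin a → ℤ) := AddEquiv.prodCongr eC eA
  let e3 : (Fin c → ℤ) × (Fin a → ℤ) ≃+ (Fin c ⊕ Fin a → ℤ) :=
    (LinearEquiv.sumArrowLequivProdArrow (Fin c) (Fin a) ℤ ℤ).symm.toAddEquiv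
  let e4 : (Fin c ⊕ Fin a → ℤ) ≃+ (Fin (c + a) → ℤ) :=
    (LinearEquiv.funCongrLeft ℤ ℤ finSumFinEquiv.symm).toAddEquiv
  exact ⟨((e1.trans e2).trans e3).trans e4⟩

section maps

variable {X Y : Type} [TopologicalSpace X] [TopologicalSpace Y]

/-- A continuous map restricted to subsets. -/
def mapSet {S : Set X} {T : Set Y} (f : C(X, Y)) (h : Set.MapsTo f S T) : sp S ⟶ sp T :=
  TopCat.ofHom ⟨h.restrict f S T, f.continuous.restrict h⟩

lemma homotopic_sets {S : Set X} (f : C(X, X)) (hf : Set.MapsTo f S S) (H : C(ℝ × X, X))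
    (h0 : ∀ x ∈ S, H (0, x) = f x) (h1 : ∀ x ∈ S, H (1, x) = x)
    (hH : ∀ τ : ℝ, 0 ≤ τ → τ ≤ 1 → ∀ x ∈ S, H (τ, x) ∈ S) :
    (mapSet f hf).hom.Homotopic (ContinuousMap.id (sp S)) := by
  refine ⟨⟨⟨fun p => ⟨H (p.1.1, p.2.1), hH _ p.1.2.1 p.1.2.2 _ p.2.2⟩, ?_⟩, ?_, ?_⟩⟩
  · refine Continuous.subtype_mk ?_ _
    exact H.continuous.comp ((continuous_subtype_val.comp continuous_fst).prodMk
      (continuous_subtype_val.comp continuous_snd))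
  · intro x
    exact Subtype.ext (h0 x.1 x.2)
  · intro x
    exact Subtype.ext (h1 x.1 x.2)

lemma mapSet_quasiIso {S : Set X} {T : Set Y} (f : C(X, Y)) (hf : Set.MapsTo f S T)
    (g : C(Y, X)) (hg : Set.MapsTo g T S) (H : C(ℝ × X, X))
    (h0 : ∀ x ∈ S, H (0, x) = g (f x)) (h1 : ∀ x ∈ S, H (1, x) = x)
    (hH : ∀ τ : ℝ, 0 ≤ τ → τ ≤ 1 → ∀ x ∈ S, H (τ, x) ∈ S)
    (K : C(ℝ × Y, Y)) (k0 : ∀ x ∈ T, K (0, x) = f (g x)) (k1 : ∀ x ∈ T, K (1, x) = x)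
    (hK : ∀ τ : ℝ, 0 ≤ τ → τ ≤ 1 → ∀ x ∈ T, K (τ, x) ∈ T) :
    QuasiIso (SC.map (mapSet f hf)) := by
  refine SC_quasiIso (mapSet f hf) (mapSet g hg) ?_ ?_
  · exact homotopic_sets (g.comp f) (hg.comp hf) H h0 h1 hH
  · exact homotopic_sets (f.comp g) (hf.comp hg) K k0 k1 hK

lemma mapSet_comm {S S' : Set X} {T T' : Set Y} (hS : S' ⊆ S) (hT : T' ⊆ T) (f : C(X, Y))
    (h : Set.MapsTo f S T) (h' : Set.MapsTo f S' T') :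
    ic hS ≫ SC.map (mapSet f h) = SC.map (mapSet f h') ≫ ic hT := by
  rw [← SC.map_comp, ← SC.map_comp]
  rfl

lemma epi_of_section {V W : Set X} (h : V ⊆ W) (f : C(X, X)) (hf : Set.MapsTo f W V)
    (H : C(ℝ × X, X)) (h0 : ∀ x ∈ W, H (0, x) = f x) (h1 : ∀ x ∈ W, H (1, x) = x)
    (hH : ∀ τ : ℝ, 0 ≤ τ → τ ≤ 1 → ∀ x ∈ W, H (τ, x) ∈ W) (i : ℕ) :
    Epi (HomologicalComplex.homologyMap (ic h) i) := by
  obtain ⟨H'⟩ := homotopic_sets f (fun x hx => h (hf hx)) H h0 h1 hH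
  have e := (SC_homotopy (f := mapSet f (fun x hx => h (hf hx))) (g := 𝟙 _) H').homologyMap_eq i
  have e2 : mapSet f (fun x hx => h (hf hx)) = mapSet f hf ≫ inc h := rfl
  rw [e2, SC.map_comp, HomologicalComplex.homologyMap_comp, SC.map_id,
    HomologicalComplex.homologyMap_id] at e
  exact epi_of_epi_fac e

end maps

section step

variable {X : Type} [TopologicalSpace X]

lemma step_poly {U O W' V W I : Set X} (hU : IsOpen U) (hO : IsOpen O) (hV : IsOpen V)
    (hW' : U ∪ O = W') (hW : V ∪ O = W) (hI : U ∩ O = I) (hI' : V ∩ O = I)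
    (hUV : U ⊆ V) (hVW : V ⊆ W) (hInO : I ⊆ O)
    (hepi : ∀ i, Epi (HomologicalComplex.homologyMap (ic hVW) i))
    {p r : Polynomial ℕ} (hp : HasPoly (SC.obj (sp W')) p)
    (hr : HasPoly (RelC hInO) (Polynomial.X * r)) : HasPoly (SC.obj (sp U)) (p + r) := by
  have hUW' : U ⊆ W' := hW' ▸ Set.subset_union_left
  have hOW' : O ⊆ W' := hW' ▸ Set.subset_union_right
  have hOW : O ⊆ W := hW ▸ Set.subset_union_right
  have hWW : W' ⊆ W := by rw [← hW', ← hW]; exact Set.union_subset_union_left _ hUV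
  have hIU : I ⊆ U := hI ▸ Set.inter_subset_left
  have hIV : I ⊆ V := hI' ▸ Set.inter_subset_left
  have q1 := excision hU hO hW' hI hInO hIU hUW' hOW'
  have q2 := excision hV hO hW hI' hInO hIV hVW hOW
  have comp : Limits.cokernel.map (ic hInO) (ic hUW') (ic hIU) (ic hOW') (ic_comm _ _ _ _) ≫
      Limits.cokernel.map (ic hUW') (ic hVW) (ic hUV) (ic hWW) (ic_comm _ _ _ _) =
      Limits.cokernel.map (ic hInO) (ic hVW) (ic hIV) (ic hOW) (ic_comm _ _ _ _) := by
    rw [← cancel_epi (Limits.cokernel.π (ic hInO))]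
    simp only [Limits.cokernel.π_desc, Limits.cokernel.map, Limits.cokernel.π_desc_assoc,
      Category.assoc]
    rw [← Category.assoc, ic_comp]
  have q3 : QuasiIso (Limits.cokernel.map (ic hUW') (ic hVW) (ic hUV) (ic hWW) (ic_comm _ _ _ _)) := by
    rw [← comp] at q2
    exact quasiIso_of_comp_left (Limits.cokernel.map (ic hInO) (ic hUW') (ic hIU) (ic hOW')
      (ic_comm _ _ _ _)) _
  have hzero : ∀ i, HomologicalComplex.homologyMap (Limits.cokernel.π (ic hUW')) i = 0 := by
    intro i
    have e : Limits.cokernel.π (ic hUW') ≫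
      Limits.cokernel.map (ic hUW') (ic hVW) (ic hUV) (ic hWW) (ic_comm _ _ _ _) =
      ic hWW ≫ Limits.cokernel.π (ic hVW) := by simp
    have e2 := congrArg (fun f => HomologicalComplex.homologyMap f i) e
    simp only [HomologicalComplex.homologyMap_comp] at e2
    have z : HomologicalComplex.homologyMap (Limits.cokernel.π (ic hVW)) i = 0 := by
      have := hepi i
      rw [← cancel_epi (HomologicalComplex.homologyMap (ic hVW) i),
        ← HomologicalComplex.homologyMap_comp, Limits.cokernel.condition]
      simp
    rw [z, Limits.comp_zero] at e2
    rw [← cancel_mono (HomologicalComplex.homologyMap (Limits.cokernel.map (ic hUW') (ic hVW)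
      (ic hUV) (ic hWW) (ic_comm _ _ _ _)) i), e2, Limits.zero_comp]
  have hr' := hr.of_quasiIso _ q1
  have hS := cokShort (ic hUW')
  intro i
  have hrel : (ComplexShape.down ℕ).Rel (i + 1) i := by simp
  obtain ⟨eA⟩ := hr' (i + 1)
  obtain ⟨eC⟩ := hp i
  rw [Polynomial.coeff_X_mul] at eA
  have ex1 := hS.homology_exact₁ (i + 1) i hrel
  have ex2 := hS.homology_exact₂ i
  have m : Mono (hS.δ (i + 1) i hrel) :=
    (hS.homology_exact₃ (i + 1) i hrel).mono_g (hzero (i + 1))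
  have ep : Epi (HomologicalComplex.homologyMap (ic hUW') i) := ex2.epi_f (hzero i)
  rw [Polynomial.coeff_add]
  rw [ShortComplex.moduleCat_exact_iff] at ex1
  refine free_split (hS.δ (i + 1) i hrel).hom.toAddMonoidHom
    (HomologicalComplex.homologyMap (ic hUW') i).hom.toAddMonoidHom
    ((ModuleCat.mono_iff_injective _).1 m) ((ModuleCat.epi_iff_surjective _).1 ep) (fun b => ?_) eA eC
  constructor
  · intro h; exact ex1 b h
  · rintro ⟨a, rfl⟩
    have := hS.δ_comp (i + 1) i hrel
    exact congrArg (fun f => ModuleCat.Hom.hom f a) this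

end step

/-! ### Thom isomorphism for trivial bundles -/

section susp

variable {B : Type} [TopologicalSpace B]

/-- The cylinder over `S`. -/
def cyl (S : Set B) (c : ℕ) : Set (B × (Fin c → ℝ)) := {x | x.1 ∈ S}

/-- The punctured cylinder over `S`. -/
def pcyl (S : Set B) (c : ℕ) : Set (B × (Fin c → ℝ)) := {x | x.1 ∈ S ∧ x.2 ≠ 0}

lemma pcyl_sub (S : Set B) (c : ℕ) : pcyl S c ⊆ cyl S c := fun _ h => h.1

/-- Upper part. -/
def upc (S : Set B) (c : ℕ) (ε : ℝ) : Set (B × (Fin (c + 1) → ℝ)) :=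
  {x | x.1 ∈ S ∧ (Fin.init x.2 ≠ (0 : Fin c → ℝ) ∨ 0 < ε * x.2 (Fin.last c))}

/-- Intersection. -/
def midc (S : Set B) (c : ℕ) : Set (B × (Fin (c + 1) → ℝ)) :=
  {x | x.1 ∈ S ∧ Fin.init x.2 ≠ (0 : Fin c → ℝ)}

lemma continuous_init (c : ℕ) : Continuous (fun x : Fin (c + 1) → ℝ => (Fin.init x : Fin c → ℝ)) :=
  continuous_pi fun i => continuous_apply i.castSucc

lemma continuous_snoc (c : ℕ) :
    Continuous (fun x : (Fin c → ℝ) × ℝ => (Fin.snoc x.1 x.2 : Fin (c + 1) → ℝ)) := by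
  refine continuous_pi fun i => ?_
  refine Fin.lastCases ?_ (fun i => ?_) i
  · simpa using continuous_snd
  · simp only [Fin.snoc_castSucc]
    exact (continuous_apply i).comp continuous_fst

lemma isOpen_midc {S : Set B} (hS : IsOpen S) (c : ℕ) : IsOpen (midc S c) := by
  refine (hS.preimage continuous_fst).inter ?_
  exact isOpen_compl_singleton.preimage ((continuous_init c).comp continuous_snd)

lemma isOpen_upc {S : Set B} (hS : IsOpen S) (c : ℕ) (ε : ℝ) : IsOpen (upc S c ε) := by
  refine (hS.preimage continuous_fst).inter (IsOpen.union ?_ ?_)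
  · exact isOpen_compl_singleton.preimage ((continuous_init c).comp continuous_snd)
  · exact isOpen_Ioi.preimage
      (continuous_const.mul ((continuous_apply (Fin.last c)).comp continuous_snd))

lemma init_eq_zero_iff {c : ℕ} (x : Fin (c + 1) → ℝ) :
    x = 0 ↔ (Fin.init x = (0 : Fin c → ℝ) ∧ x (Fin.last c) = 0) := by
  constructor
  · rintro rfl; exact ⟨rfl, rfl⟩
  · rintro ⟨h1, h2⟩
    ext i
    refine Fin.lastCases h2 (fun i => ?_) i
    exact congrFun h1 i

/-- The homotopy on the last coordinate. -/
noncomputable def lastH (c : ℕ) (f : C(ℝ, ℝ)) :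
    C(ℝ × (B × (Fin (c + 1) → ℝ)), B × (Fin (c + 1) → ℝ)) :=
  ⟨fun p => (p.2.1, Fin.snoc (Fin.init p.2.2 : Fin c → ℝ)
      ((1 - p.1) * f (p.2.2 (Fin.last c)) + p.1 * p.2.2 (Fin.last c))), by
    have h1 : Continuous (fun p : ℝ × (B × (Fin (c + 1) → ℝ)) => (Fin.init p.2.2 : Fin c → ℝ)) :=
      (continuous_init c).comp (continuous_snd.comp continuous_snd)
    have h2 : Continuous (fun p : ℝ × (B × (Fin (c + 1) → ℝ)) =>
      (1 - p.1) * f (p.2.2 (Fin.last c)) + p.1 * p.2.2 (Fin.last c)) := by fun_prop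
    exact (continuous_fst.comp continuous_snd).prodMk ((continuous_snoc c).comp
      (h1.prodMk h2))⟩

lemma lastH_one (c : ℕ) (f : C(ℝ, ℝ)) (x : B × (Fin (c + 1) → ℝ)) : lastH c f (1, x) = x := by
  refine Prod.ext rfl ?_
  change Fin.snoc (Fin.init x.2 : Fin c → ℝ) ((1 - 1) * f (x.2 (Fin.last c)) + 1 * x.2 (Fin.last c)) = x.2
  rw [sub_self, zero_mul, zero_add, one_mul]
  exact Fin.snoc_init_self x.2

lemma lastH_init (c : ℕ) (f : C(ℝ, ℝ)) (τ : ℝ) (x : B × (Fin (c + 1) → ℝ)) :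
    (Fin.init (lastH c f (τ, x)).2 : Fin c → ℝ) = Fin.init x.2 := by
  change (Fin.init (Fin.snoc (α := fun _ => ℝ) (Fin.init x.2 : Fin c → ℝ) _) : Fin c → ℝ) = _
  exact Fin.init_snoc _ _

lemma lastH_last (c : ℕ) (f : C(ℝ, ℝ)) (τ : ℝ) (x : B × (Fin (c + 1) → ℝ)) :
    (lastH c f (τ, x)).2 (Fin.last c) = (1 - τ) * f (x.2 (Fin.last c)) + τ * x.2 (Fin.last c) := by
  exact Fin.snoc_last (α := fun _ => ℝ) _ _

lemma lastH_upc {S : Set B} (c : ℕ) (ε : ℝ) (f : C(ℝ, ℝ)) (hf : ∀ s, 0 < ε * f s) (τ : ℝ)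
    (h0 : 0 ≤ τ) (h1 : τ ≤ 1) (x : B × (Fin (c + 1) → ℝ)) (hx : x ∈ upc S c ε) :
    lastH c f (τ, x) ∈ upc S c ε := by
  refine ⟨hx.1, ?_⟩
  rw [lastH_init, lastH_last]
  refine hx.2.imp_right fun h => ?_
  have e : ε * ((1 - τ) * f (x.2 (Fin.last c)) + τ * x.2 (Fin.last c)) =
    (1 - τ) * (ε * f (x.2 (Fin.last c))) + τ * (ε * x.2 (Fin.last c)) := by ring
  rw [e]
  rcases h1.eq_or_lt with rfl | h1
  · simpa using h
  · have := mul_pos (sub_pos.2 h1) (hf (x.2 (Fin.last c)))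
    have := mul_nonneg h0 h.le
    linarith

/-- Constant. -/
def cstR (r : ℝ) : C(ℝ, ℝ) := ContinuousMap.const ℝ r

lemma upc_sub (S : Set B) (c : ℕ) (ε : ℝ) : upc S c ε ⊆ cyl S (c + 1) := fun _ h => h.1

lemma quasiIso_upc (S : Set B) (c : ℕ) : QuasiIso (ic (upc_sub S c 1)) := by
  have hg : Set.MapsTo (lastH c (cstR 1) |>.comp ⟨fun x => ((0 : ℝ), x), by fun_prop⟩)
      (cyl S (c + 1)) (upc S c 1) := by
    intro x hx
    refine ⟨hx, Or.inr ?_⟩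
    change 0 < 1 * (lastH c (cstR 1) (0, x)).2 (Fin.last c)
    rw [lastH_last]
    simp [cstR]
  refine mapSet_quasiIso (ContinuousMap.id _) (upc_sub S c 1) _ hg (lastH c (cstR 1))
    (fun x _ => rfl) (fun x _ => lastH_one _ _ _) ?_ (lastH c (cstR 1))
    (fun x _ => rfl) (fun x _ => lastH_one _ _ _) ?_
  · intro τ h0 h1 x hx
    exact lastH_upc c 1 _ (fun s => by simp [cstR]) τ h0 h1 x hx
  · intro τ h0 h1 x hx
    exact hx

/-- Projection forgetting the last coordinate. -/
def prInit (c : ℕ) : C(B × (Fin (c + 1) → ℝ), B × (Fin c → ℝ)) :=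
  ⟨fun x => (x.1, Fin.init x.2), continuous_fst.prodMk ((continuous_init c).comp continuous_snd)⟩

/-- Section. -/
def scSnoc (c : ℕ) : C(B × (Fin c → ℝ), B × (Fin (c + 1) → ℝ)) :=
  ⟨fun x => (x.1, Fin.snoc x.2 (-1)), continuous_fst.prodMk
    ((continuous_snoc c).comp (continuous_snd.prodMk continuous_const))⟩

lemma init_scSnoc (c : ℕ) (x : B × (Fin c → ℝ)) :
    (Fin.init (scSnoc c x).2 : Fin c → ℝ) = x.2 := by
  exact Fin.init_snoc _ _

lemma prInit_scSnoc (c : ℕ) (x : B × (Fin c → ℝ)) : prInit c (scSnoc c x) = x :=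
  Prod.ext rfl (init_scSnoc c x)

lemma lastH_zero_neg (c : ℕ) (x : B × (Fin (c + 1) → ℝ)) :
    lastH c (cstR (-1)) (0, x) = scSnoc c (prInit c x) := by
  refine Prod.ext rfl ?_
  change (Fin.snoc (Fin.init x.2 : Fin c → ℝ) ((1 - 0) * (-1) + 0 * x.2 (Fin.last c)) :
    Fin (c + 1) → ℝ) = Fin.snoc (Fin.init x.2 : Fin c → ℝ) (-1)
  norm_num

lemma quasiIso_low (S : Set B) (c : ℕ) :
    ∃ h : Set.MapsTo (prInit c) (upc S c (-1)) (cyl S c),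
      QuasiIso (SC.map (mapSet (prInit c) h)) := by
  refine ⟨fun x hx => hx.1, ?_⟩
  refine mapSet_quasiIso _ _ (scSnoc c) ?_ (lastH c (cstR (-1))) ?_ ?_ ?_
    (⟨fun p => p.2, continuous_snd⟩) ?_ ?_ ?_
  · intro x hx
    refine ⟨hx, Or.inr ?_⟩
    have : (scSnoc c x).2 (Fin.last c) = -1 := Fin.snoc_last (α := fun _ => ℝ) _ _
    rw [this]
    norm_num
  · intro x _; exact lastH_zero_neg c x
  · intro x _; exact lastH_one _ _ _
  · intro τ h0 h1 x hx
    exact lastH_upc c (-1) _ (fun s => by simp [cstR]) τ h0 h1 x hx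
  · intro x _; exact (prInit_scSnoc c x).symm
  · intro x _; rfl
  · intro τ _ _ x hx; exact hx

lemma quasiIso_mid (S : Set B) (c : ℕ) :
    ∃ h : Set.MapsTo (prInit c) (midc S c) (pcyl S c),
      QuasiIso (SC.map (mapSet (prInit c) h)) := by
  refine ⟨fun x hx => hx, ?_⟩
  refine mapSet_quasiIso _ _ (scSnoc c) ?_ (lastH c (cstR (-1))) ?_ ?_ ?_
    (⟨fun p => p.2, continuous_snd⟩) ?_ ?_ ?_
  · intro x hx
    refine ⟨hx.1, ?_⟩
    rw [init_scSnoc]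
    exact hx.2
  · intro x _; exact lastH_zero_neg c x
  · intro x _; exact lastH_one _ _ _
  · intro τ h0 h1 x hx
    refine ⟨hx.1, ?_⟩
    rw [lastH_init]
    exact hx.2
  · intro x _; exact (prInit_scSnoc c x).symm
  · intro x _; rfl
  · intro τ _ _ x hx; exact hx

lemma HasPoly.susp {K L M : Ch} (φ : K ⟶ L) (ψ : L ⟶ M) (χ : K ⟶ M) [Mono φ] [Mono ψ] [Mono χ]
    (e : φ ≫ ψ = χ) (hχ : QuasiIso χ) {p : Polynomial ℕ} (h : HasPoly (Limits.cokernel φ) p) :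
    HasPoly (Limits.cokernel ψ) (Polynomial.X * p) := by
  have hS := tripleShort φ ψ χ e
  have hz : ∀ i, Limits.IsZero ((Limits.cokernel χ).homology i) := fun i =>
    ((Limits.cokernel χ).exactAt_iff_isZero_homology i).1 ((cokShort χ).acyclic_X₃ hχ i)
  intro i
  cases i with
  | zero =>
    have ep : Epi (HomologicalComplex.homologyMap
        (Limits.cokernel.map χ ψ φ (𝟙 M) (by simp [e])) 0) := by
      have := hS.epi_g
      exact HomologicalComplex.epi_homologyMap_of_epi_of_not_rel _ 0 (by simp)
    have hs : Subsingleton ((Limits.cokernel ψ).homology 0) := by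
      have h1 := (ModuleCat.epi_iff_surjective _).1 ep
      have h2 : Subsingleton ((Limits.cokernel χ).homology 0) :=
        ModuleCat.subsingleton_of_isZero (hz 0)
      exact h1.subsingleton
    rw [Polynomial.coeff_X_mul_zero]
    exact ⟨{ toFun := fun _ => 0, invFun := fun _ => 0, left_inv := fun _ => Subsingleton.elim _ _
             right_inv := fun _ => Subsingleton.elim _ _, map_add' := fun _ _ => by simp }⟩
  | succ i =>
    rw [Polynomial.coeff_X_mul]
    obtain ⟨f⟩ := h i
    exact ⟨(addEquivOfIso (hS.δIso (i + 1) i (by simp) (hz _) (hz _))).trans f⟩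

lemma SC_empty_isZero {X : TopCat.{0}} [IsEmpty X] : Limits.IsZero (SC.obj X) := by
  rw [Limits.IsZero.iff_id_eq_zero]
  ext n x
  refine sx_induction (p := fun x => ((𝟙 (SC.obj X) : SC.obj X ⟶ SC.obj X).f n).hom x =
    ((0 : SC.obj X ⟶ SC.obj X).f n).hom x) ?_ (fun a b ha hb => ?_) (fun m a ha => ?_)
    (fun σ => ?_) x
  · rw [map_zero, map_zero]
  · rw [map_add, map_add, ha, hb]
  · rw [map_zsmul, map_zsmul, ha]
  · exact isEmptyElim (σ (vtx n 0))

/-- The Thom isomorphism for trivial bundles. -/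
lemma thom {S : Set B} (hS : IsOpen S) {q : Polynomial ℕ} (hq : HasPoly (SC.obj (sp S)) q) (c : ℕ) :
    HasPoly (RelC (pcyl_sub S c)) (Polynomial.X ^ c * q) := by
  induction c with
  | zero =>
    rw [pow_zero, one_mul]
    have hemp : IsEmpty (sp (pcyl S 0)) := ⟨fun x => x.2.2 (Subsingleton.elim _ _)⟩
    have hz : Limits.IsZero (SC.obj (sp (pcyl S 0))) := SC_empty_isZero
    have h0 : ic (pcyl_sub S 0) = 0 := hz.eq_of_src _ _
    have hmono : Mono (Limits.cokernel.π (ic (pcyl_sub S 0))) :=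
      (cokShort (ic (pcyl_sub S 0))).exact.mono_g h0
    have hiso : IsIso (Limits.cokernel.π (ic (pcyl_sub S 0))) := isIso_of_mono_of_epi _
    have hm : Set.MapsTo (⟨fun x => (x, 0), by fun_prop⟩ : C(B, B × (Fin 0 → ℝ))) S (cyl S 0) :=
      fun x hx => hx
    have h1 : QuasiIso (SC.map (mapSet (⟨fun x => (x, 0), by fun_prop⟩ : C(B, B × (Fin 0 → ℝ))) hm)) := by
      refine mapSet_quasiIso _ _ ⟨Prod.fst, continuous_fst⟩ (fun x hx => hx)
        ⟨fun p => p.2, continuous_snd⟩ (fun _ _ => rfl) (fun _ _ => rfl) (fun _ _ _ _ hx => hx)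
        ⟨fun p => p.2, continuous_snd⟩ (fun _ _ => Prod.ext rfl (Subsingleton.elim _ _))
        (fun _ _ => rfl) (fun _ _ _ _ hx => hx)
    exact (hq.of_quasiIso _ h1).of_quasiIso (Limits.cokernel.π (ic (pcyl_sub S 0))) inferInstance
  | succ c ih =>
    rw [pow_succ', mul_assoc]
    have hT : upc S c 1 ∪ upc S c (-1) = pcyl S (c + 1) := by
      ext x
      simp only [upc, pcyl, Set.mem_union, Set.mem_ofPred_eq, ne_eq, init_eq_zero_iff (x.2)]
      rcases lt_trichotomy (x.2 (Fin.last c)) 0 with h | h | h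
      · have := h.ne
        have h' : 0 < -1 * x.2 (Fin.last c) := by linarith
        tauto
      · simp only [h, mul_zero, lt_irrefl]
        tauto
      · have := h.ne'
        have h' : 0 < 1 * x.2 (Fin.last c) := by linarith
        tauto
    have hI : upc S c 1 ∩ upc S c (-1) = midc S c := by
      ext x
      simp only [upc, midc, Set.mem_inter_iff, Set.mem_ofPred_eq, ne_eq]
      have h' : ¬ (0 < 1 * x.2 (Fin.last c) ∧ 0 < -1 * x.2 (Fin.last c)) := by
        rintro ⟨h1, h2⟩; linarith
      tauto
    have hIV : midc S c ⊆ upc S c (-1) := hI ▸ Set.inter_subset_right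
    have hIU : midc S c ⊆ upc S c 1 := hI ▸ Set.inter_subset_left
    have hUT : upc S c 1 ⊆ pcyl S (c + 1) := hT ▸ Set.subset_union_left
    have hVT : upc S c (-1) ⊆ pcyl S (c + 1) := hT ▸ Set.subset_union_right
    refine HasPoly.susp (ic hUT) (ic (pcyl_sub S (c + 1))) (ic (upc_sub S c 1)) (ic_comp _ _)
      (quasiIso_upc S c) ?_
    have ex := excision (isOpen_upc hS c 1) (isOpen_upc hS c (-1)) hT hI hIV hIU hUT hVT
    obtain ⟨h1, q1⟩ := quasiIso_low S c
    obtain ⟨h2, q2⟩ := quasiIso_mid S c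
    have q3 := quasiIso_cok_map (ic hIV) (ic (pcyl_sub S c)) _ _
      (mapSet_comm hIV (pcyl_sub S c) (prInit c) h1 h2) q2 q1
    exact (ih.of_quasiIso' _ q3).of_quasiIso _ ex

end susp

/-! ### Homology of a point -/

/-- Simplices of a point. -/
noncomputable def ptUnique (X : TopCat.{0}) [Unique X] (m : SimplexCategoryᵒᵖ) :
    Unique ((TopCat.toSSet.obj X).obj m) :=
  (TopCat.toSSetObjEquiv X m).trans
    ⟨fun _ => (), fun _ => ContinuousMap.const _ default, fun _ => by
      ext x; exact Subsingleton.elim _ _, fun _ => rfl⟩ |>.unique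

/-- The simplicial module of a point is constant. -/
noncomputable def ptConst (X : TopCat.{0}) [Unique X] :
    ((SimplicialObject.whiskering _ _).obj (ModuleCat.free ℤ)).obj (TopCat.toSSet.obj X) ≅
      (SimplicialObject.const _).obj ((ModuleCat.free ℤ).obj PUnit) :=
  NatIso.ofComponents (fun m => (ModuleCat.free ℤ).mapIso (Equiv.toIso
    ⟨fun _ => PUnit.unit, fun _ => (ptUnique X m).default,
      fun a => ((ptUnique X m).uniq a).symm, fun _ => rfl⟩)) (by
    intro a b f
    refine ((ModuleCat.free ℤ).map_comp _ _).symm.trans ?_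
    refine Eq.trans ?_ (Category.comp_id _).symm
    rfl)

lemma HasPoly.point (X : TopCat.{0}) [Unique X] : HasPoly (SC.obj X) 1 := by
  let e : SC.obj X ≅ ChainComplex.alternatingConst.obj ((ModuleCat.free ℤ).obj PUnit) :=
    (AlgebraicTopology.alternatingFaceMapComplex _).mapIso (ptConst X) ≪≫
      (AlgebraicTopology.alternatingFaceMapComplexConst).app _
  have h : HasPoly (ChainComplex.alternatingConst.obj ((ModuleCat.free ℤ).obj PUnit.{1})) 1 := by
    intro i
    rcases Nat.eq_zero_or_pos i with rfl | hi
    · rw [Polynomial.coeff_one_zero]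
      refine ⟨(addEquivOfIso (ChainComplex.alternatingConstHomologyZero _)).trans ?_⟩
      exact ((Finsupp.LinearEquiv.finsuppUnique ℤ ℤ PUnit).trans
        (LinearEquiv.funUnique (Fin 1) ℤ ℤ).symm).toAddEquiv
    · rw [Polynomial.coeff_one, if_neg hi.ne']
      have h := ChainComplex.alternatingConst_exactAt ((ModuleCat.free ℤ).obj PUnit.{1}) i hi.ne'
      have hs : Subsingleton ((ChainComplex.alternatingConst.obj
          ((ModuleCat.free ℤ).obj PUnit.{1})).homology i) :=
        ModuleCat.subsingleton_of_isZero ((HomologicalComplex.exactAt_iff_isZero_homology _ i).1 h)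
      exact ⟨{ toFun := fun _ => 0, invFun := fun _ => 0,
               left_inv := fun _ => Subsingleton.elim _ _
               right_inv := fun _ => Subsingleton.elim _ _, map_add' := fun _ _ => by simp }⟩
  exact h.of_quasiIso' e.hom inferInstance

/-! ### The sets `M` -/

/-- The complement of the `k`-equal arrangement on an arbitrary index type. -/
def Mk (k : ℕ) (ι : Type) : Set (ι → ℝ) :=
  {x | ∀ S : Finset ι, S.card = k → ¬ (∀ i ∈ S, ∀ j ∈ S, x i = x j)}

lemma isOpen_Mk (k : ℕ) (ι : Type) [Fintype ι] : IsOpen (Mk k ι) := by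
  have : Mk k ι = ⋂ S : {S : Finset ι // S.card = k}, ⋃ i : S.1, ⋃ j : S.1,
      {x : ι → ℝ | x i ≠ x j} := by
    ext x
    simp [Mk]
  rw [this]
  refine isOpen_iInter_of_finite fun S => isOpen_iUnion fun i => isOpen_iUnion fun j => ?_
  exact isOpen_ne_fun (continuous_apply _) (continuous_apply _)

lemma Mk_of_inj {k : ℕ} {ι κ : Type} {x : ι → ℝ} (hx : x ∈ Mk k ι) (y : κ → ℝ) (f : κ ↪ ι)
    (h : ∀ i j, y i = y j → x (f i) = x (f j)) : y ∈ Mk k κ := by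
  intro S hS hall
  refine hx (S.map f) (by simpa using hS) ?_
  simp only [Finset.mem_map]
  rintro _ ⟨i, hi, rfl⟩ _ ⟨j, hj, rfl⟩
  exact h i j (hall i hi j hj)

lemma Mk_iff {k : ℕ} (hk : 1 ≤ k) {ι : Type} [Fintype ι] (x : ι → ℝ) :
    x ∈ Mk k ι ↔ ∀ v, (Finset.univ.filter fun i => x i = v).card < k := by
  constructor
  · intro h v
    by_contra! hc
    obtain ⟨S, hS, hSk⟩ := Finset.exists_subset_card_eq hc
    refine h S hSk fun i hi j hj => ?_
    have h1 := hS hi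
    have h2 := hS hj
    simp only [Finset.mem_filter] at h1 h2
    rw [h1.2, h2.2]
  · intro h S hS hall
    have : S.Nonempty := Finset.card_pos.1 (by omega)
    obtain ⟨i, hi⟩ := this
    have h1 := h (x i)
    have h2 : S ⊆ Finset.univ.filter fun j => x j = x i := by
      intro j hj
      simpa using hall j hj i hi
    have := Finset.card_le_card h2
    omega

lemma Mk_cons {k : ℕ} (hk : 1 ≤ k) {n : ℕ} (s : ℝ) (y : Fin n → ℝ) :
    (Fin.cons s y : Fin (n + 1) → ℝ) ∈ Mk k (Fin (n + 1)) ↔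
      y ∈ Mk k (Fin n) ∧ (Finset.univ.filter fun i => y i = s).card ≠ k - 1 := by
  rw [Mk_iff hk, Mk_iff hk]
  simp only [Fin.card_filter_univ_succ', Fin.cons_zero, Fin.cons_succ]
  constructor
  · intro h
    refine ⟨fun v => ?_, ?_⟩
    · have := h v; omega
    · have := h s; simp at this; omega
  · rintro ⟨h1, h2⟩ v
    have := h1 v
    split_ifs with hv
    · subst hv; omega
    · omega

/-- The poly recursion. -/
noncomputable def Rp {R : Type} [CommSemiring R] (x : R) (k : ℕ) : ℕ → R
  | 0 => 1
  | n + 1 => Rp x k n + x * ∑ c ∈ (Finset.univ : Finset (Fin n → SignType)).filter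
      (fun c => (Finset.univ.filter fun i => c i = 0).card = k - 1),
      Rp x k (Finset.univ.filter fun i => c i = -1).card *
        Rp x k (Finset.univ.filter fun i => c i = 1).card
  termination_by n => n
  decreasing_by
  · omega
  · exact Nat.lt_succ_of_le ((Finset.card_le_univ _).trans (by simp))
  · exact Nat.lt_succ_of_le ((Finset.card_le_univ _).trans (by simp))

lemma Rp_zero {R : Type} [CommSemiring R] (x : R) (k : ℕ) : Rp x k 0 = 1 := by rw [Rp]

lemma Rp_succ {R : Type} [CommSemiring R] (x : R) (k n : ℕ) : Rp x k (n + 1) =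
    Rp x k n + x * ∑ c ∈ (Finset.univ : Finset (Fin n → SignType)).filter
      (fun c => (Finset.univ.filter fun i => c i = 0).card = k - 1),
      Rp x k (Finset.univ.filter fun i => c i = -1).card *
        Rp x k (Finset.univ.filter fun i => c i = 1).card := by rw [Rp]

lemma Rp_map {R R' : Type} [CommSemiring R] [CommSemiring R'] (f : R →+* R') (x : R) (k n : ℕ) :
    f (Rp x k n) = Rp (f x) k n := by
  induction n using Nat.strong_induction_on with
  | _ n ih =>
    cases n with
    | zero => simp [Rp_zero]
    | succ n =>
      rw [Rp_succ, Rp_succ, map_add, map_mul, map_sum, ih n (by omega)]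
      congr 2
      refine Finset.sum_congr rfl fun c _ => ?_
      rw [map_mul, ih, ih]
      · exact Nat.lt_succ_of_le ((Finset.card_le_univ _).trans (by simp))
      · exact Nat.lt_succ_of_le ((Finset.card_le_univ _).trans (by simp))

/-! ### The pieces removed when adding a coordinate -/

section step

variable {Y : Type}

/-- The ambient open set. -/
def Wst (k n : ℕ) (S : Set Y) : Set ((Fin n → ℝ) × (ℝ × Y)) :=
  {p | p.1 ∈ Mk k (Fin n) ∧ p.2.2 ∈ S}

/-- The removed pieces. -/
def Ac {n : ℕ} (Y : Type) (c : Fin n → SignType) : Set ((Fin n → ℝ) × (ℝ × Y)) :=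
  {p | ∀ i, (c i = 0 → p.1 i = p.2.1) ∧ (c i = -1 → p.1 i ≤ p.2.1) ∧ (c i = 1 → p.2.1 ≤ p.1 i)}

/-- The linear space spanned by a piece. -/
def Zc {n : ℕ} (Y : Type) (c : Fin n → SignType) : Set ((Fin n → ℝ) × (ℝ × Y)) :=
  {p | ∀ i, c i = 0 → p.1 i = p.2.1}

/-- Neighbourhoods of the removed pieces. -/
def Oc (k : ℕ) {n : ℕ} (S : Set Y) (c : Fin n → SignType) : Set ((Fin n → ℝ) × (ℝ × Y)) :=
  {p | p ∈ Wst k n S ∧ ∀ i,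
    (c i = -1 → p.1 i < p.2.1 ∧ ∀ j, c j = 0 → p.1 i < p.1 j) ∧
    (c i = 1 → p.2.1 < p.1 i ∧ ∀ j, c j = 0 → p.1 j < p.1 i)}

/-- The number of zeros. -/
def zn {n : ℕ} (c : Fin n → SignType) : ℕ := (Finset.univ.filter fun i => c i = 0).card

lemma Ac_ne {k n : ℕ} (hk : 2 ≤ k) {S : Set Y} {c : Fin n → SignType} (hc : zn c = k - 1)
    {p : (Fin n → ℝ) × (ℝ × Y)} (hp : p ∈ Wst k n S) (hA : p ∈ Zc Y c) (i : Fin n) (hi : c i ≠ 0) :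
    p.1 i ≠ p.2.1 := by
  intro he
  refine hp.1 (insert i (Finset.univ.filter fun i => c i = 0)) ?_ ?_
  · rw [Finset.card_insert_of_notMem (by simpa using hi)]
    change zn c + 1 = k
    omega
  · have : ∀ j ∈ insert i (Finset.univ.filter fun i => c i = 0), p.1 j = p.2.1 := by
      intro j hj
      rcases Finset.mem_insert.1 hj with rfl | hj
      · exact he
      · exact hA j (by simpa using hj)
    intro a ha b hb
    rw [this a ha, this b hb]

lemma Ac_sub_Oc {k n : ℕ} (hk : 2 ≤ k) {S : Set Y} {c : Fin n → SignType} (hc : zn c = k - 1)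
    {p : (Fin n → ℝ) × (ℝ × Y)} (hp : p ∈ Wst k n S) (hA : p ∈ Ac Y c) : p ∈ Oc k S c := by
  have hZ : p ∈ Zc Y c := fun i hi => (hA i).1 hi
  refine ⟨hp, fun i => ⟨fun hi => ?_, fun hi => ?_⟩⟩
  · have h1 : p.1 i < p.2.1 := lt_of_le_of_ne ((hA i).2.1 hi)
      (Ac_ne hk hc hp hZ i (by rw [hi]; decide))
    exact ⟨h1, fun j hj => by rw [hZ j hj]; exact h1⟩
  · have h1 : p.2.1 < p.1 i := lt_of_le_of_ne ((hA i).2.2 hi)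
      (Ac_ne hk hc hp hZ i (by rw [hi]; decide)).symm
    exact ⟨h1, fun j hj => by rw [hZ j hj]; exact h1⟩

lemma Ac_iff_Zc {k n : ℕ} {S : Set Y} {c : Fin n → SignType}
    {p : (Fin n → ℝ) × (ℝ × Y)} (hp : p ∈ Oc k S c) : p ∈ Ac Y c ↔ p ∈ Zc Y c :=
  ⟨fun h i hi => (h i).1 hi, fun h i => ⟨h i, fun hi => ((hp.2 i).1 hi).1.le,
    fun hi => ((hp.2 i).2 hi).1.le⟩⟩

lemma sign_cases (s : SignType) : s = 0 ∨ s = -1 ∨ s = 1 := by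
  cases s <;> simp

lemma Oc_disj {k n : ℕ} (hk : 2 ≤ k) {S : Set Y} {c c' : Fin n → SignType} (hc : zn c = k - 1)
    (hc' : zn c' = k - 1) {p : (Fin n → ℝ) × (ℝ × Y)} (hp : p ∈ Oc k S c) (hA : p ∈ Ac Y c') :
    c = c' := by
  have hO := Ac_sub_Oc hk hc' hp.1 hA
  have h1 : ∀ i, c i = -1 → c' i = -1 := by
    intro i hi
    have h := ((hp.2 i).1 hi).1
    rcases sign_cases (c' i) with h' | h' | h'
    · have := (hA i).1 h'; linarith
    · exact h'
    · have := (hA i).2.2 h'; linarith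
  have h2 : ∀ i, c i = 1 → c' i = 1 := by
    intro i hi
    have h := ((hp.2 i).2 hi).1
    rcases sign_cases (c' i) with h' | h' | h'
    · have := (hA i).1 h'; linarith
    · have := (hA i).2.1 h'; linarith
    · exact h'
  have h3 : (Finset.univ.filter fun i => c' i = 0) = Finset.univ.filter fun i => c i = 0 := by
    refine Finset.eq_of_subset_of_card_le ?_ (le_of_eq (hc.trans hc'.symm))
    intro i hi
    simp only [Finset.mem_filter, Finset.mem_univ, true_and] at hi ⊢
    rcases sign_cases (c i) with h | h | h
    · exact h
    · rw [h1 i h] at hi; exact absurd hi (by decide)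
    · rw [h2 i h] at hi; exact absurd hi (by decide)
  ext i
  rcases sign_cases (c i) with h | h | h
  · have : i ∈ Finset.univ.filter fun i => c' i = 0 := by rw [h3]; simpa using h
    rw [h, (Finset.mem_filter.1 this).2]
  · rw [h, h1 i h]
  · rw [h, h2 i h]

lemma mem_Mk_of_sep {k n : ℕ} (hk : 2 ≤ k) {c : Fin n → SignType} (hc : zn c = k - 1)
    (x : Fin n → ℝ) (hsep : ∀ i j, x i = x j → c i = c j)
    (hL : (fun i : {i // c i = -1} => x i) ∈ Mk k {i // c i = -1})
    (hR : (fun i : {i // c i = 1} => x i) ∈ Mk k {i // c i = 1}) : x ∈ Mk k (Fin n) := by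
  intro T hT hall
  obtain ⟨i, hi⟩ : T.Nonempty := Finset.card_pos.1 (by omega)
  have hcc : ∀ j ∈ T, c j = c i := fun j hj => hsep _ _ (hall j hj i hi)
  rcases sign_cases (c i) with h | h | h
  · have : T ⊆ Finset.univ.filter fun i => c i = 0 := fun j hj => by simp [hcc j hj, h]
    have := Finset.card_le_card this
    change _ ≤ zn c at this
    omega
  · refine hL (T.subtype fun i => c i = -1) ?_ ?_
    · rw [Finset.card_subtype, Finset.filter_true_of_mem, hT]
      intro j hj
      rw [hcc j hj, h]
    · intro a ha b hb
      exact hall a (by simpa using ha) b (by simpa using hb)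
  · refine hR (T.subtype fun i => c i = 1) ?_ ?_
    · rw [Finset.card_subtype, Finset.filter_true_of_mem, hT]
      intro j hj
      rw [hcc j hj, h]
    · intro a ha b hb
      exact hall a (by simpa using ha) b (by simpa using hb)

/-- Criterion for membership in `Oc`. -/
lemma mem_Oc {k n : ℕ} (hk : 2 ≤ k) {c : Fin n → SignType} (hc : zn c = k - 1) {S : Set Y}
    (p : (Fin n → ℝ) × (ℝ × Y)) (hS : p.2.2 ∈ S)
    (hL : (fun i : {i // c i = -1} => p.1 i) ∈ Mk k {i // c i = -1})
    (hR : (fun i : {i // c i = 1} => p.1 i) ∈ Mk k {i // c i = 1})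
    (h : ∀ i, (c i = -1 → p.1 i < p.2.1 ∧ ∀ j, c j = 0 → p.1 i < p.1 j) ∧
      (c i = 1 → p.2.1 < p.1 i ∧ ∀ j, c j = 0 → p.1 j < p.1 i)) : p ∈ Oc k S c := by
  refine ⟨⟨mem_Mk_of_sep hk hc p.1 ?_ hL hR, hS⟩, h⟩
  intro i j hij
  rcases sign_cases (c i) with hi | hi | hi <;> rcases sign_cases (c j) with hj | hj | hj
  · rw [hi, hj]
  · have := ((h j).1 hj).2 i hi; linarith
  · have := ((h j).2 hj).2 i hi; linarith
  · have := ((h i).1 hi).2 j hj; linarith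
  · rw [hi, hj]
  · have := ((h i).1 hi).1; have := ((h j).2 hj).1; linarith
  · have := ((h i).2 hi).2 j hj; linarith
  · have := ((h i).2 hi).1; have := ((h j).1 hj).1; linarith
  · rw [hi, hj]

variable [TopologicalSpace Y]

lemma isOpen_Wst {k n : ℕ} {S : Set Y} (hS : IsOpen S) : IsOpen (Wst k n S) :=
  ((isOpen_Mk k (Fin n)).preimage continuous_fst).inter
    (hS.preimage (continuous_snd.comp continuous_snd))

lemma isClosed_Ac {n : ℕ} (c : Fin n → SignType) : IsClosed (Ac Y c) := by
  have : Ac Y c = ⋂ i, ((⋂ _ : c i = 0, {p | p.1 i = p.2.1}) ∩ ((⋂ _ : c i = -1, {p | p.1 i ≤ p.2.1})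
      ∩ ⋂ _ : c i = 1, {p | p.2.1 ≤ p.1 i})) := by
    ext p; simp [Ac]
  rw [this]
  refine isClosed_iInter fun i => ?_
  have hc1 : Continuous (fun p : (Fin n → ℝ) × (ℝ × Y) => p.1 i) := by fun_prop
  have hc2 : Continuous (fun p : (Fin n → ℝ) × (ℝ × Y) => p.2.1) := by fun_prop
  exact (isClosed_iInter fun _ => isClosed_eq hc1 hc2).inter
    ((isClosed_iInter fun _ => isClosed_le hc1 hc2).inter
      (isClosed_iInter fun _ => isClosed_le hc2 hc1))

lemma isOpen_Oc {k n : ℕ} {S : Set Y} (hS : IsOpen S) (c : Fin n → SignType) :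
    IsOpen (Oc k S c) := by
  have : Oc k S c = Wst k n S ∩ ⋂ i, ((⋂ _ : c i = -1, ({p | p.1 i < p.2.1} ∩
      ⋂ j, ⋂ _ : c j = 0, {p | p.1 i < p.1 j})) ∩
      (⋂ _ : c i = 1, ({p | p.2.1 < p.1 i} ∩ ⋂ j, ⋂ _ : c j = 0, {p | p.1 j < p.1 i}))) := by
    ext p; simp [Oc]
  rw [this]
  have hc1 : ∀ i, Continuous (fun p : (Fin n → ℝ) × (ℝ × Y) => p.1 i) := by intro i; fun_prop
  have hc2 : Continuous (fun p : (Fin n → ℝ) × (ℝ × Y) => p.2.1) := by fun_prop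
  refine (isOpen_Wst hS).inter (isOpen_iInter_of_finite fun i => ?_)
  refine IsOpen.inter (isOpen_iInter_of_finite fun _ => IsOpen.inter ?_ ?_)
    (isOpen_iInter_of_finite fun _ => IsOpen.inter ?_ ?_)
  · exact isOpen_lt (hc1 i) hc2
  · exact isOpen_iInter_of_finite fun j => isOpen_iInter_of_finite fun _ => isOpen_lt (hc1 i) (hc1 j)
  · exact isOpen_lt hc2 (hc1 i)
  · exact isOpen_iInter_of_finite fun j => isOpen_iInter_of_finite fun _ => isOpen_lt (hc1 j) (hc1 i)

/-! #### Trivialization of the neighbourhood -/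

/-- Left labels. -/
abbrev Lt {n : ℕ} (c : Fin n → SignType) : Type := {i // c i = -1}

/-- Right labels. -/
abbrev Rt {n : ℕ} (c : Fin n → SignType) : Type := {i // c i = 1}

/-- The base. -/
abbrev Bs {n : ℕ} (Y : Type) (c : Fin n → SignType) : Type := (Lt c → ℝ) × ((Rt c → ℝ) × Y)

/-- To the trivialization. -/
def fc {n m : ℕ} (Y : Type) [TopologicalSpace Y] (c : Fin n → SignType) (e : Fin m ≃ {i // c i = 0}) :
    C((Fin n → ℝ) × (ℝ × Y), Bs Y c × (Fin m → ℝ)) :=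
  ⟨fun p => ((fun i => p.1 i, (fun i => p.1 i, p.2.2)), fun a => p.1 (e a) - p.2.1), by fun_prop⟩

/-- The coordinates of the inverse. -/
noncomputable def gcoord {n m : ℕ} {c : Fin n → SignType} (e : Fin m ≃ {i // c i = 0})
    (a : Lt c → ℝ) (b : Rt c → ℝ) (z : Fin m → ℝ) (i : Fin n) : ℝ :=
  if h : c i = -1 then -(∑ j, |z j|) - Real.exp (-(a ⟨i, h⟩))
  else if h : c i = 1 then (∑ j, |z j|) + Real.exp (b ⟨i, h⟩)
  else if h : c i = 0 then z (e.symm ⟨i, h⟩) else 0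

lemma gcoord_neg {n m : ℕ} {c : Fin n → SignType} (e : Fin m ≃ {i // c i = 0})
    (a : Lt c → ℝ) (b : Rt c → ℝ) (z : Fin m → ℝ) (i : Fin n) (h : c i = -1) :
    gcoord e a b z i = -(∑ j, |z j|) - Real.exp (-(a ⟨i, h⟩)) := by
  rw [gcoord, dif_pos h]

lemma gcoord_pos {n m : ℕ} {c : Fin n → SignType} (e : Fin m ≃ {i // c i = 0})
    (a : Lt c → ℝ) (b : Rt c → ℝ) (z : Fin m → ℝ) (i : Fin n) (h : c i = 1) :
    gcoord e a b z i = (∑ j, |z j|) + Real.exp (b ⟨i, h⟩) := by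
  rw [gcoord, dif_neg (by rw [h]; decide), dif_pos h]

lemma gcoord_zero {n m : ℕ} {c : Fin n → SignType} (e : Fin m ≃ {i // c i = 0})
    (a : Lt c → ℝ) (b : Rt c → ℝ) (z : Fin m → ℝ) (i : Fin n) (h : c i = 0) :
    gcoord e a b z i = z (e.symm ⟨i, h⟩) := by
  rw [gcoord, dif_neg (by rw [h]; decide), dif_neg (by rw [h]; decide), dif_pos h]

/-- From the trivialization. -/
noncomputable def gc {n m : ℕ} (Y : Type) [TopologicalSpace Y] (c : Fin n → SignType)
    (e : Fin m ≃ {i // c i = 0}) : C(Bs Y c × (Fin m → ℝ), (Fin n → ℝ) × (ℝ × Y)) :=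
  ⟨fun q => (gcoord e q.1.1 q.1.2.1 q.2, (0, q.1.2.2)), by
    refine Continuous.prodMk (continuous_pi fun i => ?_) (by fun_prop)
    unfold gcoord
    split_ifs <;> fun_prop⟩

/-- The homotopy upstairs. -/
noncomputable def Hc {n m : ℕ} (Y : Type) [TopologicalSpace Y] (c : Fin n → SignType)
    (e : Fin m ≃ {i // c i = 0}) : C(ℝ × ((Fin n → ℝ) × (ℝ × Y)), (Fin n → ℝ) × (ℝ × Y)) :=
  ⟨fun q => (fun i => q.1 * q.2.1 i + (1 - q.1) * (gc Y c e (fc Y c e q.2)).1 i,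
    (q.1 * q.2.2.1, q.2.2.2)), by
    have h := (gc Y c e).continuous.comp (fc Y c e).continuous
    have h' : ∀ i, Continuous (fun p => (gc Y c e (fc Y c e p)).1 i) := fun i =>
      (continuous_apply i).comp (continuous_fst.comp h)
    refine Continuous.prodMk (continuous_pi fun i => ?_) (by fun_prop)
    have := (h' i).comp (continuous_snd : Continuous (Prod.snd : ℝ × ((Fin n → ℝ) × (ℝ × Y)) → _))
    exact (by fun_prop : Continuous fun q : ℝ × ((Fin n → ℝ) × (ℝ × Y)) => q.1 * q.2.1 i).add
      ((by fun_prop : Continuous fun q : ℝ × ((Fin n → ℝ) × (ℝ × Y)) => 1 - q.1).mul this)⟩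

/-- The homotopy downstairs. -/
noncomputable def Kc {n m : ℕ} (Y : Type) [TopologicalSpace Y] (c : Fin n → SignType)
    (_e : Fin m ≃ {i // c i = 0}) : C(ℝ × (Bs Y c × (Fin m → ℝ)), Bs Y c × (Fin m → ℝ)) :=
  ⟨fun q => ((fun i => q.1 * q.2.1.1 i + (1 - q.1) * (-(∑ j, |q.2.2 j|) - Real.exp (-(q.2.1.1 i))),
    (fun i => q.1 * q.2.1.2.1 i + (1 - q.1) * ((∑ j, |q.2.2 j|) + Real.exp (q.2.1.2.1 i)),
      q.2.1.2.2)), q.2.2), by fun_prop⟩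

lemma conv_inj {φ : ℝ → ℝ} (hφ : StrictMono φ) {τ : ℝ} (h0 : 0 ≤ τ) (h1 : τ ≤ 1) {a b : ℝ}
    (h : τ * a + (1 - τ) * φ a = τ * b + (1 - τ) * φ b) : a = b := by
  have hm : StrictMono fun a => τ * a + (1 - τ) * φ a := by
    intro a b hab
    have := hφ hab
    rcases h1.eq_or_lt with rfl | h1
    · simpa using hab
    · have h2 := mul_lt_mul_of_pos_left this (sub_pos.2 h1)
      have h3 := mul_le_mul_of_nonneg_left hab.le h0
      simp only
      linarith
  exact hm.injective h

lemma conv_lt {τ : ℝ} (h0 : 0 ≤ τ) (h1 : τ ≤ 1) {a b a' b' : ℝ} (h : a < b) (h' : a' < b') :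
    τ * a + (1 - τ) * a' < τ * b + (1 - τ) * b' := by
  rcases h1.eq_or_lt with rfl | h1
  · simpa using h
  · have h2 := mul_lt_mul_of_pos_left h' (sub_pos.2 h1)
    have h3 := mul_le_mul_of_nonneg_left h.le h0
    linarith

lemma strictMono_L (N : ℝ) : StrictMono fun a : ℝ => -N - Real.exp (-a) := by
  intro a b hab
  have := Real.exp_lt_exp.2 (neg_lt_neg hab)
  simp only; linarith

lemma strictMono_R (N : ℝ) : StrictMono fun a : ℝ => N + Real.exp a := by
  intro a b hab
  have := Real.exp_lt_exp.2 hab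
  simp only; linarith

/-- The base set. -/
def Bset (k : ℕ) {n : ℕ} (S : Set Y) (c : Fin n → SignType) : Set (Bs Y c) :=
  Mk k (Lt c) ×ˢ (Mk k (Rt c) ×ˢ S)

lemma gcoord_order {n m : ℕ} {c : Fin n → SignType} (e : Fin m ≃ {i // c i = 0})
    (a : Lt c → ℝ) (b : Rt c → ℝ) (z : Fin m → ℝ) (i : Fin n) :
    (c i = -1 → gcoord e a b z i < 0 ∧ ∀ j, c j = 0 → gcoord e a b z i < gcoord e a b z j) ∧
    (c i = 1 → 0 < gcoord e a b z i ∧ ∀ j, c j = 0 → gcoord e a b z j < gcoord e a b z i) := by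
  have hN : ∀ j, |z j| ≤ ∑ j, |z j| := fun j =>
    Finset.single_le_sum (f := fun j => |z j|) (fun j _ => abs_nonneg _) (Finset.mem_univ j)
  have hN0 : 0 ≤ ∑ j, |z j| := Finset.sum_nonneg fun j _ => abs_nonneg _
  refine ⟨fun h => ?_, fun h => ?_⟩
  · rw [gcoord_neg e a b z i h]
    have := Real.exp_pos (-(a ⟨i, h⟩))
    refine ⟨by linarith, fun j hj => ?_⟩
    rw [gcoord_zero e a b z j hj]
    have h1 := hN (e.symm ⟨j, hj⟩)
    have h2 := neg_abs_le (z (e.symm ⟨j, hj⟩))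
    linarith
  · rw [gcoord_pos e a b z i h]
    have := Real.exp_pos (b ⟨i, h⟩)
    refine ⟨by linarith, fun j hj => ?_⟩
    rw [gcoord_zero e a b z j hj]
    have h1 := hN (e.symm ⟨j, hj⟩)
    have h2 := le_abs_self (z (e.symm ⟨j, hj⟩))
    linarith

lemma fc_maps {k n m : ℕ} {S : Set Y} (c : Fin n → SignType) (e : Fin m ≃ {i // c i = 0}) :
    Set.MapsTo (fc Y c e) (Oc k S c) (cyl (Bset k S c) m) := by
  intro p hp
  exact ⟨Mk_of_inj hp.1.1 _ (Function.Embedding.subtype _) fun i j h => h,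
    Mk_of_inj hp.1.1 _ (Function.Embedding.subtype _) fun i j h => h, hp.1.2⟩

lemma fc_snd_zero {n m : ℕ} (c : Fin n → SignType) (e : Fin m ≃ {i // c i = 0})
    (p : (Fin n → ℝ) × (ℝ × Y)) : (fc Y c e p).2 = 0 ↔ p ∈ Zc Y c := by
  constructor
  · intro h i hi
    have := congrFun h (e.symm ⟨i, hi⟩)
    change p.1 (e (e.symm ⟨i, hi⟩)) - p.2.1 = 0 at this
    rw [Equiv.apply_symm_apply] at this
    linarith
  · intro h
    ext a
    change p.1 (e a) - p.2.1 = 0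
    rw [h _ (e a).2, sub_self]

lemma gc_maps {k n m : ℕ} (hk : 2 ≤ k) {S : Set Y} (c : Fin n → SignType) (hc : zn c = k - 1)
    (e : Fin m ≃ {i // c i = 0}) :
    Set.MapsTo (gc Y c e) (cyl (Bset k S c) m) (Oc k S c) := by
  intro q hq
  refine mem_Oc hk hc _ hq.2.2 ?_ ?_ (fun i => gcoord_order e _ _ _ i)
  · refine Mk_of_inj hq.1 _ (Function.Embedding.refl _) fun i j h => ?_
    change gcoord e q.1.1 q.1.2.1 q.2 i = gcoord e q.1.1 q.1.2.1 q.2 j at h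
    rw [gcoord_neg _ _ _ _ _ i.2, gcoord_neg _ _ _ _ _ j.2] at h
    exact (strictMono_L _).injective h
  · refine Mk_of_inj hq.2.1 _ (Function.Embedding.refl _) fun i j h => ?_
    change gcoord e q.1.1 q.1.2.1 q.2 i = gcoord e q.1.1 q.1.2.1 q.2 j at h
    rw [gcoord_pos _ _ _ _ _ i.2, gcoord_pos _ _ _ _ _ j.2] at h
    exact (strictMono_R _).injective h

lemma fc_gc_snd {n m : ℕ} (c : Fin n → SignType) (e : Fin m ≃ {i // c i = 0})
    (q : Bs Y c × (Fin m → ℝ)) : (fc Y c e (gc Y c e q)).2 = q.2 := by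
  ext a
  change gcoord e q.1.1 q.1.2.1 q.2 (e a) - 0 = _
  rw [gcoord_zero _ _ _ _ _ (e a).2, sub_zero]
  simp

lemma Hc_maps {k n m : ℕ} (hk : 2 ≤ k) {S : Set Y} (c : Fin n → SignType) (hc : zn c = k - 1)
    (e : Fin m ≃ {i // c i = 0}) (τ : ℝ) (h0 : 0 ≤ τ) (h1 : τ ≤ 1)
    (p : (Fin n → ℝ) × (ℝ × Y)) (hp : p ∈ Oc k S c) : Hc Y c e (τ, p) ∈ Oc k S c := by
  have ho := gcoord_order e (fun i => p.1 i) (fun i => p.1 i) (fun a => p.1 (e a) - p.2.1)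
  have hco : ∀ i, (Hc Y c e (τ, p)).1 i = τ * p.1 i + (1 - τ) *
    gcoord e (fun i => p.1 i) (fun i => p.1 i) (fun a => p.1 (e a) - p.2.1) i := fun i => rfl
  have hs : (Hc Y c e (τ, p)).2.1 = τ * p.2.1 + (1 - τ) * 0 := by
    rw [mul_zero, add_zero]; rfl
  refine mem_Oc hk hc _ hp.1.2 ?_ ?_ ?_
  · refine Mk_of_inj hp.1.1 _ (Function.Embedding.subtype _) fun i j h => ?_
    rw [hco, hco, gcoord_neg _ _ _ _ _ i.2, gcoord_neg _ _ _ _ _ j.2] at h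
    exact conv_inj (strictMono_L _) h0 h1 h
  · refine Mk_of_inj hp.1.1 _ (Function.Embedding.subtype _) fun i j h => ?_
    rw [hco, hco, gcoord_pos _ _ _ _ _ i.2, gcoord_pos _ _ _ _ _ j.2] at h
    exact conv_inj (strictMono_R _) h0 h1 h
  · intro i
    refine ⟨fun hi => ⟨?_, fun j hj => ?_⟩, fun hi => ⟨?_, fun j hj => ?_⟩⟩
    · rw [hco, hs]
      exact conv_lt h0 h1 ((hp.2 i).1 hi).1 ((ho i).1 hi).1
    · rw [hco, hco]
      exact conv_lt h0 h1 (((hp.2 i).1 hi).2 j hj) (((ho i).1 hi).2 j hj)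
    · rw [hco, hs]
      exact conv_lt h0 h1 ((hp.2 i).2 hi).1 ((ho i).2 hi).1
    · rw [hco, hco]
      exact conv_lt h0 h1 (((hp.2 i).2 hi).2 j hj) (((ho i).2 hi).2 j hj)

lemma fc_Hc {n m : ℕ} (c : Fin n → SignType) (e : Fin m ≃ {i // c i = 0}) (τ : ℝ)
    (p : (Fin n → ℝ) × (ℝ × Y)) : (fc Y c e (Hc Y c e (τ, p))).2 = (fc Y c e p).2 := by
  ext a
  have h := congrFun (fc_gc_snd c e (fc Y c e p)) a
  change (gc Y c e (fc Y c e p)).1 (e a) - 0 = p.1 (e a) - p.2.1 at h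
  change τ * p.1 (e a) + (1 - τ) * (gc Y c e (fc Y c e p)).1 (e a) - τ * p.2.1 = p.1 (e a) - p.2.1
  rw [sub_zero] at h
  rw [h]
  ring

lemma Kc_maps {k n m : ℕ} {S : Set Y} (c : Fin n → SignType)
    (e : Fin m ≃ {i // c i = 0}) (τ : ℝ) (h0 : 0 ≤ τ) (h1 : τ ≤ 1)
    (q : Bs Y c × (Fin m → ℝ)) (hq : q ∈ cyl (Bset k S c) m) :
    Kc Y c e (τ, q) ∈ cyl (Bset k S c) m := by
  refine ⟨?_, ?_, hq.2.2⟩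
  · exact Mk_of_inj hq.1 _ (Function.Embedding.refl _) fun i j h => conv_inj (strictMono_L _) h0 h1 h
  · exact Mk_of_inj hq.2.1 _ (Function.Embedding.refl _) fun i j h => conv_inj (strictMono_R _) h0 h1 h

lemma Hc_zero {n m : ℕ} (c : Fin n → SignType) (e : Fin m ≃ {i // c i = 0})
    (p : (Fin n → ℝ) × (ℝ × Y)) : Hc Y c e (0, p) = gc Y c e (fc Y c e p) := by
  refine Prod.ext ?_ (Prod.ext ?_ rfl)
  · ext i
    change 0 * p.1 i + (1 - 0) * (gc Y c e (fc Y c e p)).1 i = _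
    ring
  · change 0 * p.2.1 = 0
    ring

lemma Hc_one {n m : ℕ} (c : Fin n → SignType) (e : Fin m ≃ {i // c i = 0})
    (p : (Fin n → ℝ) × (ℝ × Y)) : Hc Y c e (1, p) = p := by
  refine Prod.ext ?_ (Prod.ext ?_ rfl)
  · ext i
    change 1 * p.1 i + (1 - 1) * (gc Y c e (fc Y c e p)).1 i = _
    ring
  · change 1 * p.2.1 = _
    ring

lemma Kc_one {n m : ℕ} (c : Fin n → SignType) (e : Fin m ≃ {i // c i = 0})
    (q : Bs Y c × (Fin m → ℝ)) : Kc Y c e (1, q) = q := by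
  refine Prod.ext (Prod.ext ?_ (Prod.ext ?_ rfl)) rfl
  · ext i
    change 1 * q.1.1 i + (1 - 1) * _ = _
    ring
  · ext i
    change 1 * q.1.2.1 i + (1 - 1) * _ = _
    ring

lemma Kc_zero {n m : ℕ} (c : Fin n → SignType) (e : Fin m ≃ {i // c i = 0})
    (q : Bs Y c × (Fin m → ℝ)) : Kc Y c e (0, q) = fc Y c e (gc Y c e q) := by
  refine Prod.ext (Prod.ext ?_ (Prod.ext ?_ rfl)) (fc_gc_snd c e q).symm
  · ext i
    change 0 * q.1.1 i + (1 - 0) * (-(∑ j, |q.2 j|) - Real.exp (-(q.1.1 i))) =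
      gcoord e q.1.1 q.1.2.1 q.2 i
    rw [gcoord_neg _ _ _ _ _ i.2]
    ring
  · ext i
    change 0 * q.1.2.1 i + (1 - 0) * ((∑ j, |q.2 j|) + Real.exp (q.1.2.1 i)) =
      gcoord e q.1.1 q.1.2.1 q.2 i
    rw [gcoord_pos _ _ _ _ _ i.2]
    ring

/-- The punctured neighbourhood. -/
def Ic (k : ℕ) {n : ℕ} (S : Set Y) (c : Fin n → SignType) : Set ((Fin n → ℝ) × (ℝ × Y)) :=
  {p | p ∈ Oc k S c ∧ p ∉ Zc Y c}

lemma Ic_sub (k : ℕ) {n : ℕ} (S : Set Y) (c : Fin n → SignType) : Ic k S c ⊆ Oc k S c :=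
  fun _ h => h.1

lemma rel_piece {k n : ℕ} (hk : 2 ≤ k) {S : Set Y} (hS : IsOpen S) (c : Fin n → SignType)
    (hc : zn c = k - 1) {q : Polynomial ℕ} (hq : HasPoly (SC.obj (sp (Bset k S c))) q) :
    HasPoly (RelC (Ic_sub k S c)) (Polynomial.X ^ (k - 1) * q) := by
  have hcard : Fintype.card {i // c i = 0} = k - 1 := by
    rw [Fintype.card_subtype]; exact hc
  let e : Fin (k - 1) ≃ {i // c i = 0} := (Fintype.equivFinOfCardEq hcard).symm
  have hB : IsOpen (Bset k S c) := (isOpen_Mk k _).prod ((isOpen_Mk k _).prod hS)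
  have h1 : QuasiIso (SC.map (mapSet (fc Y c e) (fc_maps (k := k) (S := S) c e))) :=
    mapSet_quasiIso _ _ (gc Y c e) (gc_maps hk c hc e) (Hc Y c e) (fun p _ => Hc_zero c e p)
      (fun p _ => Hc_one c e p) (fun τ h0 h1 p hp => Hc_maps hk c hc e τ h0 h1 p hp) (Kc Y c e)
      (fun p _ => Kc_zero c e p) (fun p _ => Kc_one c e p)
      (fun τ h0 h1 p hp => Kc_maps c e τ h0 h1 p hp)
  have hf' : Set.MapsTo (fc Y c e) (Ic k S c) (pcyl (Bset k S c) (k - 1)) := fun p hp =>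
    ⟨fc_maps c e hp.1, fun h => hp.2 ((fc_snd_zero c e p).1 h)⟩
  have h2 : QuasiIso (SC.map (mapSet (fc Y c e) hf')) := by
    refine mapSet_quasiIso _ _ (gc Y c e) ?_ (Hc Y c e) (fun p _ => Hc_zero c e p)
      (fun p _ => Hc_one c e p) ?_ (Kc Y c e)
      (fun p _ => Kc_zero c e p) (fun p _ => Kc_one c e p) ?_
    · intro q hq
      refine ⟨gc_maps hk c hc e hq.1, fun h => hq.2 ?_⟩
      rw [← fc_snd_zero c e, fc_gc_snd] at h
      exact h
    · intro τ h0 h1 p hp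
      refine ⟨Hc_maps hk c hc e τ h0 h1 p hp.1, fun h => hp.2 ?_⟩
      rw [← fc_snd_zero c e, fc_Hc] at h
      exact (fc_snd_zero c e p).1 h
    · intro τ h0 h1 p hp
      exact ⟨Kc_maps c e τ h0 h1 p hp.1, hp.2⟩
  have q3 := quasiIso_cok_map (ic (Ic_sub k S c)) (ic (pcyl_sub (Bset k S c) (k - 1))) _ _
    (mapSet_comm (Ic_sub k S c) (pcyl_sub (Bset k S c) (k - 1)) (fc Y c e) (fc_maps c e) hf') h2 h1
  exact (thom hB hq (k - 1)).of_quasiIso' _ q3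

end step

/-! ### Assembling the pieces -/

section assemble

variable {Y : Type} [TopologicalSpace Y]

/-- Removing a set of pieces. -/
def Wf (k n : ℕ) (S : Set Y) (P : Finset (Fin n → SignType)) : Set ((Fin n → ℝ) × (ℝ × Y)) :=
  {p | p ∈ Wst k n S ∧ ∀ c ∈ P, p ∉ Ac Y c}

lemma isOpen_Wf {k n : ℕ} {S : Set Y} (hS : IsOpen S) (P : Finset (Fin n → SignType)) :
    IsOpen (Wf k n S P) := by
  have : Wf k n S P = Wst k n S ∩ ⋂ c : {c // c ∈ P}, (Ac Y c.1)ᶜ := by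
    ext p; simp [Wf]
  rw [this]
  exact (isOpen_Wst hS).inter (isOpen_iInter_of_finite fun c => (isClosed_Ac _).isOpen_compl)

lemma epi_piece {k n : ℕ} (hk : 2 ≤ k) {S : Set Y} (c : Fin n → SignType) (hc : zn c = k - 1)
    (h : Wf k n S {c} ⊆ Wst k n S) (i : ℕ) : Epi (HomologicalComplex.homologyMap (ic h) i) := by
  let f : C((Fin n → ℝ) × (ℝ × Y), (Fin n → ℝ) × (ℝ × Y)) :=
    ⟨fun p => (p.1, (∑ j, |p.1 j| + 1, p.2.2)), by fun_prop⟩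
  let H : C(ℝ × ((Fin n → ℝ) × (ℝ × Y)), (Fin n → ℝ) × (ℝ × Y)) :=
    ⟨fun q => (q.2.1, (q.1 * q.2.2.1 + (1 - q.1) * (∑ j, |q.2.1 j| + 1), q.2.2.2)), by fun_prop⟩
  refine epi_of_section h f ?_ H ?_ ?_ ?_ i
  · intro p hp
    refine ⟨hp, ?_⟩
    intro c' hc' hA
    obtain rfl := Finset.mem_singleton.1 hc'
    have hne : (Finset.univ.filter fun i => c' i = 0).Nonempty := by
      refine Finset.card_pos.1 ?_
      change 0 < zn c'
      omega
    obtain ⟨j, hj⟩ := hne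
    have h1 : p.1 j = ∑ j, |p.1 j| + 1 := (hA j).1 (by simpa using hj)
    have h2 : |p.1 j| ≤ ∑ j, |p.1 j| :=
      Finset.single_le_sum (f := fun j => |p.1 j|) (fun j _ => abs_nonneg _) (Finset.mem_univ j)
    have h3 := le_abs_self (p.1 j)
    linarith
  · intro p _
    refine Prod.ext rfl (Prod.ext ?_ rfl)
    change 0 * p.2.1 + (1 - 0) * (∑ j, |p.1 j| + 1) = ∑ j, |p.1 j| + 1
    ring
  · intro p _
    refine Prod.ext rfl (Prod.ext ?_ rfl)
    change 1 * p.2.1 + (1 - 1) * (∑ j, |p.1 j| + 1) = p.2.1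
    ring
  · intro τ _ _ p hp
    exact hp

lemma Wf_poly {k n : ℕ} (hk : 2 ≤ k) {S : Set Y} (hS : IsOpen S) {p : Polynomial ℕ}
    (hp : HasPoly (SC.obj (sp (Wst k n S))) p) (r : (Fin n → SignType) → Polynomial ℕ)
    (P : Finset (Fin n → SignType)) (hP : ∀ c ∈ P, zn c = k - 1)
    (hr : ∀ c ∈ P, HasPoly (SC.obj (sp (Bset k S c))) (r c)) :
    HasPoly (SC.obj (sp (Wf k n S P))) (p + ∑ c ∈ P, Polynomial.X ^ (k - 2) * r c) := by
  induction P using Finset.induction_on with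
  | empty =>
    have : Wf k n S ∅ = Wst k n S := by ext p; simp [Wf]
    rw [Finset.sum_empty, add_zero, this]
    exact hp
  | insert c P hcP ih =>
    have ih' := ih (fun c' h => hP c' (Finset.mem_insert_of_mem h))
      (fun c' h => hr c' (Finset.mem_insert_of_mem h))
    have hc := hP c (Finset.mem_insert_self c P)
    rw [Finset.sum_insert hcP, add_comm (Polynomial.X ^ (k - 2) * r c), ← add_assoc]
    have hVW : Wf k n S {c} ⊆ Wst k n S := fun _ h => h.1
    refine step_poly (isOpen_Wf hS (insert c P)) (isOpen_Oc hS c) (isOpen_Wf hS {c})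
      (W' := Wf k n S P) (W := Wst k n S) (I := Ic k S c) ?_ ?_ ?_ ?_ ?_ hVW (Ic_sub k S c)
      (epi_piece hk c hc hVW) ih' ?_
    · ext x
      simp only [Set.mem_union]
      constructor
      · rintro (h | h)
        · exact ⟨h.1, fun c' hc' => h.2 c' (Finset.mem_insert_of_mem hc')⟩
        · refine ⟨h.1, fun c' hc' hA => hcP ?_⟩
          rw [Oc_disj hk hc (hP c' (Finset.mem_insert_of_mem hc')) h hA]
          exact hc'
      · intro h
        by_cases hA : x ∈ Ac Y c
        · exact Or.inr (Ac_sub_Oc hk hc h.1 hA)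
        · refine Or.inl ⟨h.1, fun c' hc' => ?_⟩
          rcases Finset.mem_insert.1 hc' with rfl | hc'
          · exact hA
          · exact h.2 c' hc'
    · ext x
      simp only [Set.mem_union]
      constructor
      · rintro (h | h)
        · exact h.1
        · exact h.1
      · intro h
        by_cases hA : x ∈ Ac Y c
        · exact Or.inr (Ac_sub_Oc hk hc h hA)
        · refine Or.inl ⟨h, fun c' hc' => ?_⟩
          rw [Finset.mem_singleton.1 hc']
          exact hA
    · ext x
      constructor
      · rintro ⟨h, h'⟩
        refine ⟨h', fun hz => h.2 c (Finset.mem_insert_self c P) ((Ac_iff_Zc h').2 hz)⟩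
      · rintro ⟨h, h'⟩
        refine ⟨⟨h.1, fun c' hc' hA => ?_⟩, h⟩
        obtain rfl := Oc_disj hk hc (hP c' hc') h hA
        exact h' ((Ac_iff_Zc h).1 hA)
    · ext x
      constructor
      · rintro ⟨h, h'⟩
        refine ⟨h', fun hz => h.2 c (Finset.mem_singleton_self c) ((Ac_iff_Zc h').2 hz)⟩
      · rintro ⟨h, h'⟩
        refine ⟨⟨h.1, fun c' hc' hA => ?_⟩, h⟩
        obtain rfl := Finset.mem_singleton.1 hc'
        exact h' ((Ac_iff_Zc h).1 hA)
    · intro x hx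
      refine ⟨hx.1, fun c' hc' => ?_⟩
      rw [Finset.mem_singleton.1 hc']
      exact hx.2 c (Finset.mem_insert_self c P)
    · rw [← mul_assoc, ← pow_succ', show k - 2 + 1 = k - 1 by omega]
      exact rel_piece hk hS c hc (hr c (Finset.mem_insert_self c P))

/-- Homeomorphisms of ambient spaces. -/
lemma mapSet_quasiIso_homeo {X Z : Type} [TopologicalSpace X] [TopologicalSpace Z] {S : Set X}
    {T : Set Z} (f : C(X, Z)) (g : C(Z, X)) (hf : Set.MapsTo f S T) (hg : Set.MapsTo g T S)
    (h1 : ∀ x, g (f x) = x) (h2 : ∀ x, f (g x) = x) : QuasiIso (SC.map (mapSet f hf)) :=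
  mapSet_quasiIso f hf g hg ⟨fun q => q.2, continuous_snd⟩ (fun x _ => (h1 x).symm)
    (fun _ _ => rfl) (fun _ _ _ _ h => h) ⟨fun q => q.2, continuous_snd⟩ (fun x _ => (h2 x).symm)
    (fun _ _ => rfl) (fun _ _ _ _ h => h)

lemma HasPoly.reindex {k : ℕ} {ι κ : Type} (e : ι ≃ κ) {S : Set Y}
    {q : Polynomial ℕ} (h : HasPoly (SC.obj (sp (Mk k ι ×ˢ S))) q) :
    HasPoly (SC.obj (sp (Mk k κ ×ˢ S))) q := by
  refine h.of_quasiIso (SC.map (mapSet (⟨fun p => (fun j => p.1 (e.symm j), p.2), by fun_prop⟩ :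
    C((ι → ℝ) × Y, (κ → ℝ) × Y)) ?_)) (mapSet_quasiIso_homeo _
      (⟨fun p => (fun j => p.1 (e j), p.2), by fun_prop⟩ : C((κ → ℝ) × Y, (ι → ℝ) × Y)) _ ?_ ?_ ?_)
  · intro p hp
    exact ⟨Mk_of_inj hp.1 _ e.symm.toEmbedding fun _ _ h => h, hp.2⟩
  · intro p hp
    exact ⟨Mk_of_inj hp.1 _ e.toEmbedding fun _ _ h => h, hp.2⟩
  · intro p; simp
  · intro p; simp

lemma Wst_poly {k n : ℕ} {S : Set Y} {q : Polynomial ℕ}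
    (h : HasPoly (SC.obj (sp (Mk k (Fin n) ×ˢ S))) q) : HasPoly (SC.obj (sp (Wst k n S))) q := by
  have hm : Set.MapsTo (⟨fun p => (p.1, p.2.2), by fun_prop⟩ :
    C((Fin n → ℝ) × (ℝ × Y), (Fin n → ℝ) × Y)) (Wst k n S) (Mk k (Fin n) ×ˢ S) := fun p hp => hp
  refine h.of_quasiIso' (SC.map (mapSet _ hm)) ?_
  refine mapSet_quasiIso _ _ ⟨fun p => (p.1, (0, p.2)), by fun_prop⟩ (fun p hp => hp)
    ⟨fun q => (q.2.1, (q.1 * q.2.2.1, q.2.2.2)), by fun_prop⟩ ?_ ?_ (fun _ _ _ _ h => h)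
    ⟨fun q => q.2, continuous_snd⟩ (fun _ _ => rfl) (fun _ _ => rfl) (fun _ _ _ _ h => h)
  · intro p _; simp
  · intro p _; simp

lemma Wf_all {k n : ℕ} (hk : 1 ≤ k) {S : Set Y} (p : (Fin n → ℝ) × (ℝ × Y)) :
    p ∈ Wf k n S (Finset.univ.filter fun c => zn c = k - 1) ↔
      (Fin.cons p.2.1 p.1 : Fin (n + 1) → ℝ) ∈ Mk k (Fin (n + 1)) ∧ p.2.2 ∈ S := by
  rw [Mk_cons hk]
  constructor
  · rintro ⟨h1, h2⟩
    refine ⟨⟨h1.1, fun hcard => ?_⟩, h1.2⟩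
    have hsz : ∀ i, SignType.sign (p.1 i - p.2.1) = 0 ↔ p.1 i = p.2.1 := fun i => by
      rw [sign_eq_zero_iff, sub_eq_zero]
    refine h2 (fun i => SignType.sign (p.1 i - p.2.1)) ?_ ?_
    · refine Finset.mem_filter.2 ⟨Finset.mem_univ _, ?_⟩
      rw [← hcard]
      exact congrArg Finset.card (Finset.filter_congr fun i _ => hsz i)
    · intro i
      refine ⟨(hsz i).1, fun h => ?_, fun h => ?_⟩
      · have := sign_eq_neg_one_iff.1 h; linarith
      · have := sign_eq_one_iff.1 h; linarith
  · rintro ⟨⟨h1, h2⟩, h3⟩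
    refine ⟨⟨h1, h3⟩, fun c hc hA => h2 ?_⟩
    have hc' : zn c = k - 1 := by simpa using hc
    have h4 := (Mk_iff hk _).1 h1 p.2.1
    have h5 : (Finset.univ.filter fun i => c i = 0) ⊆ Finset.univ.filter fun i => p.1 i = p.2.1 := by
      intro i hi
      simp only [Finset.mem_filter, Finset.mem_univ, true_and] at hi ⊢
      exact (hA i).1 hi
    have := Finset.card_le_card h5
    change zn c ≤ _ at this
    omega

lemma key_step {k n : ℕ} (hk : 1 ≤ k) {S : Set Y} {q : Polynomial ℕ}
    (h : HasPoly (SC.obj (sp (Wf k n S (Finset.univ.filter fun c => zn c = k - 1)))) q) :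
    HasPoly (SC.obj (sp (Mk k (Fin (n + 1)) ×ˢ S))) q := by
  have hc1 : Continuous (fun p : (Fin n → ℝ) × (ℝ × Y) => (Fin.cons p.2.1 p.1 : Fin (n + 1) → ℝ)) := by
    refine continuous_pi fun i => ?_
    refine Fin.cases ?_ (fun i => ?_) i
    · simp only [Fin.cons_zero]; fun_prop
    · simp only [Fin.cons_succ]; fun_prop
  refine h.of_quasiIso (SC.map (mapSet (⟨fun p => ((Fin.cons p.2.1 p.1 : Fin (n + 1) → ℝ), p.2.2),
    hc1.prodMk (by fun_prop)⟩ : C((Fin n → ℝ) × (ℝ × Y), (Fin (n + 1) → ℝ) × Y)) ?_))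
      (mapSet_quasiIso_homeo _
      (⟨fun p => (fun j => p.1 j.succ, (p.1 0, p.2)), by fun_prop⟩ :
        C((Fin (n + 1) → ℝ) × Y, (Fin n → ℝ) × (ℝ × Y))) _ ?_ ?_ ?_)
  · intro p hp
    exact (Wf_all hk p).1 hp
  · intro p hp
    refine (Wf_all hk _).2 ⟨?_, hp.2⟩
    have : (Fin.cons (p.1 0) (fun j => p.1 j.succ) : Fin (n + 1) → ℝ) = p.1 := Fin.cons_self_tail p.1
    change (Fin.cons (p.1 0) (fun j => p.1 j.succ) : Fin (n + 1) → ℝ) ∈ _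
    rw [this]
    exact hp.1
  · intro p
    rfl
  · intro p
    exact Prod.ext (Fin.cons_self_tail p.1) rfl

end assemble

lemma Mk_poly {k : ℕ} (hk : 2 ≤ k) (n : ℕ) : ∀ (Y : Type) [TopologicalSpace Y] (S : Set Y)
    (_ : IsOpen S) (q : Polynomial ℕ) (_ : HasPoly (SC.obj (sp S)) q),
    HasPoly (SC.obj (sp (Mk k (Fin n) ×ˢ S))) (Rp (Polynomial.X ^ (k - 2)) k n * q) := by
  induction n using Nat.strong_induction_on with
  | _ n ih =>
    intro Y _ S hS q hq
    cases n with
    | zero =>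
      rw [Rp_zero, one_mul]
      refine hq.of_quasiIso (SC.map (mapSet (⟨fun p => (0, p), by fun_prop⟩ :
        C(Y, (Fin 0 → ℝ) × Y)) ?_)) (mapSet_quasiIso_homeo _
        (⟨fun p => p.2, by fun_prop⟩ : C((Fin 0 → ℝ) × Y, Y)) _ (fun p hp => hp.2) (fun p => rfl)
          (fun p => Prod.ext (Subsingleton.elim _ _) rfl))
      intro p hp
      refine ⟨?_, hp⟩
      intro T hT
      have : T = ∅ := Subsingleton.elim _ _
      rw [this, Finset.card_empty] at hT
      omega
    | succ n =>
      refine key_step (by omega) ?_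
      have hsub : ∀ (c : Fin n → SignType) (s : SignType),
          (Finset.univ.filter fun i => c i = s).card < n + 1 := fun c s =>
        Nat.lt_succ_of_le ((Finset.card_le_univ _).trans (by simp))
      have hM : ∀ (m : ℕ) (_ : m < n + 1) (ι : Type) [Fintype ι] (_ : Fintype.card ι = m)
          (Z : Type) [TopologicalSpace Z] (T : Set Z) (_ : IsOpen T) (q' : Polynomial ℕ)
          (_ : HasPoly (SC.obj (sp T)) q'),
          HasPoly (SC.obj (sp (Mk k ι ×ˢ T))) (Rp (Polynomial.X ^ (k - 2)) k m * q') := by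
        intro m hm ι _ hι Z _ T hT q' hq'
        exact (ih m hm Z T hT q' hq').reindex (Fintype.equivFinOfCardEq hι).symm
      have h := Wf_poly hk hS (Wst_poly (ih n (by omega) Y S hS q hq))
        (fun c => Rp (Polynomial.X ^ (k - 2)) k (Finset.univ.filter fun i => c i = -1).card *
          (Rp (Polynomial.X ^ (k - 2)) k (Finset.univ.filter fun i => c i = 1).card * q))
        (Finset.univ.filter fun c => zn c = k - 1) (fun c hc => by simpa using hc) (by
          intro c _
          refine hM _ (hsub c _) (Lt c) (Fintype.card_subtype _) _ _ ((isOpen_Mk k _).prod hS) _ ?_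
          exact hM _ (hsub c _) (Rt c) (Fintype.card_subtype _) _ _ hS _ hq)
      convert h using 1
      rw [Rp_succ, add_mul, Finset.mul_sum, Finset.sum_mul]
      congr 1
      refine Finset.sum_congr rfl fun c _ => ?_
      ring

lemma kEqual_poly {k : ℕ} (hk : 2 ≤ k) (n : ℕ) :
    HasPoly (SC.obj (TopCat.of (kEqualComplement n k))) (Rp (Polynomial.X ^ (k - 2)) k (n + 1)) := by
  have : Unique (sp (Set.univ : Set Unit)) := ⟨⟨⟨(), trivial⟩⟩, fun a => Subsingleton.elim _ _⟩
  have h := Mk_poly hk (n + 1) Unit Set.univ isOpen_univ 1 (HasPoly.point _)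
  rw [mul_one] at h
  refine h.of_quasiIso (SC.map (mapSet (T := kEqualComplement n k) (⟨fun p => p.1, by fun_prop⟩ :
    C((Fin (n + 1) → ℝ) × Unit, (Fin (n + 1) → ℝ))) (fun p hp => hp.1)))
    (mapSet_quasiIso_homeo _ (⟨fun p => (p, ()), by fun_prop⟩ :
      C(Fin (n + 1) → ℝ, (Fin (n + 1) → ℝ) × Unit)) _ (fun p hp => ⟨hp, trivial⟩) (fun p => rfl)
      (fun p => rfl))

lemma kEqual_homology {k : ℕ} (hk : 3 ≤ k) (n t : ℕ) :
    Nonempty ((singularHomology (TopCat.of (kEqualComplement n k)) (t * (k - 2))) ≃ₗ[ℤ]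
      (Fin ((Rp (Polynomial.X : Polynomial ℕ) k (n + 1)).coeff t) → ℤ)) := by
  obtain ⟨e⟩ := kEqual_poly (by omega : 2 ≤ k) n (t * (k - 2))
  have : (Rp (Polynomial.X ^ (k - 2)) k (n + 1)).coeff (t * (k - 2)) =
      (Rp (Polynomial.X : Polynomial ℕ) k (n + 1)).coeff t := by
    have h := Rp_map (Polynomial.expand ℕ (k - 2)).toRingHom (Polynomial.X : Polynomial ℕ) k (n + 1)
    have h' : (Polynomial.expand ℕ (k - 2)).toRingHom (Polynomial.X : Polynomial ℕ) =
      Polynomial.X ^ (k - 2) := Polynomial.expand_X _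
    rw [h'] at h
    rw [← h]
    exact Polynomial.coeff_expand_mul (by omega) _ _
  rw [this] at e
  refine ⟨AddEquiv.toLinearEquiv e fun m x => ?_⟩
  refine Eq.trans ?_ (map_zsmul e.toAddMonoidHom m x)
  exact congrArg e (int_smul_eq_zsmul _ m x)

/-! ### Combinatorics: lists of items -/

section items

/-- Decreasing lists. -/
abbrev Decr (X : List ℕ) : Prop := X.Pairwise (fun a b => b < a)

/-- Items: decreasing lists of length `1` or `k`. -/
def Item (k : ℕ) (X : List ℕ) : Prop := (X.length = 1 ∨ X.length = k) ∧ Decr X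

/-- Consecutive items. -/
def IRel (k : ℕ) (X Y : List ℕ) : Prop := X.length = k ∨ ∀ x ∈ X, ∀ y ∈ Y.head?, x < y

/-- Good lists of items with labels `I`. -/
structure Good (k : ℕ) (I : Finset ℕ) (l : List (List ℕ)) : Prop where
  item : ∀ X ∈ l, Item k X
  chain : l.IsChain (IRel k)
  nodup : l.flatten.Nodup
  mem : ∀ x, x ∈ l.flatten ↔ x ∈ I

/-- Number of blocks. -/
def bl (k : ℕ) (l : List (List ℕ)) : ℕ := l.countP (fun X => decide (X.length = k))

lemma bl_append (k : ℕ) (A B : List (List ℕ)) : bl k (A ++ B) = bl k A + bl k B :=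
  List.countP_append

lemma bl_cons_block (k : ℕ) (X : List ℕ) (hX : X.length = k) (B : List (List ℕ)) :
    bl k (X :: B) = bl k B + 1 := by
  simp [bl, List.countP_cons, hX]

lemma bl_cons_single (k : ℕ) (X : List ℕ) (hX : X.length ≠ k) (B : List (List ℕ)) :
    bl k (X :: B) = bl k B := by
  simp [bl, List.countP_cons, hX]

variable {k : ℕ}

lemma Good.split {I L R : Finset ℕ} {A B : List (List ℕ)} {X : List ℕ}
    (h : Good k I (A ++ X :: B)) (hL : ∀ x, x ∈ A.flatten ↔ x ∈ L)
    (hR : ∀ x, x ∈ B.flatten ↔ x ∈ R) : Good k L A ∧ Good k R B := by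
  have hn := h.nodup
  rw [List.flatten_append, List.flatten_cons, List.nodup_append, List.nodup_append] at hn
  have hc := h.chain
  rw [List.isChain_append, List.isChain_cons] at hc
  exact ⟨⟨fun X hX => h.item X (by simp [hX]), hc.1, hn.1, hL⟩,
    ⟨fun X hX => h.item X (by simp [hX]), hc.2.1.2, hn.2.1.2.1, hR⟩⟩

lemma Good.ne_nil {I : Finset ℕ} {l : List (List ℕ)} (hk : 1 ≤ k) (h : Good k I l) :
    ∀ X ∈ l, X ≠ [] := by
  intro X hX h0
  have := (h.item X hX).1
  rw [h0, List.length_nil] at this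
  omega

/-- Chains through an item headed by a large element. -/
lemma chain_mid {L : Finset ℕ} {A B : List (List ℕ)} {m : ℕ} {D : List ℕ} (hA : Good k L A)
    (hL : ∀ x ∈ L, x < m) (hB : B.IsChain (IRel k)) (hX : ∀ Y ∈ B.head?, IRel k (m :: D) Y) :
    (A ++ (m :: D) :: B).IsChain (IRel k) := by
  rw [List.isChain_append, List.isChain_cons]
  refine ⟨hA.chain, ⟨hX, hB⟩, ?_⟩
  intro X hXA Y hY
  simp only [List.head?_cons, Option.mem_def, Option.some.injEq] at hY
  subst hY
  refine Or.inr fun x hx y hy => ?_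
  simp only [List.head?_cons, Option.mem_def, Option.some.injEq] at hy
  subst hy
  refine hL x ((hA.mem x).1 (List.mem_flatten.2 ⟨X, List.mem_of_getLast? hXA, hx⟩))

lemma good_snoc {L : Finset ℕ} {A : List (List ℕ)} {m : ℕ} (hA : Good k L A)
    (hL : ∀ x ∈ L, x < m) : Good k (insert m L) (A ++ [[m]]) := by
  refine ⟨?_, chain_mid hA hL List.isChain_nil (by simp), ?_, ?_⟩
  · intro X hX
    rcases List.mem_append.1 hX with h | h
    · exact hA.item X h
    · obtain rfl := List.mem_singleton.1 h
      exact ⟨Or.inl rfl, by simp⟩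
  · rw [List.flatten_append, List.nodup_append]
    refine ⟨hA.nodup, by simp, ?_⟩
    intro a ha b hb
    simp only [List.flatten_cons, List.flatten_nil, List.append_nil, List.mem_singleton] at hb
    subst hb
    exact (hL a ((hA.mem a).1 ha)).ne
  · intro x
    rw [List.flatten_append, List.mem_append, hA.mem]
    simp [or_comm]

lemma good_mid {L Z R : Finset ℕ} {A B : List (List ℕ)} {m : ℕ} {D : List ℕ} (hk : 1 ≤ k)
    (hA : Good k L A) (hB : Good k R B) (hD : Decr D) (hlen : D.length = k - 1)
    (hDZ : ∀ x, x ∈ D ↔ x ∈ Z) (hL : ∀ x ∈ L, x < m) (hZ : ∀ x ∈ Z, x < m) (hR : ∀ x ∈ R, x < m)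
    (hLZ : Disjoint L Z) (hLR : Disjoint L R) (hZR : Disjoint Z R) :
    Good k (insert m (L ∪ Z ∪ R)) (A ++ (m :: D) :: B) := by
  have hlen' : (m :: D).length = k := by rw [List.length_cons, hlen]; omega
  have hdec : Decr (m :: D) := by
    refine List.pairwise_cons.2 ⟨fun x hx => hZ x ((hDZ x).1 hx), hD⟩
  refine ⟨?_, chain_mid hA hL hB.chain (fun Y _ => Or.inl hlen'), ?_, ?_⟩
  · intro X hX
    rcases List.mem_append.1 hX with h | h
    · exact hA.item X h
    · rcases List.mem_cons.1 h with rfl | h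
      · exact ⟨Or.inr hlen', hdec⟩
      · exact hB.item X h
  · rw [List.flatten_append, List.flatten_cons, List.nodup_append, List.nodup_append]
    refine ⟨hA.nodup, ⟨hdec.imp (fun h => h.ne'), hB.nodup, ?_⟩, ?_⟩
    · rintro a ha b hb rfl
      rw [hB.mem] at hb
      rcases List.mem_cons.1 ha with rfl | ha
      · exact (hR a hb).ne rfl
      · exact Finset.disjoint_left.1 hZR ((hDZ a).1 ha) hb
    · rintro a ha b hb rfl
      rw [hA.mem] at ha
      rcases List.mem_append.1 hb with hb | hb
      · rcases List.mem_cons.1 hb with rfl | hb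
        · exact (hL a ha).ne rfl
        · exact Finset.disjoint_left.1 hLZ ha ((hDZ a).1 hb)
      · exact Finset.disjoint_left.1 hLR ha ((hB.mem a).1 hb)
  · intro x
    rw [List.flatten_append, List.flatten_cons, List.mem_append, List.mem_append, List.mem_cons,
      hA.mem, hB.mem, hDZ]
    simp only [Finset.mem_insert, Finset.mem_union]
    tauto

lemma good_cases {I : Finset ℕ} {l : List (List ℕ)} {m : ℕ} (hk : 2 ≤ k) (h : Good k I l)
    (hm : m ∈ I) (hI : ∀ x ∈ I, x ≤ m) :
    (∃ A, l = A ++ [[m]]) ∨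
    ∃ A D B, l = A ++ (m :: D) :: B ∧ D.length = k - 1 ∧ Decr D := by
  obtain ⟨X, hX, hmX⟩ := List.mem_flatten.1 ((h.mem m).2 hm)
  obtain ⟨A, B, rfl⟩ := List.append_of_mem hX
  have hit := h.item X hX
  rcases hit.1 with h1 | h1
  · left
    obtain ⟨x, rfl⟩ := List.length_eq_one_iff.1 h1
    obtain rfl := List.mem_singleton.1 hmX
    refine ⟨A, ?_⟩
    cases B with
    | nil => rfl
    | cons Y B =>
      exfalso
      have hc := h.chain
      rw [List.isChain_append, List.isChain_cons] at hc
      have hr := hc.2.1.1 Y (by simp)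
      have hYm : Y ∈ A ++ [m] :: Y :: B := by simp
      rcases hr with hr | hr
      · simp at hr; omega
      · cases Y with
        | nil => exact h.ne_nil (by omega) [] hYm rfl
        | cons y Y =>
          have h2 := hr m (by simp) y (by simp)
          have h3 := hI y ((h.mem y).1 (List.mem_flatten.2 ⟨_, hYm, by simp⟩))
          omega
  · right
    cases X with
    | nil => simp at hmX
    | cons x D =>
      have hx := hI x ((h.mem x).1 (List.mem_flatten.2 ⟨_, hX, by simp⟩))
      have hd := List.pairwise_cons.1 hit.2
      have : x = m := by
        rcases List.mem_cons.1 hmX with h | h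
        · exact h.symm
        · have := hd.1 m h; omega
      subst this
      refine ⟨A, D, B, rfl, ?_, hd.2⟩
      rw [List.length_cons] at h1
      omega

lemma split_unique {α : Type} {m : α} : ∀ {A A' B B' : List (List α)} {X X' : List α}
    (_ : A ++ X :: B = A' ++ X' :: B') (_ : m ∈ X) (_ : m ∈ X') (_ : m ∉ A.flatten)
    (_ : m ∉ A'.flatten), A = A' ∧ X = X' ∧ B = B'
  | [], [], B, B', X, X', h, _, _, _, _ => by
    simpa using h
  | [], Y :: A', B, B', X, X', h, hX, hX', hA, hA' => by
    simp only [List.nil_append, List.cons_append, List.cons.injEq] at h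
    exact absurd (by simp [← h.1, hX]) hA'
  | Y :: A, [], B, B', X, X', h, hX, hX', hA, hA' => by
    simp only [List.nil_append, List.cons_append, List.cons.injEq] at h
    exact absurd (by simp [h.1, hX']) hA
  | Y :: A, Y' :: A', B, B', X, X', h, hX, hX', hA, hA' => by
    simp only [List.cons_append, List.cons.injEq] at h
    rw [List.flatten_cons, List.mem_append, not_or] at hA hA'
    obtain ⟨h1, h2, h3⟩ := split_unique h.2 hX hX' hA.2 hA'.2
    exact ⟨by rw [h.1, h1], h2, h3⟩

lemma decr_unique {D D' : List ℕ} (hD : Decr D) (hD' : Decr D') (h : ∀ x, x ∈ D ↔ x ∈ D') :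
    D = D' := by
  refine List.Perm.eq_of_pairwise (le := fun a b => b < a) ?_ hD hD' ?_
  · intro a b _ _ h1 h2; omega
  · exact (List.perm_ext_iff_of_nodup (hD.imp fun h => h.ne') (hD'.imp fun h => h.ne')).2 h

/-- Fibres of a sign function. -/
def fib {J : Finset ℕ} (c : J → SignType) (s : SignType) : Finset ℕ :=
  (Finset.univ.filter fun i => c i = s).map (Function.Embedding.subtype _)

lemma mem_fib {J : Finset ℕ} (c : J → SignType) (s : SignType) (x : ℕ) :
    x ∈ fib c s ↔ ∃ h : x ∈ J, c ⟨x, h⟩ = s := by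
  simp [fib]

lemma fib_card {J : Finset ℕ} (c : J → SignType) (s : SignType) :
    (fib c s).card = (Finset.univ.filter fun i => c i = s).card := Finset.card_map _

lemma fib_disj {J : Finset ℕ} (c : J → SignType) {s s' : SignType} (h : s ≠ s') :
    Disjoint (fib c s) (fib c s') := by
  rw [Finset.disjoint_left]
  intro x hx hx'
  obtain ⟨h1, h2⟩ := (mem_fib _ _ _).1 hx
  obtain ⟨_, h3⟩ := (mem_fib _ _ _).1 hx'
  exact h (h2.symm.trans h3)

lemma fib_union {J : Finset ℕ} (c : J → SignType) :
    fib c (-1) ∪ fib c 0 ∪ fib c 1 = J := by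
  ext x
  simp only [Finset.mem_union, mem_fib]
  constructor
  · rintro ((⟨h, _⟩ | ⟨h, _⟩) | ⟨h, _⟩) <;> exact h
  · intro h
    rcases sign_cases (c ⟨x, h⟩) with h' | h' | h'
    · exact Or.inl (Or.inr ⟨h, h'⟩)
    · exact Or.inl (Or.inl ⟨h, h'⟩)
    · exact Or.inr ⟨h, h'⟩

lemma Rp_succ_finset {R : Type} [CommSemiring R] (x : R) (k n : ℕ) (J : Finset ℕ)
    (hJ : J.card = n) : Rp x k (n + 1) =
    Rp x k n + x * ∑ c ∈ (Finset.univ : Finset (J → SignType)).filter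
      (fun c => (fib c 0).card = k - 1),
      Rp x k (fib c (-1)).card * Rp x k (fib c 1).card := by
  rw [Rp_succ]
  congr 2
  have e : J ≃ Fin n := Fintype.equivFinOfCardEq (by simpa using hJ)
  have hcard : ∀ (c : Fin n → SignType) (s : SignType),
      (fib (fun j => c (e j)) s).card = (Finset.univ.filter fun i => c i = s).card := by
    intro c s
    rw [fib_card]
    refine Finset.card_equiv e fun i => ?_
    simp
  refine Finset.sum_equiv (Equiv.arrowCongr e.symm (Equiv.refl _)) ?_ ?_
  · intro c
    have : (Equiv.arrowCongr e.symm (Equiv.refl _)) c = fun j => c (e j) := rfl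
    rw [this]
    simp only [Finset.mem_filter, Finset.mem_univ, true_and, hcard]
  · intro c _
    have : (Equiv.arrowCongr e.symm (Equiv.refl _)) c = fun j => c (e j) := rfl
    rw [this, hcard, hcard]

/-- The generating function of good lists. -/
lemma good_gen (hk : 2 ≤ k) (n : ℕ) : ∀ I : Finset ℕ, I.card = n →
    ∃ G : Finset (List (List ℕ)), (∀ l, l ∈ G ↔ Good k I l) ∧
      ∑ l ∈ G, (Polynomial.X : Polynomial ℕ) ^ bl k l = Rp Polynomial.X k n := by
  classical
  induction n using Nat.strong_induction_on with
  | _ n ih =>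
    intro I hI
    cases n with
    | zero =>
      obtain rfl := Finset.card_eq_zero.1 hI
      refine ⟨{[]}, fun l => ?_, by simp [Rp_zero, bl]⟩
      rw [Finset.mem_singleton]
      constructor
      · rintro rfl
        exact ⟨by simp, List.isChain_nil, by simp, by simp⟩
      · intro h
        cases l with
        | nil => rfl
        | cons X l =>
          exfalso
          cases X with
          | nil => exact h.ne_nil (by omega) [] (by simp) rfl
          | cons x X => simpa using (h.mem x).1 (by simp)
    | succ n =>
      have hne : I.Nonempty := Finset.card_pos.1 (by omega)
      obtain ⟨m, hm, hmax⟩ : ∃ m ∈ I, ∀ x ∈ I, x ≤ m :=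
        ⟨I.max' hne, I.max'_mem hne, fun x hx => I.le_max' x hx⟩
      set J := I.erase m with hJ
      have hJc : J.card = n := by rw [hJ, Finset.card_erase_of_mem hm, hI]; rfl
      have hJm : ∀ x ∈ J, x < m := fun x hx =>
        lt_of_le_of_ne (hmax x (Finset.mem_of_mem_erase hx)) (Finset.ne_of_mem_erase hx)
      have hIJ : insert m J = I := Finset.insert_erase hm
      have H : ∀ K : Finset ℕ, ∃ G : Finset (List (List ℕ)), K.card < n + 1 →
        (∀ l, l ∈ G ↔ Good k K l) ∧
        ∑ l ∈ G, (Polynomial.X : Polynomial ℕ) ^ bl k l = Rp Polynomial.X k K.card := by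
        intro K
        by_cases hK : K.card < n + 1
        · obtain ⟨G, hG⟩ := ih K.card hK K rfl
          exact ⟨G, fun _ => hG⟩
        · exact ⟨∅, fun h => absurd h hK⟩
      choose G hG using H
      have hfibJ : ∀ (c : J → SignType) (s : SignType), fib c s ⊆ J := fun c s x hx =>
        ((mem_fib _ _ _).1 hx).1
      have hfc : ∀ (c : J → SignType) (s : SignType), (fib c s).card < n + 1 := fun c s =>
        lt_of_le_of_lt (Finset.card_le_card (hfibJ c s)) (by omega)
      have hfm : ∀ (c : J → SignType) (s : SignType), ∀ x ∈ fib c s, x < m := fun c s x hx =>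
        hJm x (hfibJ c s hx)
      let P : Finset (J → SignType) := Finset.univ.filter fun c => (fib c 0).card = k - 1
      let F : (J → SignType) → (List (List ℕ) × List (List ℕ)) → List (List ℕ) :=
        fun c p => p.1 ++ (m :: (fib c 0).sort (· ≥ ·)) :: p.2
      let G1 : Finset (List (List ℕ)) := (G J).image (fun A => A ++ [[m]])
      let G2 : (J → SignType) → Finset (List (List ℕ)) := fun c =>
        (G (fib c (-1)) ×ˢ G (fib c 1)).image (F c)
      have hsort : ∀ c : J → SignType, Decr ((fib c 0).sort (· ≥ ·)) := fun c =>
        (Finset.sortedGT_sort (fib c 0)).pairwise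
      have hGJ := hG J (by omega)
      have hnotin : ∀ (K : Finset ℕ), (∀ x ∈ K, x < m) → ∀ A, Good k K A → m ∉ A.flatten := by
        intro K hK A hA h
        exact lt_irrefl _ (hK m ((hA.mem m).1 h))
      have hF : ∀ c ∈ P, ∀ p ∈ G (fib c (-1)) ×ˢ G (fib c 1), 
          Good k (fib c (-1)) p.1 ∧ Good k (fib c 1) p.2 ∧ Good k I (F c p) := by
        intro c hc p hp
        rw [Finset.mem_product] at hp
        have h1 := ((hG (fib c (-1)) (hfc c _)).1 _).1 hp.1
        have h2 := ((hG (fib c 1) (hfc c _)).1 _).1 hp.2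
        refine ⟨h1, h2, ?_⟩
        have := good_mid (Z := fib c 0) (by omega) h1 h2 (hsort c)
          (by rw [Finset.length_sort]; exact (Finset.mem_filter.1 hc).2)
          (fun x => Finset.mem_sort _) (hfm c _) (hfm c _) (hfm c _)
          (fib_disj c (by decide)) (fib_disj c (by decide)) (fib_disj c (by decide))
        rw [fib_union, hIJ] at this
        exact this
      have hFinj : ∀ c ∈ P, ∀ c' ∈ P, ∀ p ∈ G (fib c (-1)) ×ˢ G (fib c 1),
          ∀ p' ∈ G (fib c' (-1)) ×ˢ G (fib c' 1), F c p = F c' p' → c = c' ∧ p = p' := by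
        intro c hc c' hc' p hp p' hp' he
        obtain ⟨h1, h2, _⟩ := hF c hc p hp
        obtain ⟨h1', h2', _⟩ := hF c' hc' p' hp'
        obtain ⟨e1, e2, e3⟩ := split_unique (m := m) he (by simp) (by simp)
          (hnotin _ (hfm c _) _ h1) (hnotin _ (hfm c' _) _ h1')
        refine ⟨?_, Prod.ext e1 e3⟩
        have hx : ∀ (x : ℕ), (x ∈ fib c (-1) ↔ x ∈ fib c' (-1)) ∧ (x ∈ fib c 1 ↔ x ∈ fib c' 1) := by
          intro x
          rw [← h1.mem, ← h1'.mem, ← h2.mem, ← h2'.mem, e1, e3]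
          exact ⟨Iff.rfl, Iff.rfl⟩
        funext j
        have h3 := (hx j).1
        have h4 := (hx j).2
        simp only [mem_fib, Subtype.coe_eta, Finset.coe_mem, exists_true_left] at h3 h4
        rcases sign_cases (c j) with h | h | h
        · rcases sign_cases (c' j) with h' | h' | h'
          · rw [h, h']
          · rw [h3.2 h'] at h; exact absurd h (by decide)
          · rw [h4.2 h'] at h; exact absurd h (by decide)
        · rw [h, h3.1 h]
        · rw [h, h4.1 h]
      have hG12 : ∀ l ∈ G1, ∀ c ∈ P, l ∉ G2 c := by
        intro l hl c hc hl'
        obtain ⟨A, hA, rfl⟩ := Finset.mem_image.1 hl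
        obtain ⟨p, hp, he⟩ := Finset.mem_image.1 hl'
        obtain ⟨h1, h2, _⟩ := hF c hc p hp
        obtain ⟨_, e2, _⟩ := split_unique (m := m) he (by simp) (by simp)
          (hnotin _ (hfm c _) _ h1) (hnotin _ hJm _ ((hGJ.1 A).1 hA))
        have := congrArg List.length e2
        rw [List.length_cons, Finset.length_sort, (Finset.mem_filter.1 hc).2] at this
        simp at this
        omega
      refine ⟨G1 ∪ P.biUnion G2, ?_, ?_⟩
      · intro l
        rw [Finset.mem_union, Finset.mem_biUnion]
        constructor
        · rintro (h | ⟨c, hc, h⟩)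
          · obtain ⟨A, hA, rfl⟩ := Finset.mem_image.1 h
            rw [← hIJ]
            exact good_snoc ((hGJ.1 A).1 hA) hJm
          · obtain ⟨p, hp, rfl⟩ := Finset.mem_image.1 h
            exact (hF c hc p hp).2.2
        · intro h
          rcases good_cases hk h hm hmax with ⟨A, rfl⟩ | ⟨A, D, B, rfl, hD, hDd⟩
          · left
            refine Finset.mem_image.2 ⟨A, (hGJ.1 A).2 ?_, rfl⟩
            refine (h.split (R := ∅) ?_ (by simp)).1
            intro x
            have h1 := h.mem x
            have h2 := h.nodup
            rw [List.flatten_append, List.nodup_append] at h2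
            rw [List.flatten_append, List.mem_append] at h1
            simp only [List.flatten_cons, List.flatten_nil, List.append_nil,
              List.mem_singleton] at h1 h2
            rw [hJ, Finset.mem_erase, ← h1]
            constructor
            · intro hx
              exact ⟨h2.2.2 x hx m rfl, Or.inl hx⟩
            · rintro ⟨h3, h4⟩
              exact h4.resolve_right h3
          · right
            have h2 := h.nodup
            have h1 := h.mem
            simp only [List.flatten_append, List.flatten_cons, List.nodup_append,
              List.nodup_cons, List.mem_append, List.mem_cons] at h1 h2
            obtain ⟨-, ⟨⟨h3, -⟩, -, h4⟩, h5⟩ := h2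
            have hmA : m ∉ A.flatten := fun hA => h5 m hA m (Or.inl (Or.inl rfl)) rfl
            have hmB : m ∉ B.flatten := fun hB => h4 m (Or.inl rfl) m hB rfl
            have hAB : ∀ x ∈ A.flatten, x ∉ B.flatten := fun x hA hB => h5 x hA x (Or.inr hB) rfl
            have hAD : ∀ x ∈ A.flatten, x ∉ D := fun x hA hB =>
              h5 x hA x (Or.inl (Or.inr hB)) rfl
            have hDB : ∀ x ∈ D, x ∉ B.flatten := fun x hA hB => h4 x (Or.inr hA) x hB rfl
            have hJi : ∀ x, x ∈ J ↔ x ∈ A.flatten ∨ x ∈ D ∨ x ∈ B.flatten := by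
              intro x
              rw [hJ, Finset.mem_erase, ← h1]
              constructor
              · rintro ⟨h, h'⟩; tauto
              · intro h
                refine ⟨?_, by tauto⟩
                rintro rfl
                tauto
            let c : J → SignType := fun j => if j.1 ∈ A.flatten then -1 else
              if j.1 ∈ B.flatten then 1 else 0
            have hcA : ∀ x, x ∈ A.flatten ↔ x ∈ fib c (-1) := by
              intro x
              rw [mem_fib]
              constructor
              · intro hx
                exact ⟨(hJi x).2 (Or.inl hx), if_pos hx⟩
              · rintro ⟨hx, hc⟩
                by_contra hxA
                simp only [c, if_neg hxA] at hc
                split_ifs at hc <;> exact absurd hc (by decide)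
            have hcB : ∀ x, x ∈ B.flatten ↔ x ∈ fib c 1 := by
              intro x
              rw [mem_fib]
              constructor
              · intro hx
                refine ⟨(hJi x).2 (Or.inr (Or.inr hx)), ?_⟩
                have : x ∉ A.flatten := fun h => hAB x h hx
                simp only [c, if_neg this, if_pos hx]
              · rintro ⟨hx, hc⟩
                by_contra hxB
                simp only [c, if_neg hxB] at hc
                split_ifs at hc <;> exact absurd hc (by decide)
            have hcD : ∀ x, x ∈ D ↔ x ∈ fib c 0 := by
              intro x
              rw [mem_fib]
              constructor
              · intro hx
                refine ⟨(hJi x).2 (Or.inr (Or.inl hx)), ?_⟩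
                have h6 : x ∉ A.flatten := fun h => hAD x h hx
                simp only [c, if_neg h6, if_neg (hDB x hx)]
              · rintro ⟨hx, hc⟩
                have h6 : x ∉ A.flatten := fun h => by
                  simp only [c, if_pos h] at hc
                  exact absurd hc (by decide)
                have h7 : x ∉ B.flatten := fun h => by
                  simp only [c, if_neg h6, if_pos h] at hc
                  exact absurd hc (by decide)
                have := (hJi x).1 hx
                tauto
            have hDs : D = (fib c 0).sort (· ≥ ·) :=
              decr_unique hDd (hsort c) fun x => by rw [hcD, Finset.mem_sort]
            have hcP : c ∈ P := by
              refine Finset.mem_filter.2 ⟨Finset.mem_univ _, ?_⟩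
              rw [← hD, hDs, Finset.length_sort]
            obtain ⟨gA, gB⟩ := h.split hcA hcB
            refine ⟨c, hcP, Finset.mem_image.2 ⟨(A, B), Finset.mem_product.2
              ⟨((hG _ (hfc c _)).1 A).2 gA, ((hG _ (hfc c _)).1 B).2 gB⟩, ?_⟩⟩
            change A ++ (m :: (fib c 0).sort (· ≥ ·)) :: B = _
            rw [← hDs]
      · rw [Finset.sum_union, Rp_succ_finset _ _ _ J hJc]
        · congr 1
          · rw [Finset.sum_image, ← hJc, ← hGJ.2]
            · refine Finset.sum_congr rfl fun A _ => ?_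
              rw [bl_append, bl_cons_single k [m] (by simp; omega)]
              simp [bl]
            · intro A _ A' _ he
              exact List.append_cancel_right he
          · rw [Finset.sum_biUnion, Finset.mul_sum]
            · refine Finset.sum_congr rfl fun c hc => ?_
              rw [Finset.sum_image]
              · rw [← (hG _ (hfc c (-1))).2, ← (hG _ (hfc c 1)).2, Finset.sum_mul_sum,
                  Finset.sum_product, Finset.mul_sum]
                refine Finset.sum_congr rfl fun A _ => ?_
                rw [Finset.mul_sum]
                refine Finset.sum_congr rfl fun B _ => ?_
                have hlen : (m :: (fib c 0).sort (· ≥ ·)).length = k := by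
                  rw [List.length_cons, Finset.length_sort, (Finset.mem_filter.1 hc).2]
                  omega
                change Polynomial.X ^ bl k (A ++ (m :: (fib c 0).sort (· ≥ ·)) :: B) = _
                rw [bl_append, bl_cons_block k _ hlen]
                ring
              · intro p hp p' hp' he
                exact (hFinj c hc c hc p hp p' hp' he).2
            · intro c hc c' hc' hne
              refine Finset.disjoint_left.2 fun l hl hl' => ?_
              obtain ⟨p, hp, rfl⟩ := Finset.mem_image.1 hl
              obtain ⟨p', hp', he⟩ := Finset.mem_image.1 hl'
              exact hne (hFinj c hc c' hc' p hp p' hp' he.symm).1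
        · refine Finset.disjoint_left.2 fun l hl hl' => ?_
          obtain ⟨c, hc, h⟩ := Finset.mem_biUnion.1 hl'
          exact hG12 l hl c hc h

lemma good_count (hk : 2 ≤ k) (I : Finset ℕ) (t : ℕ) :
    Nat.card {l // Good k I l ∧ bl k l = t} = (Rp (Polynomial.X : Polynomial ℕ) k I.card).coeff t := by
  classical
  obtain ⟨G, hG, hs⟩ := good_gen hk I.card I rfl
  rw [← hs, Polynomial.finsetSum_coeff]
  simp only [Polynomial.coeff_X_pow]
  rw [Finset.sum_ite, Finset.sum_const_zero, add_zero, Finset.sum_const, smul_eq_mul, mul_one]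
  exact Nat.subtype_card _ (fun l => by simp [hG, eq_comm])

end items

/-! ### Combinatorics: item lists and positions -/

section positions

/-- `v` is a descent position of the list `l`. -/
def LD (l : List ℕ) (v : ℕ) : Prop := v + 1 < l.length ∧ l.getD (v + 1) 0 < l.getD v 0

/-- Positional description of critical pairs: `D` is the descent predicate. -/
structure Crit (k N : ℕ) (D : ℕ → Prop) (S : Finset ℕ) : Prop where
  le : ∀ a ∈ S, a + k ≤ N
  desc : ∀ a ∈ S, ∀ j, j + 1 < k → D (a + j)
  sep : ∀ a ∈ S, ∀ b ∈ S, a < b → a + k ≤ b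
  cover : ∀ v, D v → ∃ a ∈ S, a ≤ v ∧ v < a + k

/-- Starting positions of the blocks. -/
def starts (k : ℕ) : List (List ℕ) → Finset ℕ
  | [] => ∅
  | X :: Xs => (if X.length = k then {0} else ∅) ∪
      (starts k Xs).map (addRightEmbedding X.length)

variable {k : ℕ}

lemma LD_append (X l : List ℕ) (v : ℕ) : LD (X ++ l) (v + X.length) ↔ LD l v := by
  unfold LD
  rw [List.length_append, List.getD_append_right _ _ _ _ (by omega),
    List.getD_append_right _ _ _ _ (by omega)]
  have h1 : v + X.length + 1 - X.length = v + 1 := by omega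
  have h2 : v + X.length - X.length = v := by omega
  rw [h1, h2]
  constructor <;> rintro ⟨h, h'⟩ <;> exact ⟨by omega, h'⟩

lemma LD_cons (x : ℕ) (l : List ℕ) (v : ℕ) : LD (x :: l) (v + 1) ↔ LD l v := LD_append [x] l v

lemma LD_cons_zero (x : ℕ) (l : List ℕ) : LD (x :: l) 0 ↔ ∃ y ∈ l.head?, y < x := by
  cases l <;> simp [LD]

lemma LD_block {X l : List ℕ} (v : ℕ) (hv : v + 1 < X.length) : LD (X ++ l) v ↔ LD X v := by
  unfold LD
  rw [List.length_append, List.getD_append _ _ _ _ (by omega),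
    List.getD_append _ _ _ _ (by omega)]
  constructor <;> rintro ⟨h, h'⟩ <;> exact ⟨by omega, h'⟩

lemma decr_iff (X : List ℕ) : Decr X ↔ ∀ v, v + 1 < X.length → LD X v := by
  have : Decr X ↔ X.IsChain (fun a b => b < a) := by
    haveI : Trans (fun a b : ℕ => b < a) (fun a b => b < a) (fun a b => b < a) :=
      ⟨fun h h' => lt_trans h' h⟩
    exact List.isChain_iff_pairwise.symm
  rw [this, List.isChain_iff_getElem]
  refine forall_congr' fun v => ?_
  constructor
  · intro h hv
    refine ⟨hv, ?_⟩
    rw [List.getD_eq_getElem _ _ hv, List.getD_eq_getElem _ _ (by omega)]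
    exact h hv
  · intro h hv
    have := (h hv).2
    rw [List.getD_eq_getElem _ _ hv, List.getD_eq_getElem _ _ (by omega)] at this
    exact this

lemma crit_single {x : ℕ} {l : List ℕ} {S : Finset ℕ} (hx : x ∉ l) :
    Crit k (x :: l).length (LD (x :: l)) (S.map (addRightEmbedding 1)) ↔
      Crit k l.length (LD l) S ∧ ∀ y ∈ l.head?, x < y := by
  have hS : ∀ a, a + 1 ∈ S.map (addRightEmbedding 1) ↔ a ∈ S := fun a => by simp
  have hS' : ∀ a ∈ S.map (addRightEmbedding 1), ∃ b, a = b + 1 ∧ b ∈ S := fun a ha => by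
    obtain ⟨b, hb, rfl⟩ := Finset.mem_map.1 ha
    exact ⟨b, rfl, hb⟩
  constructor
  · intro h
    refine ⟨⟨?_, ?_, ?_, ?_⟩, ?_⟩
    · intro a ha
      have := h.le (a + 1) ((hS a).2 ha)
      rw [List.length_cons] at this
      omega
    · intro a ha j hj
      have := h.desc (a + 1) ((hS a).2 ha) j hj
      rw [← LD_cons x]
      rwa [show a + j + 1 = a + 1 + j by omega]
    · intro a ha b hb hab
      have := h.sep (a + 1) ((hS a).2 ha) (b + 1) ((hS b).2 hb) (by omega)
      omega
    · intro v hv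
      obtain ⟨a, ha, h1, h2⟩ := h.cover (v + 1) ((LD_cons x l v).2 hv)
      obtain ⟨b, rfl, hb⟩ := hS' a ha
      exact ⟨b, hb, by omega, by omega⟩
    · intro y hy
      have hne : x ≠ y := by
        rintro rfl
        exact hx (List.mem_of_head? hy)
      by_contra hxy
      obtain ⟨a, ha, h1, h2⟩ := h.cover 0 ((LD_cons_zero x l).2 ⟨y, hy, by omega⟩)
      obtain ⟨b, rfl, hb⟩ := hS' a ha
      omega
  · rintro ⟨h, hlt⟩
    refine ⟨?_, ?_, ?_, ?_⟩
    · intro a ha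
      obtain ⟨b, rfl, hb⟩ := hS' a ha
      have := h.le b hb
      rw [List.length_cons]
      omega
    · intro a ha j hj
      obtain ⟨b, rfl, hb⟩ := hS' a ha
      rw [show b + 1 + j = b + j + 1 by omega, LD_cons]
      exact h.desc b hb j hj
    · intro a ha b hb hab
      obtain ⟨a, rfl, ha'⟩ := hS' a ha
      obtain ⟨b, rfl, hb'⟩ := hS' b hb
      have := h.sep a ha' b hb' (by omega)
      omega
    · intro v hv
      cases v with
      | zero =>
        obtain ⟨y, hy, h'⟩ := (LD_cons_zero x l).1 hv
        have := hlt y hy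
        omega
      | succ v =>
        obtain ⟨a, ha, h1, h2⟩ := h.cover v ((LD_cons x l v).1 hv)
        exact ⟨a + 1, (hS a).2 ha, by omega, by omega⟩

lemma crit_block {X l : List ℕ} {S : Finset ℕ} (hX : X.length = k) :
    Crit k (X ++ l).length (LD (X ++ l)) ({0} ∪ S.map (addRightEmbedding k)) ↔
      Crit k l.length (LD l) S ∧ Decr X := by
  have hS : ∀ a, a ∈ S → a + k ∈ {0} ∪ S.map (addRightEmbedding k) := fun a ha => by simp [ha]
  have h0 : 0 ∈ {0} ∪ S.map (addRightEmbedding k) := by simp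
  have hS' : ∀ a ∈ {0} ∪ S.map (addRightEmbedding k), a = 0 ∨ ∃ b, a = b + k ∧ b ∈ S :=
    fun a ha => by
      rcases Finset.mem_union.1 ha with ha | ha
      · exact Or.inl (Finset.mem_singleton.1 ha)
      · obtain ⟨b, hb, rfl⟩ := Finset.mem_map.1 ha
        exact Or.inr ⟨b, rfl, hb⟩
  have hL : ∀ v, LD (X ++ l) (v + k) ↔ LD l v := fun v => by rw [← hX]; exact LD_append X l v
  constructor
  · intro h
    refine ⟨⟨?_, ?_, ?_, ?_⟩, ?_⟩
    · intro a ha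
      have := h.le (a + k) (hS a ha)
      rw [List.length_append] at this
      omega
    · intro a ha j hj
      have := h.desc (a + k) (hS a ha) j hj
      rw [← hL]
      rwa [show a + j + k = a + k + j by omega]
    · intro a ha b hb hab
      have := h.sep (a + k) (hS a ha) (b + k) (hS b hb) (by omega)
      omega
    · intro v hv
      obtain ⟨a, ha, h1, h2⟩ := h.cover (v + k) ((hL v).2 hv)
      rcases hS' a ha with rfl | ⟨b, rfl, hb⟩
      · omega
      · exact ⟨b, hb, by omega, by omega⟩
    · rw [decr_iff]
      intro v hv
      have := h.desc 0 h0 v (by omega)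
      rw [zero_add] at this
      exact (LD_block v hv).1 this
  · rintro ⟨h, hd⟩
    rw [decr_iff] at hd
    refine ⟨?_, ?_, ?_, ?_⟩
    · intro a ha
      rw [List.length_append]
      rcases hS' a ha with rfl | ⟨b, rfl, hb⟩
      · omega
      · have := h.le b hb
        omega
    · intro a ha j hj
      rcases hS' a ha with rfl | ⟨b, rfl, hb⟩
      · rw [zero_add, LD_block j (by omega)]
        exact hd j (by omega)
      · rw [show b + k + j = b + j + k by omega, hL]
        exact h.desc b hb j hj
    · intro a ha b hb hab
      rcases hS' a ha with rfl | ⟨a, rfl, ha'⟩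
      · rcases hS' b hb with rfl | ⟨b, rfl, hb'⟩ <;> omega
      · rcases hS' b hb with rfl | ⟨b, rfl, hb'⟩
        · omega
        · have := h.sep a ha' b hb' (by omega)
          omega
    · intro v hv
      by_cases hvk : v < k
      · exact ⟨0, h0, by omega, by omega⟩
      · obtain ⟨v, rfl⟩ : ∃ u, v = u + k := ⟨v - k, by omega⟩
        obtain ⟨a, ha, h1, h2⟩ := h.cover v ((hL v).1 hv)
        exact ⟨a + k, hS a ha, by omega, by omega⟩

lemma starts_block {X : List ℕ} {Xs : List (List ℕ)} (hX : X.length = k) :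
    starts k (X :: Xs) = {0} ∪ (starts k Xs).map (addRightEmbedding k) := by
  rw [starts, if_pos hX, hX]

lemma starts_single (hk : 2 ≤ k) {x : ℕ} {Xs : List (List ℕ)} :
    starts k ([x] :: Xs) = (starts k Xs).map (addRightEmbedding 1) := by
  rw [starts, if_neg (by simp; omega), Finset.empty_union]
  rfl

lemma head_flatten {Xs : List (List ℕ)} (h : ∀ X ∈ Xs, X ≠ []) (y : ℕ) :
    y ∈ Xs.flatten.head? ↔ ∃ Y ∈ Xs.head?, y ∈ Y.head? := by
  cases Xs with
  | nil => simp
  | cons X Xs =>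
    cases X with
    | nil => exact absurd rfl (h [] (by simp))
    | cons x X => simp

lemma item_ne_nil (hk : 2 ≤ k) {X : List ℕ} (h : Item k X) : X ≠ [] := by
  rintro rfl
  have := h.1
  simp at this
  omega

lemma chain_single (hk : 2 ≤ k) {x : ℕ} {Xs : List (List ℕ)} (h : ∀ X ∈ Xs, X ≠ []) :
    (∀ Y ∈ Xs.head?, IRel k [x] Y) ↔ ∀ y ∈ Xs.flatten.head?, x < y := by
  constructor
  · intro h1 y hy
    obtain ⟨Y, hY, hy⟩ := (head_flatten h y).1 hy
    rcases h1 Y hY with h2 | h2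
    · simp at h2; omega
    · exact h2 x (by simp) y hy
  · intro h1 Y hY
    refine Or.inr fun z hz y hy => ?_
    obtain rfl := List.mem_singleton.1 hz
    exact h1 y ((head_flatten h y).2 ⟨Y, hY, hy⟩)

lemma crit_of_items (hk : 2 ≤ k) : ∀ Xs : List (List ℕ), (∀ X ∈ Xs, Item k X) →
    Xs.IsChain (IRel k) → Xs.flatten.Nodup → Crit k Xs.flatten.length (LD Xs.flatten) (starts k Xs)
  | [], _, _, _ => ⟨by simp [starts], by simp [starts], by simp [starts], by
      intro v hv; have := hv.1; simp at this⟩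
  | X :: Xs, h1, h2, h3 => by
    rw [List.flatten_cons, List.nodup_append] at h3
    rw [List.isChain_cons] at h2
    have ih := crit_of_items hk Xs (fun X hX => h1 X (by simp [hX])) h2.2 h3.2.1
    have hX := h1 X (by simp)
    rcases hX.1 with h4 | h4
    · obtain ⟨x, rfl⟩ := List.length_eq_one_iff.1 h4
      rw [starts_single hk]
      change Crit k (x :: Xs.flatten).length (LD (x :: Xs.flatten)) _
      rw [crit_single]
      · refine ⟨ih, (chain_single hk ?_).1 h2.1⟩
        intro X hX
        exact item_ne_nil hk (h1 X (by simp [hX]))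
      · intro hx
        exact h3.2.2 x (by simp) x hx rfl
    · rw [starts_block h4, List.flatten_cons, crit_block h4]
      exact ⟨ih, hX.2⟩

lemma card_starts (hk : 2 ≤ k) : ∀ Xs : List (List ℕ), (∀ X ∈ Xs, Item k X) →
    (starts k Xs).card = bl k Xs
  | [], _ => by simp [starts, bl]
  | X :: Xs, h1 => by
    have ih := card_starts hk Xs (fun X hX => h1 X (by simp [hX]))
    rcases (h1 X (by simp)).1 with h4 | h4
    · obtain ⟨x, rfl⟩ := List.length_eq_one_iff.1 h4
      rw [starts_single hk, Finset.card_map, ih, bl_cons_single]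
      simp; omega
    · rw [starts_block h4, Finset.card_union_of_disjoint, Finset.card_map, ih,
        bl_cons_block k X h4, Finset.card_singleton, add_comm]
      rw [Finset.disjoint_left]
      intro a ha hb
      obtain rfl := Finset.mem_singleton.1 ha
      obtain ⟨b, _, hb⟩ := Finset.mem_map.1 hb
      simp at hb
      omega

lemma zero_mem_starts (hk : 2 ≤ k) {X : List ℕ} {Xs : List (List ℕ)} (hX : Item k X) :
    0 ∈ starts k (X :: Xs) ↔ X.length = k := by
  rcases hX.1 with h4 | h4
  · obtain ⟨x, rfl⟩ := List.length_eq_one_iff.1 h4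
    rw [starts_single hk]
    simp
    omega
  · rw [starts_block h4]
    simp [h4]

lemma starts_inj (hk : 2 ≤ k) : ∀ Xs Ys : List (List ℕ), (∀ X ∈ Xs, Item k X) →
    (∀ X ∈ Ys, Item k X) → Xs.flatten = Ys.flatten → starts k Xs = starts k Ys → Xs = Ys
  | [], [], _, _, _, _ => rfl
  | [], Y :: Ys, _, hY, h, _ => by
    have := item_ne_nil hk (hY Y (by simp))
    rw [List.flatten_cons] at h
    simp at h
    exact absurd h.1 this
  | X :: Xs, [], hX, _, h, _ => by
    have := item_ne_nil hk (hX X (by simp))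
    rw [List.flatten_cons] at h
    simp at h
    exact absurd h.1 this
  | X :: Xs, Y :: Ys, hX, hY, h, hs => by
    have iX := hX X (by simp)
    have iY := hY Y (by simp)
    have h0 : X.length = k ↔ Y.length = k := by
      rw [← zero_mem_starts hk iX (Xs := Xs), hs, zero_mem_starts hk iY]
    have hl : X.length = Y.length := by
      have := iX.1
      have := iY.1
      omega
    rw [List.flatten_cons, List.flatten_cons] at h
    obtain ⟨rfl, h'⟩ := List.append_inj h hl
    have hs' : starts k Xs = starts k Ys := by
      rcases iX.1 with h4 | h4
      · obtain ⟨x, rfl⟩ := List.length_eq_one_iff.1 h4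
        rw [starts_single hk, starts_single hk] at hs
        exact Finset.map_injective _ hs
      · rw [starts_block h4, starts_block h4] at hs
        ext a
        have := congrArg (fun S => a + k ∈ S) hs
        have hk0 : k ≠ 0 := by omega
        simpa [hk0] using this
    rw [starts_inj hk Xs Ys (fun X h => hX X (by simp [h])) (fun X h => hY X (by simp [h])) h' hs']

lemma items_of_crit (hk : 2 ≤ k) (N : ℕ) : ∀ (l : List ℕ) (S : Finset ℕ), l.length = N → l.Nodup →
    Crit k l.length (LD l) S → ∃ Xs : List (List ℕ), (∀ X ∈ Xs, Item k X) ∧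
      Xs.IsChain (IRel k) ∧ Xs.flatten = l ∧ starts k Xs = S := by
  induction N using Nat.strong_induction_on with
  | _ N ih =>
    intro l S hl hn h
    by_cases h0 : 0 ∈ S
    · have hkl : k ≤ l.length := by have := h.le 0 h0; omega
      obtain ⟨X, l', rfl, hX⟩ : ∃ X l', l = X ++ l' ∧ X.length = k :=
        ⟨l.take k, l.drop k, (List.take_append_drop k l).symm, by simp [hkl]⟩
      obtain ⟨S', rfl⟩ : ∃ S' : Finset ℕ, S = {0} ∪ S'.map (addRightEmbedding k) := by
        refine ⟨(S.erase 0).image (fun a => a - k), ?_⟩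
        have hge : ∀ a ∈ S, a ≠ 0 → k ≤ a := fun a ha h1 => by
          have := h.sep 0 h0 a ha (by omega)
          omega
        ext a
        simp only [Finset.mem_union, Finset.mem_singleton, Finset.mem_map, Finset.mem_image,
          Finset.mem_erase, addRightEmbedding_apply]
        constructor
        · intro ha
          by_cases ha0 : a = 0
          · exact Or.inl ha0
          · have := hge a ha ha0
            exact Or.inr ⟨a - k, ⟨a, ⟨ha0, ha⟩, rfl⟩, by omega⟩
        · rintro (rfl | ⟨b, ⟨c, ⟨hc0, hc⟩, rfl⟩, rfl⟩)
          · exact h0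
          · have := hge c hc hc0
            rwa [show c - k + k = c by omega]
      rw [crit_block hX] at h
      rw [List.length_append] at hl
      rw [List.nodup_append] at hn
      obtain ⟨Xs, h1, h2, h3, h4⟩ := ih l'.length (by omega) l' S' rfl hn.2.1 h.1
      refine ⟨X :: Xs, ?_, ?_, ?_, ?_⟩
      · intro Y hY
        rcases List.mem_cons.1 hY with rfl | hY
        · exact ⟨Or.inr hX, h.2⟩
        · exact h1 Y hY
      · exact List.isChain_cons.2 ⟨fun Y _ => Or.inl hX, h2⟩
      · rw [List.flatten_cons, h3]
      · rw [starts_block hX, h4]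
    · cases l with
      | nil =>
        refine ⟨[], by simp, List.isChain_nil, rfl, ?_⟩
        symm
        change S = ∅
        rw [Finset.eq_empty_iff_forall_notMem]
        intro a ha
        have := h.le a ha
        simp at this
        omega
      | cons x l' =>
        obtain ⟨S', rfl⟩ : ∃ S' : Finset ℕ, S = S'.map (addRightEmbedding 1) := by
          refine ⟨S.image (fun a => a - 1), ?_⟩
          have hge : ∀ a ∈ S, 1 ≤ a := fun a ha => by
            by_contra h1
            obtain rfl : a = 0 := by omega
            exact h0 ha
          ext a
          simp only [Finset.mem_map, Finset.mem_image, addRightEmbedding_apply]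
          constructor
          · intro ha
            have := hge a ha
            exact ⟨a - 1, ⟨a, ha, rfl⟩, by omega⟩
          · rintro ⟨b, ⟨c, hc, rfl⟩, rfl⟩
            have := hge c hc
            rwa [show c - 1 + 1 = c by omega]
        rw [List.nodup_cons] at hn
        rw [crit_single hn.1] at h
        rw [List.length_cons] at hl
        obtain ⟨Xs, h1, h2, h3, h4⟩ := ih l'.length (by omega) l' S' rfl hn.2 h.1
        refine ⟨[x] :: Xs, ?_, ?_, ?_, ?_⟩
        · intro Y hY
          rcases List.mem_cons.1 hY with rfl | hY
          · exact ⟨Or.inl rfl, by simp⟩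
          · exact h1 Y hY
        · refine List.isChain_cons.2 ⟨?_, h2⟩
          rw [chain_single hk fun X hX => item_ne_nil hk (h1 X hX), h3]
          exact h.2
        · rw [List.flatten_cons, h3]; rfl
        · rw [starts_single hk, h4]

/-- Counting good lists by positions. -/
lemma good_count' (hk : 2 ≤ k) (I : Finset ℕ) (t : ℕ) :
    Nat.card {p : List ℕ × Finset ℕ // p.1.Nodup ∧ (∀ x, x ∈ p.1 ↔ x ∈ I) ∧
      Crit k p.1.length (LD p.1) p.2 ∧ p.2.card = t} =
      (Rp (Polynomial.X : Polynomial ℕ) k I.card).coeff t := by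
  rw [← good_count hk I t]
  symm
  refine Nat.card_congr (Equiv.ofBijective (fun l => ⟨(l.1.flatten, starts k l.1),
    l.2.1.nodup, l.2.1.mem, crit_of_items hk _ l.2.1.item l.2.1.chain l.2.1.nodup, by
      rw [card_starts hk _ l.2.1.item]; exact l.2.2⟩) ⟨?_, ?_⟩)
  · rintro ⟨l, hl, _⟩ ⟨l', hl', _⟩ h
    simp only [Subtype.mk.injEq, Prod.mk.injEq] at h
    exact Subtype.ext (starts_inj hk _ _ hl.item hl'.item h.1 h.2)
  · rintro ⟨⟨l, S⟩, h1, h2, h3, h4⟩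
    obtain ⟨Xs, g1, g2, rfl, rfl⟩ := items_of_crit hk _ l S rfl h1 h3
    exact ⟨⟨Xs, ⟨g1, g2, h1, h2⟩, by rw [← card_starts hk _ g1]; exact h4⟩, rfl⟩

end positions

/-! ### Combinatorics: critical pairs and positions -/

section critical

variable {n : ℕ}

/-- Descents as natural numbers. -/
def ND (w : Equiv.Perm (Fin (n + 1))) (v : ℕ) : Prop := ∃ h : v < n, IsDescent w ⟨v, h⟩

/-- The set `T` attached to a set of starting positions. -/
def TS (n k : ℕ) (S : Finset ℕ) : Finset (Fin n) :=
  Finset.univ.filter fun x : Fin n => ∃ a ∈ S, a < x.1 ∧ x.1 + 1 < a + k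

lemma mem_TS {k : ℕ} {S : Finset ℕ} {x : Fin n} :
    x ∈ TS n k S ↔ ∃ a ∈ S, a < x.1 ∧ x.1 + 1 < a + k := by
  simp [TS]

/-- The induced path graph. -/
abbrev PG (T : Finset (Fin n)) := (SimpleGraph.pathGraph n).induce (T : Set (Fin n))

lemma reach_of_interval (T : Finset (Fin n)) (d : ℕ) : ∀ u v : (T : Set (Fin n)),
    v.1.1 = u.1.1 + d → (∀ x : Fin n, u.1.1 ≤ x.1 → x.1 ≤ v.1.1 → x ∈ T) →
    (PG T).Reachable u v := by
  induction d with
  | zero =>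
    intro u v h _
    have : u = v := Subtype.ext (Fin.ext (by omega))
    rw [this]
  | succ d ih =>
    intro u v h hT
    have hv := v.1.2
    have hm : (⟨u.1.1 + d, by omega⟩ : Fin n) ∈ T := hT _ (by simp) (by simp; omega)
    refine (ih u ⟨⟨u.1.1 + d, by omega⟩, hm⟩ rfl ?_).trans (SimpleGraph.Adj.reachable ?_)
    · intro x h1 h2
      exact hT x h1 (by simp at h2; omega)
    · rw [SimpleGraph.induce_adj, SimpleGraph.pathGraph_adj]
      simp
      omega

lemma interval_of_reach (T : Finset (Fin n)) {u v : (T : Set (Fin n))}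
    (h : (PG T).Reachable u v) : ∀ x : Fin n, (u.1.1 ≤ x.1 ∧ x.1 ≤ v.1.1) ∨
      (v.1.1 ≤ x.1 ∧ x.1 ≤ u.1.1) → x ∈ T := by
  obtain ⟨p⟩ := h
  induction p with
  | nil =>
    rename_i u
    intro x hx
    have : x = u.1 := Fin.ext (by omega)
    rw [this]
    exact u.2
  | cons hadj p ih =>
    rename_i u u' v
    intro x hx
    rw [SimpleGraph.induce_adj, SimpleGraph.pathGraph_adj] at hadj
    by_cases hxu : x = u.1
    · rw [hxu]; exact u.2
    · refine ih x ?_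
      have : x.1 ≠ u.1.1 := fun h => hxu (Fin.ext h)
      omega

variable {k : ℕ} {w : Equiv.Perm (Fin (n + 1))} {S : Finset ℕ}

lemma start_notMem (h : Crit k (n + 1) (ND w) S) {a : ℕ} (ha : a ∈ S) (han : a < n) :
    (⟨a, han⟩ : Fin n) ∉ TS n k S := by
  intro h'
  obtain ⟨b, hb, h1, h2⟩ := mem_TS.1 h'
  simp only at h1 h2
  have := h.sep b hb a ha h1
  omega

lemma critical_of_crit (hk : 3 ≤ k) (h : Crit k (n + 1) (ND w) S) :
    IsCriticalPair n k S.card (w, TS n k S) := by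
  classical
  set T := TS n k S with hT
  have hlt : ∀ a ∈ S, a + 1 < n := fun a ha => by have := h.le a ha; omega
  have hm : ∀ (a : ℕ) (ha : a ∈ S), (⟨a + 1, hlt a ha⟩ : Fin n) ∈ T := fun a ha =>
    mem_TS.2 ⟨a, ha, by simp, by simp; omega⟩
  let φ : S → (PG T).ConnectedComponent := fun a =>
    (PG T).connectedComponentMk ⟨⟨a.1 + 1, hlt a.1 a.2⟩, hm a.1 a.2⟩
  have hφ : ∀ (a : S) (x : (T : Set (Fin n))), a.1 < x.1.1 → x.1.1 + 1 < a.1 + k →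
      (PG T).connectedComponentMk x = φ a := by
    intro a x h1 h2
    refine (SimpleGraph.ConnectedComponent.sound ?_).symm
    refine reach_of_interval T (x.1.1 - (a.1 + 1)) _ _ (by simp; omega) ?_
    intro y h3 h4
    simp only at h3
    exact mem_TS.2 ⟨a.1, a.2, by omega, by omega⟩
  have hinj' : ∀ a b : S, a.1 < b.1 → φ a ≠ φ b := by
    intro a b hab he
    have := interval_of_reach T (SimpleGraph.ConnectedComponent.exact he)
      ⟨b.1, by have := hlt b.1 b.2; omega⟩ (Or.inl ⟨by simp; omega, by simp⟩)
    exact start_notMem h b.2 _ this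
  have hinj : Function.Injective φ := by
    intro a b he
    rcases lt_trichotomy a.1 b.1 with h1 | h1 | h1
    · exact absurd he (hinj' a b h1)
    · exact Subtype.ext h1
    · exact absurd he.symm (hinj' b a h1)
  have hsurj : Function.Surjective φ := by
    intro c
    induction c using SimpleGraph.ConnectedComponent.ind with
    | _ x =>
      obtain ⟨a, ha, h1, h2⟩ := mem_TS.1 x.2
      exact ⟨⟨a, ha⟩, (hφ ⟨a, ha⟩ x h1 h2).symm⟩
  have hsupp : ∀ (a : S) (x : (T : Set (Fin n))), x ∈ (φ a).supp ↔
      a.1 < x.1.1 ∧ x.1.1 + 1 < a.1 + k := by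
    intro a x
    rw [SimpleGraph.ConnectedComponent.mem_supp_iff]
    constructor
    · intro hx
      obtain ⟨b, hb, h1, h2⟩ := mem_TS.1 x.2
      have := hinj ((hφ ⟨b, hb⟩ x h1 h2).symm.trans hx)
      rw [← this]
      exact ⟨h1, h2⟩
    · rintro ⟨h1, h2⟩
      exact hφ a x h1 h2
  refine ⟨?_, ?_, ?_, ?_, ?_⟩
  · intro i hi
    obtain ⟨a, ha, h1, h2⟩ := mem_TS.1 hi
    obtain ⟨h3, h4⟩ := h.desc a ha (i.1 - a) (by omega)
    convert h4 using 1
    exact Fin.ext (by simp; omega)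
  · change Nat.card (PG T).ConnectedComponent = _
    rw [← Nat.card_congr (Equiv.ofBijective φ ⟨hinj, hsurj⟩)]
    simp
  · change ∀ c : (PG T).ConnectedComponent, _
    intro c
    obtain ⟨a, rfl⟩ := hsurj c
    rw [Nat.card_coe_set_eq]
    have hi : Function.Injective (fun x : (T : Set (Fin n)) => x.1.1) := fun x y h =>
      Subtype.ext (Fin.ext h)
    rw [← Set.ncard_image_of_injective _ hi]
    have : Set.image (fun x : (T : Set (Fin n)) => x.1.1) (φ a).supp =
        (Finset.Ioo a.1 (a.1 + k - 1) : Finset ℕ) := by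
      ext y
      simp only [Set.mem_image, Finset.coe_Ioo, Set.mem_Ioo]
      constructor
      · rintro ⟨x, hx, rfl⟩
        have := (hsupp a x).1 hx
        omega
      · rintro ⟨h1, h2⟩
        have hle := h.le a.1 a.2
        have hy : (⟨y, by omega⟩ : Fin n) ∈ T := mem_TS.2 ⟨a.1, a.2, h1, by simp; omega⟩
        exact ⟨⟨_, hy⟩, (hsupp a _).2 ⟨h1, by simp; omega⟩, rfl⟩
    rw [this, Set.ncard_coe_finset, Nat.card_Ioo]
    omega
  · change ∀ c : (PG T).ConnectedComponent, _
    intro c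
    obtain ⟨a, rfl⟩ := hsurj c
    have han := hlt a.1 a.2
    refine ⟨⟨a.1, by omega⟩, ?_, start_notMem h a.2 _, ?_, ?_, ?_⟩
    · obtain ⟨h3, h4⟩ := h.desc a.1 a.2 0 (by omega)
      exact h4
    · refine ⟨⟨⟨a.1 + 1, han⟩, hm a.1 a.2⟩, rfl, ?_⟩
      rw [SimpleGraph.pathGraph_adj]
      exact Or.inl rfl
    · intro u hu
      exact ((hsupp a u).1 hu).1
    · change ∀ c' : (PG T).ConnectedComponent, _
      intro c' hc' u hu hadj
      obtain ⟨b, rfl⟩ := hsurj c'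
      have hab : a.1 ≠ b.1 := fun h => hc' (congrArg φ (Subtype.ext h.symm))
      have := (hsupp b u).1 hu
      rw [SimpleGraph.pathGraph_adj] at hadj
      simp only at hadj
      rcases lt_or_gt_of_ne hab with h1 | h1
      · have := h.sep a.1 a.2 b.1 b.2 h1
        omega
      · have := h.sep b.1 b.2 a.1 a.2 h1
        omega
  · intro v hv hvT
    obtain ⟨a, ha, h1, h2⟩ := h.cover v.1 ⟨v.2, hv⟩
    have hle := h.le a ha
    have hvT' : ¬ (a < v.1 ∧ v.1 + 1 < a + k) := fun hh => hvT (mem_TS.2 ⟨a, ha, hh⟩)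
    by_cases hva : v.1 = a
    · refine ⟨⟨a + 1, hlt a ha⟩, hm a ha, ?_⟩
      rw [SimpleGraph.pathGraph_adj]
      left
      simp; omega
    · refine ⟨⟨v.1 - 1, by omega⟩, mem_TS.2 ⟨a, ha, by simp; omega, by simp; omega⟩, ?_⟩
      rw [SimpleGraph.pathGraph_adj]
      right
      simp; omega

lemma segment_eq {A : Finset ℕ} {v m : ℕ} (h1 : ∀ x ∈ A, v < x)
    (h2 : ∀ x ∈ A, ∀ y, v < y → y < x → y ∈ A) (h3 : A.card = m) : A = Finset.Ioo v (v + m + 1) := by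
  have hsub : A ⊆ Finset.Ioo v (v + m + 1) := by
    intro x hx
    rw [Finset.mem_Ioo]
    refine ⟨h1 x hx, ?_⟩
    by_contra hlt
    have : Finset.Ioc v (v + m + 1) ⊆ A := by
      intro y hy
      rw [Finset.mem_Ioc] at hy
      by_cases hyx : y = x
      · rw [hyx]; exact hx
      · exact h2 x hx y hy.1 (by omega)
    have := Finset.card_le_card this
    rw [Nat.card_Ioc] at this
    omega
  refine Finset.eq_of_subset_of_card_le hsub ?_
  rw [Nat.card_Ioo]
  omega

lemma crit_of_critical (hk : 3 ≤ k) {T : Finset (Fin n)} {t : ℕ}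
    (h : IsCriticalPair n k t (w, T)) :
    ∃ S : Finset ℕ, Crit k (n + 1) (ND w) S ∧ S.card = t ∧ TS n k S = T := by
  classical
  obtain ⟨hD, hc, hcard, h2, h3⟩ := h
  change ∀ i ∈ T, IsDescent w i at hD
  change Nat.card (PG T).ConnectedComponent = t at hc
  change ∀ c : (PG T).ConnectedComponent, _ at hcard
  have hi : Function.Injective (fun x : (T : Set (Fin n)) => x.1.1) := fun x y h =>
    Subtype.ext (Fin.ext h)
  -- the block of each element
  have key : ∀ x ∈ T, ∃ a : ℕ, ND w a ∧ (∀ y ∈ T, y.1 ≠ a) ∧ a < x.1 ∧ x.1 + 1 < a + k ∧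
      (∀ y, a < y → y + 1 < a + k → ∃ hy : y < n, (⟨y, hy⟩ : Fin n) ∈ T) ∧
      (∀ y ∈ T, y.1 + 1 ≠ a) := by
    intro x hx
    let c : (PG T).ConnectedComponent := (PG T).connectedComponentMk ⟨x, hx⟩
    obtain ⟨v, hv1, hv2, ⟨u, hu, huv⟩, hv4, hv5⟩ := h2 c
    change ∀ c' : (PG T).ConnectedComponent, _ at hv5
    have hlt := hv4 u hu
    rw [SimpleGraph.pathGraph_adj] at huv
    have huv' : u.1.1 = v.1 + 1 := by
      have : v.1 < u.1.1 := hlt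
      omega
    let A : Finset ℕ := (Set.toFinite c.supp).toFinset.image (fun x => x.1.1)
    have hA : ∀ y, y ∈ A ↔ ∃ z ∈ c.supp, z.1.1 = y := by
      intro y
      simp [A]
    have hAc : A.card = k - 2 := by
      rw [Finset.card_image_of_injective _ hi, ← Set.ncard_eq_toFinset_card, ← hcard c,
        Nat.card_coe_set_eq]
    have hseg : A = Finset.Ioo v.1 (v.1 + (k - 2) + 1) := by
      refine segment_eq ?_ ?_ hAc
      · intro y hy
        obtain ⟨z, hz, rfl⟩ := (hA y).1 hy
        exact hv4 z hz
      · intro y hy y' h4 h5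
        obtain ⟨z, hz, rfl⟩ := (hA y).1 hy
        have hz' := z.1.2
        have hr : (PG T).Reachable u z := SimpleGraph.ConnectedComponent.exact (hu.trans hz.symm)
        have hbetw := interval_of_reach T hr
        have hy'T : (⟨y', by omega⟩ : Fin n) ∈ T := hbetw _ (Or.inl ⟨by simp; omega, by simp; omega⟩)
        refine (hA y').2 ⟨⟨_, hy'T⟩, ?_, rfl⟩
        refine Eq.trans (SimpleGraph.ConnectedComponent.sound ?_) hu
        refine (reach_of_interval T (y' - u.1.1) u _ (by simp; omega) ?_).symm
        intro q hq1 hq2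
        simp only at hq2
        exact hbetw q (Or.inl ⟨hq1, by omega⟩)
    have hxA : x.1 ∈ A := (hA _).2 ⟨⟨x, hx⟩, rfl, rfl⟩
    have hxA' := hxA
    rw [hseg, Finset.mem_Ioo] at hxA'
    refine ⟨v.1, ⟨v.2, hv1⟩, ?_, hxA'.1, by omega, ?_, ?_⟩
    · intro y hy he
      exact hv2 (by rw [← Fin.ext he]; exact hy)
    · intro y hy1 hy2
      have : y ∈ A := by rw [hseg, Finset.mem_Ioo]; omega
      obtain ⟨z, hz, rfl⟩ := (hA y).1 this
      exact ⟨z.1.2, z.2⟩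
    · intro y hy he
      refine hv5 ((PG T).connectedComponentMk ⟨y, hy⟩) ?_ ⟨y, hy⟩ rfl ?_
      · intro hcc
        have : v.1 < y.1 := hv4 ⟨y, hy⟩ hcc
        omega
      · rw [SimpleGraph.pathGraph_adj]
        exact Or.inr he
  let S : Finset ℕ := (Finset.range n).filter fun a => (∀ y ∈ T, y.1 ≠ a) ∧ ∃ y ∈ T, y.1 = a + 1
  have hS : ∀ a, a ∈ S ↔ (∀ y ∈ T, y.1 ≠ a) ∧ ∃ y ∈ T, y.1 = a + 1 := by
    intro a
    simp only [S, Finset.mem_filter, Finset.mem_range, and_iff_right_iff_imp]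
    rintro ⟨_, y, _, hy⟩
    have := y.2
    omega
  have keyS : ∀ x ∈ T, ∃ a ∈ S, a < x.1 ∧ x.1 + 1 < a + k := by
    intro x hx
    obtain ⟨a, _, k2, k3, k4, k5, _⟩ := key x hx
    obtain ⟨h6, h7⟩ := k5 (a + 1) (by omega) (by omega)
    exact ⟨a, (hS a).2 ⟨k2, _, h7, rfl⟩, k3, k4⟩
  have key' : ∀ a ∈ S, ND w a ∧
      (∀ y, a < y → y + 1 < a + k → ∃ hy : y < n, (⟨y, hy⟩ : Fin n) ∈ T) ∧
      (∀ y ∈ T, y.1 + 1 ≠ a) := by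
    intro a ha
    obtain ⟨ha1, x, hx, hxa⟩ := (hS a).1 ha
    obtain ⟨b, k1, k2, k3, k4, k5, k6⟩ := key x hx
    have : b = a := by
      by_contra hne
      obtain ⟨h7, h8⟩ := k5 a (by omega) (by omega)
      exact ha1 _ h8 rfl
    subst this
    exact ⟨k1, k5, k6⟩
  have hcrit : Crit k (n + 1) (ND w) S := by
    refine ⟨?_, ?_, ?_, ?_⟩
    · intro a ha
      obtain ⟨h4, -⟩ := (key' a ha).2.1 (a + k - 2) (by omega) (by omega)
      omega
    · intro a ha j hj
      by_cases hj0 : j = 0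
      · subst hj0; exact (key' a ha).1
      · obtain ⟨h4, h5⟩ := (key' a ha).2.1 (a + j) (by omega) (by omega)
        exact ⟨h4, hD _ h5⟩
    · intro a ha b hb hab
      by_contra hlt
      by_cases hb1 : b + 1 < a + k
      · obtain ⟨h4, h5⟩ := (key' a ha).2.1 b hab hb1
        exact ((hS b).1 hb).1 _ h5 rfl
      · obtain ⟨h4, h5⟩ := (key' a ha).2.1 (b - 1) (by omega) (by omega)
        exact (key' b hb).2.2 _ h5 (by simp; omega)
    · rintro v ⟨hv, hd⟩
      by_cases hvT : (⟨v, hv⟩ : Fin n) ∈ T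
      · obtain ⟨a, ha, h4, h5⟩ := keyS _ hvT
        simp only at h4 h5
        exact ⟨a, ha, by omega, by omega⟩
      · obtain ⟨u, hu, hadj⟩ := h3 _ hd hvT
        obtain ⟨a, ha, h4, h5⟩ := keyS u hu
        rw [SimpleGraph.pathGraph_adj] at hadj
        simp only at hadj
        exact ⟨a, ha, by omega, by omega⟩
  have hTS : TS n k S = T := by
    ext x
    rw [mem_TS]
    constructor
    · rintro ⟨a, ha, h4, h5⟩
      exact ((key' a ha).2.1 x.1 h4 h5).2
    · exact keyS x
  refine ⟨S, hcrit, ?_, hTS⟩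
  have := (critical_of_crit hk hcrit).2.1
  rw [hTS] at this
  exact this.symm.trans hc

lemma TS_inj (hk : 3 ≤ k) {S S' : Finset ℕ} (h : Crit k (n + 1) (ND w) S)
    (he : TS n k S = TS n k S') : S ⊆ S' := by
  intro a ha
  have hle := h.le a ha
  have h1 : (⟨a + 1, by omega⟩ : Fin n) ∈ TS n k S := mem_TS.2 ⟨a, ha, by simp, by simp; omega⟩
  rw [he] at h1
  obtain ⟨b, hb, h2, h3⟩ := mem_TS.1 h1
  simp only at h2 h3
  by_cases hab : a = b
  · rw [hab]; exact hb
  · exfalso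
    refine start_notMem h ha (by omega) ?_
    rw [he]
    exact mem_TS.2 ⟨b, hb, by simp; omega, by simp; omega⟩

/-- One-line form of a permutation. -/
def pl (w : Equiv.Perm (Fin (n + 1))) : List ℕ := List.ofFn fun i => (w i).1

lemma pl_length (w : Equiv.Perm (Fin (n + 1))) : (pl w).length = n + 1 := by simp [pl]

lemma pl_getElem (w : Equiv.Perm (Fin (n + 1))) (i : ℕ) (h : i < (pl w).length) :
    (pl w)[i] = (w ⟨i, by rw [pl_length] at h; exact h⟩).1 := by
  exact List.getElem_ofFn (f := fun i => (w i).1) h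

lemma LD_pl (w : Equiv.Perm (Fin (n + 1))) : LD (pl w) = ND w := by
  funext v
  apply propext
  unfold LD ND
  rw [pl_length]
  constructor
  · rintro ⟨h1, h2⟩
    refine ⟨by omega, ?_⟩
    rw [List.getD_eq_getElem _ _ (by rw [pl_length]; omega),
      List.getD_eq_getElem _ _ (by rw [pl_length]; omega), pl_getElem, pl_getElem] at h2
    exact h2
  · rintro ⟨h1, h2⟩
    refine ⟨by omega, ?_⟩
    rw [List.getD_eq_getElem _ _ (by rw [pl_length]; omega),
      List.getD_eq_getElem _ _ (by rw [pl_length]; omega), pl_getElem, pl_getElem]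
    exact h2

lemma pl_nodup (w : Equiv.Perm (Fin (n + 1))) : (pl w).Nodup := by
  rw [pl, List.nodup_ofFn]
  intro i j h
  exact w.injective (Fin.ext h)

lemma pl_mem (w : Equiv.Perm (Fin (n + 1))) (x : ℕ) : x ∈ pl w ↔ x ∈ Finset.range (n + 1) := by
  rw [pl, List.mem_ofFn', Finset.mem_range]
  constructor
  · rintro ⟨i, rfl⟩
    exact (w i).2
  · intro hx
    exact ⟨w.symm ⟨x, hx⟩, by simp⟩

lemma pl_inj {w w' : Equiv.Perm (Fin (n + 1))} (h : pl w = pl w') : w = w' := by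
  have := List.ofFn_injective h
  ext i
  exact congrFun this i

lemma pl_surj {l : List ℕ} (hn : l.Nodup) (hm : ∀ x, x ∈ l ↔ x ∈ Finset.range (n + 1)) :
    ∃ w : Equiv.Perm (Fin (n + 1)), pl w = l := by
  have hlen : l.length = n + 1 := by
    rw [← List.toFinset_card_of_nodup hn, ← Finset.card_range (n + 1)]
    congr 1
    ext x
    rw [List.mem_toFinset, hm]
  let f : Fin (n + 1) → Fin (n + 1) := fun i =>
    ⟨l[i.1]'(by rw [hlen]; exact i.2), Finset.mem_range.1 ((hm _).1 (List.getElem_mem _))⟩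
  have hf : Function.Injective f := by
    intro i j h
    have h1 : l[i.1]'(by rw [hlen]; exact i.2) = l[j.1]'(by rw [hlen]; exact j.2) :=
      congrArg Fin.val h
    exact Fin.ext ((List.Nodup.getElem_inj_iff hn).1 h1)
  refine ⟨Equiv.ofBijective f (Finite.injective_iff_bijective.1 hf), ?_⟩
  refine List.ext_getElem (by rw [pl_length, hlen]) ?_
  intro i h1 h2
  rw [pl_getElem]
  rfl

lemma critical_count (hk : 3 ≤ k) (t : ℕ) :
    Nat.card {p : Equiv.Perm (Fin (n + 1)) × Finset (Fin n) // IsCriticalPair n k t p} =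
      (Rp (Polynomial.X : Polynomial ℕ) k (n + 1)).coeff t := by
  have hg := good_count' (k := k) (by omega) (Finset.range (n + 1)) t
  rw [Finset.card_range] at hg
  rw [← hg]
  have e1 : Nat.card {p : Equiv.Perm (Fin (n + 1)) × Finset ℕ //
      Crit k (n + 1) (ND p.1) p.2 ∧ p.2.card = t} =
      Nat.card {p : Equiv.Perm (Fin (n + 1)) × Finset (Fin n) // IsCriticalPair n k t p} := by
    refine Nat.card_congr (Equiv.ofBijective (fun p => ⟨(p.1.1, TS n k p.1.2), by
      have := critical_of_crit hk p.2.1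
      rw [p.2.2] at this
      exact this⟩) ⟨?_, ?_⟩)
    · rintro ⟨⟨w, S⟩, h1, h2⟩ ⟨⟨w', S'⟩, h1', h2'⟩ he
      simp only [Subtype.mk.injEq, Prod.mk.injEq] at he
      obtain ⟨rfl, he⟩ := he
      have : S = S' := Finset.Subset.antisymm (TS_inj hk h1 he) (TS_inj hk h1' he.symm)
      subst this
      rfl
    · rintro ⟨⟨w, T⟩, h⟩
      obtain ⟨S, h1, h2, rfl⟩ := crit_of_critical hk h
      exact ⟨⟨(w, S), h1, h2⟩, rfl⟩
  rw [← e1]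
  refine Nat.card_congr (Equiv.ofBijective (fun p => ⟨(pl p.1.1, p.1.2), pl_nodup _, pl_mem _, by
      rw [pl_length, LD_pl]
      exact p.2.1, p.2.2⟩) ⟨?_, ?_⟩)
  · rintro ⟨⟨w, S⟩, h1, h2⟩ ⟨⟨w', S'⟩, h1', h2'⟩ he
    simp only [Subtype.mk.injEq, Prod.mk.injEq] at he
    obtain ⟨hw, rfl⟩ := he
    obtain rfl := pl_inj hw
    rfl
  · rintro ⟨⟨l, S⟩, h1, h2, h3, h4⟩
    obtain ⟨w, rfl⟩ := pl_surj h1 h2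
    rw [pl_length, LD_pl] at h3
    exact ⟨⟨(w, S), h3, h4⟩, rfl⟩

end critical

theorem betti_of_k_equal_complement_eq_card_critical_pairs (n k : ℕ)
    (hk : 3 ≤ k) (hkn : k ≤ n) (t : ℕ) :
    Nonempty
      ((singularHomology (TopCat.of (kEqualComplement n k)) (t * (k - 2))) ≃ₗ[ℤ]
        (Fin (Nat.card {p : Equiv.Perm (Fin (n + 1)) × Finset (Fin n) //
            IsCriticalPair n k t p}) → ℤ)) := by
  rw [critical_count hk t]
  exact kEqual_homology hk n t
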